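/- Let Ω be an n-connected quadrature domain of finite area with no degenerate boundary components, let K be its Bergman kernel, and suppose K̂ is a continuous function on (closure(Ω) × closure(Ω)) \ {(z, z) : z ∈ ∂Ω} that agrees with K on Ω × Ω. Then there exist polynomials P, Q ∈ ℂ[X₁,X₂,X₃,X₄] such that the function (z,w) ↦ Q(z, conj(z), w, conj(w)) is not identically zero on {(z,w) ∈ ∂Ω × ∂Ω : z ≠ w} and K̂(z,w)·Q(z, conj(z), w, conj(w)) = P(z, conj(z), w, conj(w)) for all z, w ∈ ∂Ω with z ≠ w; that is, the Bergman kernel is a rational function of z, conj(z), w, conj(w) on ∂Ω × ∂Ω minus the boundary diagonal. -/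

import Mathlib

open MeasureTheory Complex ComplexConjugate Metric Set

noncomputable section

/-- `f` belongs to the Bergman space `A²(Ω)`. -/
def BergmanFun (Ω : Set ℂ) (f : ℂ → ℂ) : Prop :=
  DifferentiableOn ℂ f Ω ∧ IntegrableOn (fun z => ‖f z‖ ^ 2) Ω volume

/-- `Ω` is a finitely connected domain none of whose complementary components is a point. -/
def IsFinConnDomain (Ω : Set ℂ) : Prop :=
  IsOpen Ω ∧ IsConnected Ω ∧
  {C : Set ℂ | ∃ x ∈ Ωᶜ, C = connectedComponentIn Ωᶜ x}.Finite ∧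
  ∀ x ∈ Ωᶜ, ¬ (connectedComponentIn Ωᶜ x).Subsingleton

/-- `Ω` is a quadrature domain. -/
def IsQuadratureDomain (Ω : Set ℂ) : Prop :=
  ∃ N : ℕ, 0 < N ∧ ∃ (w : Fin N → ℂ) (n : Fin N → ℕ) (c : Fin N → ℕ → ℂ),
    (∀ j, w j ∈ Ω) ∧
    ∀ f : ℂ → ℂ, BergmanFun Ω f →
      (∫ z in Ω, f z) =
        ∑ j, ∑ k ∈ Finset.range (n j + 1), c j k * iteratedDerivWithin k f Ω (w j)

/-- `fa` is an Ahlfors map of `Ω` at `a`. -/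
def IsAhlforsMap (Ω : Set ℂ) (a : ℂ) (fa : ℂ → ℂ) : Prop :=
  DifferentiableOn ℂ fa Ω ∧ (∀ z ∈ Ω, ‖fa z‖ < 1) ∧
  (deriv fa a).im = 0 ∧ 0 < (deriv fa a).re ∧
  ∀ g : ℂ → ℂ, DifferentiableOn ℂ g Ω → (∀ z ∈ Ω, ‖g z‖ < 1) →
    ‖deriv g a‖ ≤ (deriv fa a).re

/-- `Ω` is bounded with `C^∞` smooth boundary consisting of finitely many disjoint
simple closed curves. -/
def HasSmoothBoundary (Ω : Set ℂ) : Prop :=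
  Bornology.IsBounded Ω ∧
  ∃ (n : ℕ) (γ : Fin n → ℝ → ℂ),
    (∀ i, ContDiff ℝ (⊤ : ℕ∞) (γ i)) ∧
    (∀ i, Function.Periodic (γ i) (2 * Real.pi)) ∧
    (∀ i, InjOn (γ i) (Ico 0 (2 * Real.pi))) ∧
    (∀ i t, deriv (γ i) t ≠ 0) ∧
    (Pairwise fun i j => Disjoint (range (γ i)) (range (γ j))) ∧
    frontier Ω = ⋃ i, range (γ i)

/-- Partial derivative in the `x`-direction of a real-valued function on `ℂ`. -/
def pdx (u : ℂ → ℝ) (z : ℂ) : ℝ := deriv (fun t : ℝ => u (z + (t : ℂ))) 0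

/-- Partial derivative in the `y`-direction of a real-valued function on `ℂ`. -/
def pdy (u : ℂ → ℝ) (z : ℂ) : ℝ := deriv (fun t : ℝ => u (z + (t : ℂ) * Complex.I)) 0

/-- `f` is a proper holomorphic map of `Ω` onto the open unit disc. -/
def IsProperOntoDisc (Ω : Set ℂ) (f : ℂ → ℂ) : Prop :=
  DifferentiableOn ℂ f Ω ∧ f '' Ω = ball (0 : ℂ) 1 ∧
  ∀ L : Set ℂ, L ⊆ ball (0 : ℂ) 1 → IsCompact L → IsCompact (Ω ∩ f ⁻¹' L)

/-- `g` is `(m, δ)`-close to the identity on `closure Ω`. -/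
def CloseToId (Ω : Set ℂ) (m : ℕ) (δ : ℝ) (g : ℂ → ℂ) : Prop :=
  ∀ k ≤ m, ∀ z ∈ closure Ω, ‖iteratedFDeriv ℝ k (fun w => g w - w) z‖ ≤ δ

/-- `σ : [0,1] → ℂ` is a piecewise continuously differentiable curve. -/
def PiecewiseC1On01 (σ : ℝ → ℂ) : Prop :=
  ContinuousOn σ (Icc 0 1) ∧ ∃ s : Finset ℝ, ContDiffOn ℝ 1 σ (Icc (0 : ℝ) 1 \ s)

/-- `Ω` is a generalized quadrature domain. -/
def IsGenQuadratureDomain (Ω : Set ℂ) : Prop :=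
  ∃ (N M : ℕ) (w : Fin N → ℂ) (n : Fin N → ℕ) (c : Fin N → ℕ → ℂ)
    (b : Fin M → ℂ) (σ : Fin M → ℝ → ℂ),
    (∀ j, w j ∈ Ω) ∧
    (∀ m, PiecewiseC1On01 (σ m)) ∧
    (∀ m, ∀ t ∈ Icc (0 : ℝ) 1, σ m t ∈ Ω) ∧
    ∀ f : ℂ → ℂ, BergmanFun Ω f →
      (∫ z in Ω, f z) =
        (∑ j, ∑ k ∈ Finset.range (n j + 1), c j k * iteratedDerivWithin k f Ω (w j)) +
        ∑ m, b m * ∫ t in (0 : ℝ)..1, f (σ m t) * deriv (σ m) t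

open Topology Filter

theorem integral_fderiv_det_eq_zero {a b : ℂ → ℝ} (ha : ContDiff ℝ 2 a) (hb : ContDiff ℝ 2 b)
    (hac : HasCompactSupport a) (u v : ℂ) :
    ∫ z, (fderiv ℝ a z u * fderiv ℝ b z v - fderiv ℝ a z v * fderiv ℝ b z u) = 0 := by
  have hfb : ContDiff ℝ 1 (fderiv ℝ b) := hb.fderiv_right (by norm_num)
  have hbv : ∀ v, ContDiff ℝ 1 (fun z => fderiv ℝ b z v) := fun v => hfb.clm_apply contDiff_const
  have hca : ∀ v, Continuous (fun z => fderiv ℝ a z v) := fun v =>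
    (ha.continuous_fderiv (by norm_num)).clm_apply continuous_const
  have hcb : ∀ u v, Continuous (fun z => fderiv ℝ (fun z => fderiv ℝ b z v) z u) := fun u v =>
    ((hbv v).continuous_fderiv (by norm_num)).clm_apply continuous_const
  have hsa : ∀ v, HasCompactSupport (fun z => fderiv ℝ a z v) := fun v =>
    hac.fderiv_apply (𝕜 := ℝ) v
  have i1 : ∀ u v, Integrable (fun z => fderiv ℝ a z u * fderiv ℝ b z v) := fun u v =>
    ((hca u).mul (hbv v).continuous).integrable_of_hasCompactSupport ((hsa u).mul_right)
  have key : ∀ u v, ∫ z, a z * fderiv ℝ (fun z => fderiv ℝ b z v) z u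
      = - ∫ z, fderiv ℝ a z u * fderiv ℝ b z v := fun u v =>
    integral_mul_fderiv_eq_neg_fderiv_mul_of_integrable (i1 u v)
      ((ha.continuous.mul (hcb u v)).integrable_of_hasCompactSupport hac.mul_right)
      ((ha.continuous.mul (hbv v).continuous).integrable_of_hasCompactSupport hac.mul_right)
      (fun x _ => (ha.differentiable (by norm_num)).differentiableAt)
      (fun x _ => ((hbv v).differentiable (by norm_num)).differentiableAt)
  have sym : ∀ z, fderiv ℝ (fun z => fderiv ℝ b z v) z u = fderiv ℝ (fun z => fderiv ℝ b z u) z v := by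
    intro z
    have hd : DifferentiableAt ℝ (fderiv ℝ b) z := (hfb.differentiable (by norm_num)).differentiableAt
    rw [fderiv_clm_apply hd (differentiableAt_const _), fderiv_clm_apply hd (differentiableAt_const _)]
    have := (hb.contDiffAt (x := z)).isSymmSndFDerivAt (by simp)
    simpa using this u v
  rw [integral_sub (i1 u v) (i1 v u)]
  have h1 := key u v
  have h2 := key v u
  simp_rw [sym] at h1
  linarith

/-- A smooth odd nondecreasing function vanishing near `0` and equal to the identity far away. -/
def flatCut (t : ℝ) : ℝ := t * Real.smoothTransition (t ^ 2 - 1)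

theorem contDiff_flatCut : ContDiff ℝ 2 flatCut := by
  have : ContDiff ℝ 2 Real.smoothTransition := Real.smoothTransition.contDiff (n := 2)
  unfold flatCut
  fun_prop

theorem flatCut_eq_zero {t : ℝ} (ht : |t| ≤ 1) : flatCut t = 0 := by
  have : t ^ 2 ≤ 1 := (sq_le_one_iff_abs_le_one t).2 ht
  rw [flatCut, Real.smoothTransition.zero_of_nonpos (by linarith), mul_zero]

theorem deriv_flatCut_nonneg (t : ℝ) : 0 ≤ deriv flatCut t := by
  have hs : Differentiable ℝ Real.smoothTransition :=
    (Real.smoothTransition.contDiff (n := 1)).differentiable (by norm_num)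
  have h1 : HasDerivAt (fun t : ℝ => t ^ 2 - 1) (2 * t) t := by
    simpa using (hasDerivAt_pow 2 t).sub_const 1
  have h2 := (hasDerivAt_id t).mul ((hs (t ^ 2 - 1)).hasDerivAt.comp t h1)
  have h3 : deriv flatCut t = _ := h2.deriv
  rw [h3]
  have h4 : 0 ≤ deriv Real.smoothTransition (t ^ 2 - 1) := Real.smoothTransition.monotone.deriv_nonneg
  have h5 := Real.smoothTransition.nonneg (t ^ 2 - 1)
  simp only [Function.comp, id, one_mul]
  nlinarith [mul_nonneg h4 (sq_nonneg t)]

theorem deriv_flatCut_eq_one {t : ℝ} (ht : 2 < |t|) : deriv flatCut t = 1 := by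
  have : flatCut =ᶠ[𝓝 t] id := by
    filter_upwards [(continuous_abs.tendsto t).eventually (lt_mem_nhds ht)] with s hs
    have : 2 ≤ s ^ 2 := by rw [← sq_abs]; nlinarith
    rw [flatCut, Real.smoothTransition.one_of_one_le (by linarith), mul_one, id]
  rw [this.deriv_eq, deriv_id]

theorem exists_deriv_flatCut_le : ∃ C, 0 < C ∧ ∀ t, deriv flatCut t ≤ C := by
  have hc : Continuous (deriv flatCut) := contDiff_flatCut.continuous_deriv (by norm_num)
  obtain ⟨C, hC⟩ := (isCompact_Icc (a := (-2 : ℝ)) (b := 2)).bddAbove_image hc.continuousOn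
  refine ⟨max C 1, by positivity, fun t => ?_⟩
  by_cases h : |t| ≤ 2
  · exact le_max_of_le_left (hC ⟨t, abs_le.1 h, rfl⟩)
  · rw [deriv_flatCut_eq_one (not_le.1 h)]; exact le_max_right _ _

/-- The rescaled cut-off `t ↦ ε flatCut (t / ε)`. -/
def flatCutScale (ε t : ℝ) : ℝ := ε * flatCut (t / ε)

theorem contDiff_flatCutScale (ε : ℝ) : ContDiff ℝ 2 (flatCutScale ε) := by
  have := contDiff_flatCut
  unfold flatCutScale
  fun_prop

theorem flatCutScale_eq_zero {ε t : ℝ} (hε : 0 < ε) (ht : |t| ≤ ε) : flatCutScale ε t = 0 := by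
  rw [flatCutScale, flatCut_eq_zero, mul_zero]
  rw [abs_div, abs_of_pos hε]
  exact (div_le_one hε).2 ht

theorem deriv_flatCutScale {ε : ℝ} (hε : 0 < ε) (t : ℝ) :
    deriv (flatCutScale ε) t = deriv flatCut (t / ε) := by
  have h1 : HasDerivAt (fun t : ℝ => t / ε) (1 / ε) t := (hasDerivAt_id t).div_const ε
  have h2 := ((contDiff_flatCut.differentiable (by norm_num) (t / ε)).hasDerivAt.comp t h1).const_mul ε
  have h3 : deriv (flatCutScale ε) t = _ := h2.deriv
  rw [h3]; field_simp

theorem deriv_flatCutScale_eventually_one {ε : ℕ → ℝ} (hε : ∀ n, 0 < ε n)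
    (h0 : Tendsto ε atTop (𝓝 0)) {t : ℝ} (ht : t ≠ 0) :
    ∀ᶠ n in atTop, deriv (flatCutScale (ε n)) t = 1 := by
  have : (0 : ℝ) < |t| / 2 := by positivity
  filter_upwards [h0.eventually (gt_mem_nhds this)] with n hn
  rw [deriv_flatCutScale (hε n), deriv_flatCut_eq_one]
  rw [abs_div, abs_of_pos (hε n), lt_div_iff₀ (hε n)]
  linarith

theorem integral_fderiv_apply_eq_zero {F : ℂ → ℂ} (hF : ContDiff ℝ 1 F)
    (hc : HasCompactSupport F) (v : ℂ) : ∫ z, fderiv ℝ F z v = 0 := by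
  have h1 : Continuous fun z => fderiv ℝ F z v :=
    (hF.continuous_fderiv (by norm_num)).clm_apply continuous_const
  have := integral_mul_fderiv_eq_neg_fderiv_mul_of_integrable (μ := volume) (f := F)
    (g := fun _ => (1 : ℂ)) (v := v)
    (by simpa using h1.integrable_of_hasCompactSupport (hc.fderiv_apply (𝕜 := ℝ) v))
    (by simp) (by simpa using hF.continuous.integrable_of_hasCompactSupport hc)
    (fun x _ => (hF.differentiable (by norm_num)).differentiableAt)
    (fun x _ => differentiableAt_const _)
  simpa using this.symm

section Cut

variable {Ω : Set ℂ} {f : ℂ → ℝ}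

theorem tsupport_flatCutScale_subset (hf : Continuous f) (h0 : ∀ z ∉ Ω, f z = 0)
    {ε : ℝ} (hε : 0 < ε) : tsupport (flatCutScale ε ∘ f) ⊆ Ω := by
  have h1 : tsupport (flatCutScale ε ∘ f) ⊆ {z | ε ≤ |f z|} := by
    refine closure_minimal (fun z hz => ?_) (isClosed_le continuous_const hf.abs)
    by_contra h
    exact hz (flatCutScale_eq_zero hε (le_of_lt (not_le.1 h)))
  intro z hz
  by_contra h
  have : ε ≤ |f z| := h1 hz
  rw [h0 z h, abs_zero] at this
  linarith

theorem hasCompactSupport_flatCutScale (hb : Bornology.IsBounded Ω) (hf : Continuous f)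
    (h0 : ∀ z ∉ Ω, f z = 0) {ε : ℝ} (hε : 0 < ε) : HasCompactSupport (flatCutScale ε ∘ f) :=
  Metric.isCompact_of_isClosed_isBounded (isClosed_tsupport _)
    (hb.subset (tsupport_flatCutScale_subset hf h0 hε))

theorem contDiff_flatCutScale_comp (ho : IsOpen Ω) (hf : Continuous f) (h0 : ∀ z ∉ Ω, f z = 0)
    (hd : ContDiffOn ℝ 2 f Ω) {ε : ℝ} (hε : 0 < ε) : ContDiff ℝ 2 (flatCutScale ε ∘ f) := by
  refine contDiff_iff_contDiffAt.2 fun z => ?_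
  by_cases hz : z ∈ tsupport (flatCutScale ε ∘ f)
  swap
  · exact contDiffAt_const.congr_of_eventuallyEq (notMem_tsupport_iff_eventuallyEq.1 hz)
  have hz : z ∈ Ω := tsupport_flatCutScale_subset hf h0 hε hz
  exact (contDiff_flatCutScale ε).contDiffAt.comp z (hd.contDiffAt (ho.mem_nhds hz))

theorem fderiv_flatCutScale_comp (ho : IsOpen Ω) (hf : Continuous f) (h0 : ∀ z ∉ Ω, f z = 0)
    (hd : ContDiffOn ℝ 2 f Ω) {ε : ℝ} (hε : 0 < ε) (z : ℂ) :
    fderiv ℝ (flatCutScale ε ∘ f) z = deriv flatCut (f z / ε) • fderiv ℝ f z := by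
  by_cases hz : z ∈ Ω
  · have h1 : DifferentiableAt ℝ f z :=
      (hd.contDiffAt (ho.mem_nhds hz)).differentiableAt (by norm_num)
    rw [← deriv_flatCutScale hε]
    exact ((((contDiff_flatCutScale ε).differentiable (by norm_num)
      (f z)).hasDerivAt).comp_hasFDerivAt z h1.hasFDerivAt).fderiv
  · have : deriv flatCut (f z / ε) = 0 := by
      rw [h0 z hz, zero_div]
      have : flatCut =ᶠ[𝓝 0] fun _ => 0 := by
        filter_upwards [Metric.ball_mem_nhds (0 : ℝ) one_pos] with t ht
        exact flatCut_eq_zero (by simpa using (Metric.mem_ball.1 ht).le)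
      rw [this.deriv_eq, deriv_const]
    rw [this, zero_smul]
    have h2 : z ∉ tsupport (flatCutScale ε ∘ f) := fun h =>
      hz (tsupport_flatCutScale_subset hf h0 hε h)
    exact image_eq_zero_of_notMem_tsupport fun h => h2 (tsupport_fderiv_subset ℝ h)

/-- At almost every zero of a differentiable function its derivative vanishes. -/
theorem ae_fderiv_eq_zero_of_eq_zero (ho : IsOpen Ω) (hf : Continuous f)
    (hd : ContDiffOn ℝ 2 f Ω) : ∀ᵐ z ∂volume.restrict Ω, f z = 0 → fderiv ℝ f z = 0 := by
  set s : Set ℂ := Ω ∩ {z | f z = 0}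
  have hs : MeasurableSet s := ho.measurableSet.inter (isClosed_eq hf continuous_const).measurableSet
  have happ : ApproximatesLinearOn (fun z => (f z : ℂ)) (0 : ℂ →L[ℝ] ℂ) s 0 := by
    intro x hx y hy
    have h1 : f x = 0 := hx.2
    have h2 : f y = 0 := hy.2
    simp [h1, h2]
  have hdiff : ∀ z ∈ Ω, HasFDerivAt f (fderiv ℝ f z) z := fun z hz =>
    ((hd.contDiffAt (ho.mem_nhds hz)).differentiableAt (by norm_num)).hasFDerivAt
  have key := happ.norm_fderiv_sub_le volume hs
    (fun z => Complex.ofRealCLM ∘L fderiv ℝ f z) (fun z hz =>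
      (Complex.ofRealCLM.hasFDerivAt.comp z (hdiff z hz.1)).hasFDerivWithinAt)
  rw [ae_restrict_iff' hs] at key
  rw [ae_restrict_iff' ho.measurableSet]
  filter_upwards [key] with z hz hzΩ h0
  have h1 := hz ⟨hzΩ, h0⟩
  simp only [sub_zero, nonpos_iff_eq_zero, nnnorm_eq_zero] at h1
  ext v
  have := congrArg (fun L => L v) h1
  simpa using this

theorem ae_eventually_fderiv_flatCutScale (ho : IsOpen Ω) (hf : Continuous f)
    (h0 : ∀ z ∉ Ω, f z = 0) (hd : ContDiffOn ℝ 2 f Ω) {ε : ℕ → ℝ} (hε : ∀ n, 0 < ε n)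
    (hε0 : Tendsto ε atTop (𝓝 0)) : ∀ᵐ z ∂volume.restrict Ω, ∀ᶠ n in atTop,
      fderiv ℝ (flatCutScale (ε n) ∘ f) z = fderiv ℝ f z := by
  filter_upwards [ae_fderiv_eq_zero_of_eq_zero ho hf hd] with z hz
  by_cases h : f z = 0
  · refine Eventually.of_forall fun n => ?_
    rw [fderiv_flatCutScale_comp ho hf h0 hd (hε n), hz h, smul_zero]
  · filter_upwards [deriv_flatCutScale_eventually_one hε hε0 h] with n hn
    rw [deriv_flatCutScale (hε n)] at hn
    rw [fderiv_flatCutScale_comp ho hf h0 hd (hε n), hn, one_smul]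

end Cut

section Energy

variable {Ω : Set ℂ} {φ : ℂ → ℂ}

theorem fderiv_apply_eq_re_im {z : ℂ} (h : DifferentiableAt ℝ φ z) (v : ℂ) :
    fderiv ℝ φ z v = (fderiv ℝ (fun z => (φ z).re) z v : ℂ) +
      (fderiv ℝ (fun z => (φ z).im) z v : ℂ) * I := by
  have h1 := (reCLM.hasFDerivAt.comp z h.hasFDerivAt).fderiv
  have h2 := (imCLM.hasFDerivAt.comp z h.hasFDerivAt).fderiv
  have h1' : fderiv ℝ (fun z => (φ z).re) z = reCLM ∘L fderiv ℝ φ z := h1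
  have h2' : fderiv ℝ (fun z => (φ z).im) z = imCLM ∘L fderiv ℝ φ z := h2
  rw [h1', h2']
  simp [re_add_im]

theorem continuousOn_fderiv_apply {E : Type*} [NormedAddCommGroup E] [NormedSpace ℝ E] {φ : ℂ → E}
    (ho : IsOpen Ω) (hd : ContDiffOn ℝ 2 φ Ω) (v : ℂ) :
    ContinuousOn (fun z => fderiv ℝ φ z v) Ω :=
  (hd.continuousOn_fderiv_of_isOpen ho (by norm_num)).clm_apply continuousOn_const

theorem integrableOn_sq_norm_fderiv (ho : IsOpen Ω) (hb : Bornology.IsBounded Ω)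
    (hφ : Continuous φ) (h0 : ∀ z ∉ Ω, φ z = 0) (hd : ContDiffOn ℝ 2 φ Ω) {M : ℝ}
    (hM : ∀ z ∈ Ω, ‖fderiv ℝ φ z 1 + I * fderiv ℝ φ z I‖ ≤ M) :
    IntegrableOn (fun z => ‖fderiv ℝ φ z 1‖ ^ 2 + ‖fderiv ℝ φ z I‖ ^ 2) Ω := by
  obtain ⟨C, hC0, hC⟩ := exists_deriv_flatCut_le
  set a : ℂ → ℝ := fun z => (φ z).re with ha
  set b : ℂ → ℝ := fun z => (φ z).im with hb'
  have hac : Continuous a := continuous_re.comp hφ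
  have hbc : Continuous b := continuous_im.comp hφ
  have ha0 : ∀ z ∉ Ω, a z = 0 := fun z hz => by simp [ha, h0 z hz]
  have hb0 : ∀ z ∉ Ω, b z = 0 := fun z hz => by simp [hb', h0 z hz]
  have had : ContDiffOn ℝ 2 a Ω := reCLM.contDiff.comp_contDiffOn hd
  have hbd : ContDiffOn ℝ 2 b Ω := imCLM.contDiff.comp_contDiffOn hd
  set E : ℂ → ℝ := fun z => ‖fderiv ℝ φ z 1‖ ^ 2 + ‖fderiv ℝ φ z I‖ ^ 2 with hE
  set P : ℂ → ℝ := fun z => ‖fderiv ℝ φ z 1 + I * fderiv ℝ φ z I‖ ^ 2 with hP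
  set d : ℂ → ℝ := fun z => fderiv ℝ a z 1 * fderiv ℝ b z I - fderiv ℝ a z I * fderiv ℝ b z 1 with hd'
  have hEeq : ∀ z ∈ Ω, E z = P z + 2 * d z := by
    intro z hz
    have h1 : DifferentiableAt ℝ φ z := (hd.contDiffAt (ho.mem_nhds hz)).differentiableAt (by norm_num)
    simp only [hE, hP, hd', fderiv_apply_eq_re_im h1, ← normSq_eq_norm_sq, normSq_apply]
    simp
    ring
  have hPM : ∀ z ∈ Ω, P z ≤ M ^ 2 := fun z hz => pow_le_pow_left₀ (norm_nonneg _) (hM z hz) 2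
  have hP0 : ∀ z, 0 ≤ P z := fun z => sq_nonneg _
  have hE0 : ∀ z, 0 ≤ E z := fun z => by positivity
  have hEc : ContinuousOn E Ω := ((continuousOn_fderiv_apply ho hd 1).norm.pow 2).add
    ((continuousOn_fderiv_apply ho hd I).norm.pow 2)
  have hPc : ContinuousOn P Ω := ((continuousOn_fderiv_apply ho hd 1).add
    (continuousOn_const.mul (continuousOn_fderiv_apply ho hd I))).norm.pow 2
  have hvol : volume Ω < ⊤ := hb.measure_lt_top
  set ε : ℕ → ℝ := fun n => 1 / ((n : ℝ) + 1) with hεdef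
  have hε : ∀ n, 0 < ε n := fun n => by positivity
  have hε0 : Tendsto ε atTop (𝓝 0) := tendsto_one_div_add_atTop_nhds_zero_nat
  set J : ℕ → ℂ → ℝ := fun n z => deriv flatCut (a z / ε n) * deriv flatCut (b z / ε n) with hJ
  have hcf : Continuous (deriv flatCut) := contDiff_flatCut.continuous_deriv (by norm_num)
  have hJc : ∀ n, Continuous (J n) := fun n =>
    (hcf.comp (hac.div_const _)).mul (hcf.comp (hbc.div_const _))
  have hJ0 : ∀ n z, 0 ≤ J n z := fun n z =>
    mul_nonneg (deriv_flatCut_nonneg _) (deriv_flatCut_nonneg _)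
  have hJC : ∀ n z, J n z ≤ C * C := fun n z =>
    mul_le_mul (hC _) (hC _) (deriv_flatCut_nonneg _) hC0.le
  have hdet : ∀ n, IntegrableOn (fun z => J n z * d z) Ω ∧ ∫ z in Ω, J n z * d z = 0 := by
    intro n
    have ca := contDiff_flatCutScale_comp ho hac ha0 had (hε n)
    have cb := contDiff_flatCutScale_comp ho hbc hb0 hbd (hε n)
    have sa := hasCompactSupport_flatCutScale hb hac ha0 (hε n)
    have h1 := integral_fderiv_det_eq_zero ca cb sa 1 I
    have h2 : ∀ z, fderiv ℝ (flatCutScale (ε n) ∘ a) z 1 * fderiv ℝ (flatCutScale (ε n) ∘ b) z I -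
        fderiv ℝ (flatCutScale (ε n) ∘ a) z I * fderiv ℝ (flatCutScale (ε n) ∘ b) z 1
        = J n z * d z := by
      intro z
      rw [fderiv_flatCutScale_comp ho hac ha0 had (hε n),
        fderiv_flatCutScale_comp ho hbc hb0 hbd (hε n)]
      simp only [hJ, hd', _root_.smul_apply, smul_eq_mul]
      ring
    have hi : Integrable (fun z => J n z * d z) := by
      simp_rw [← h2]
      have cfa : ∀ v, Continuous fun z => fderiv ℝ (flatCutScale (ε n) ∘ a) z v := fun v =>
        (ca.continuous_fderiv (by norm_num)).clm_apply continuous_const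
      have cfb : ∀ v, Continuous fun z => fderiv ℝ (flatCutScale (ε n) ∘ b) z v := fun v =>
        (cb.continuous_fderiv (by norm_num)).clm_apply continuous_const
      have i1 : ∀ u v, Integrable (fun z => fderiv ℝ (flatCutScale (ε n) ∘ a) z u *
          fderiv ℝ (flatCutScale (ε n) ∘ b) z v) := fun u v =>
        ((cfa u).mul (cfb v)).integrable_of_hasCompactSupport
          ((sa.fderiv_apply (𝕜 := ℝ) u).mul_right)
      exact (i1 _ _).sub (i1 _ _)
    refine ⟨hi.integrableOn, ?_⟩
    simp_rw [h2] at h1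
    rw [setIntegral_eq_integral_of_forall_compl_eq_zero, h1]
    intro z hz
    rw [← h2]
    have h3 : z ∉ tsupport (flatCutScale (ε n) ∘ a) := fun h =>
      hz (tsupport_flatCutScale_subset hac ha0 (hε n) h)
    rw [image_eq_zero_of_notMem_tsupport (f := fderiv ℝ (flatCutScale (ε n) ∘ a))
      fun h => h3 (tsupport_fderiv_subset ℝ h)]
    simp
  have hbound : ∀ n, ∫⁻ z in Ω, ENNReal.ofReal (J n z * E z) ≤
      ENNReal.ofReal (C * C * M ^ 2 * volume.real Ω) := by
    intro n
    have iP : IntegrableOn (fun z => J n z * P z) Ω := by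
      refine IntegrableOn.of_bound hvol
        (((hJc n).continuousOn.mul hPc).aestronglyMeasurable ho.measurableSet) (C * C * M ^ 2) ?_
      filter_upwards [ae_restrict_mem ho.measurableSet] with z hz
      rw [Real.norm_of_nonneg (mul_nonneg (hJ0 n z) (hP0 z))]
      exact mul_le_mul (hJC n z) (hPM z hz) (hP0 z) (by positivity)
    have heq : ∀ z ∈ Ω, J n z * E z = J n z * P z + 2 * (J n z * d z) := by
      intro z hz; rw [hEeq z hz]; ring
    have iE : IntegrableOn (fun z => J n z * E z) Ω :=
      (iP.add ((hdet n).1.const_mul 2)).congr_fun (fun z hz => (heq z hz).symm) ho.measurableSet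
    rw [← ofReal_integral_eq_lintegral_ofReal iE
      (Eventually.of_forall fun z => mul_nonneg (hJ0 n z) (hE0 z))]
    refine ENNReal.ofReal_le_ofReal ?_
    rw [setIntegral_congr_fun ho.measurableSet heq, integral_add iP ((hdet n).1.const_mul 2),
      integral_const_mul, (hdet n).2, mul_zero, add_zero]
    calc ∫ z in Ω, J n z * P z ≤ ∫ z in Ω, C * C * M ^ 2 := by
          refine setIntegral_mono_on iP (integrableOn_const hvol.ne) ho.measurableSet fun z hz => ?_
          exact mul_le_mul (hJC n z) (hPM z hz) (hP0 z) (by positivity)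
      _ = _ := by simp [mul_comm]
  have hfin : ∫⁻ z in Ω, ENNReal.ofReal (E z) < ⊤ := by
    calc ∫⁻ z in Ω, ENNReal.ofReal (E z)
        ≤ ∫⁻ z in Ω, (liminf (fun n => ENNReal.ofReal (J n z * E z)) atTop
            + ENNReal.ofReal (M ^ 2)) := by
          refine lintegral_mono_ae ?_
          filter_upwards [ae_restrict_mem ho.measurableSet, ae_fderiv_eq_zero_of_eq_zero ho hac had,
            ae_fderiv_eq_zero_of_eq_zero ho hbc hbd] with z hz h1 h2
          by_cases hzero : a z = 0 ∨ b z = 0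
          · have : d z = 0 := by
              rcases hzero with h | h
              · simp [hd', h1 h]
              · simp [hd', h2 h]
            refine le_add_left (ENNReal.ofReal_le_ofReal ?_)
            rw [hEeq z hz, this]; linarith [hPM z hz]
          · push Not at hzero
            refine le_add_right ?_
            have : (fun n => ENNReal.ofReal (J n z * E z)) =ᶠ[atTop] fun _ => ENNReal.ofReal (E z) := by
              filter_upwards [deriv_flatCutScale_eventually_one hε hε0 hzero.1,
                deriv_flatCutScale_eventually_one hε hε0 hzero.2] with n e1 e2
              rw [deriv_flatCutScale (hε n)] at e1 e2
              simp [hJ, e1, e2]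
            rw [liminf_congr this]
            simp
      _ = (∫⁻ z in Ω, liminf (fun n => ENNReal.ofReal (J n z * E z)) atTop)
            + ENNReal.ofReal (M ^ 2) * volume Ω := by
          rw [lintegral_add_right _ measurable_const]; simp
      _ ≤ ENNReal.ofReal (C * C * M ^ 2 * volume.real Ω) + ENNReal.ofReal (M ^ 2) * volume Ω := by
          gcongr
          refine (lintegral_liminf_le' fun n => ?_).trans ?_
          · exact (((hJc n).continuousOn.mul hEc).aemeasurable ho.measurableSet).ennreal_ofReal
          · exact (liminf_le_liminf (Eventually.of_forall hbound)).trans (by simp)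
      _ < ⊤ := by
          refine ENNReal.add_lt_top.2 ⟨ENNReal.ofReal_lt_top, ENNReal.mul_lt_top ENNReal.ofReal_lt_top hvol⟩
  exact (lintegral_ofReal_ne_top_iff_integrable (hEc.aestronglyMeasurable ho.measurableSet)
    (Eventually.of_forall hE0)).1 hfin.ne

theorem integrableOn_norm_fderiv (ho : IsOpen Ω) (hb : Bornology.IsBounded Ω)
    (hφ : Continuous φ) (h0 : ∀ z ∉ Ω, φ z = 0) (hd : ContDiffOn ℝ 2 φ Ω) {M : ℝ}
    (hM : ∀ z ∈ Ω, ‖fderiv ℝ φ z 1 + I * fderiv ℝ φ z I‖ ≤ M) :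
    IntegrableOn (fun z => ‖fderiv ℝ φ z 1‖) Ω ∧ IntegrableOn (fun z => ‖fderiv ℝ φ z I‖) Ω := by
  have h := integrableOn_sq_norm_fderiv ho hb hφ h0 hd hM
  have h1 : IntegrableOn (fun _ => (1 : ℝ)) Ω := integrableOn_const hb.measure_lt_top.ne
  constructor
  · refine (h1.add h).mono'
      ((continuousOn_fderiv_apply ho hd 1).norm.aestronglyMeasurable ho.measurableSet)
      (Eventually.of_forall fun z => ?_)
    rw [norm_norm, Pi.add_apply]
    nlinarith [sq_nonneg (‖fderiv ℝ φ z 1‖ - 1), sq_nonneg ‖fderiv ℝ φ z I‖,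
      sq_nonneg ‖fderiv ℝ φ z 1‖]
  · refine (h1.add h).mono'
      ((continuousOn_fderiv_apply ho hd I).norm.aestronglyMeasurable ho.measurableSet)
      (Eventually.of_forall fun z => ?_)
    rw [norm_norm, Pi.add_apply]
    nlinarith [sq_nonneg (‖fderiv ℝ φ z I‖ - 1), sq_nonneg ‖fderiv ℝ φ z I‖,
      sq_nonneg ‖fderiv ℝ φ z 1‖]

theorem setIntegral_mul_fderiv_eq_zero (ho : IsOpen Ω) (hb : Bornology.IsBounded Ω)
    (hφ : Continuous φ) (h0 : ∀ z ∉ Ω, φ z = 0) (hd : ContDiffOn ℝ 2 φ Ω) {M : ℝ}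
    (hM : ∀ z ∈ Ω, ‖fderiv ℝ φ z 1 + I * fderiv ℝ φ z I‖ ≤ M)
    {c : ℂ} {g : ℂ → ℂ} (hg : ContDiffOn ℝ 1 g Ω) {B : ℝ} (hB : ∀ z ∈ Ω, ‖g z‖ ≤ B)
    (hgc : ∀ z ∈ Ω, fderiv ℝ g z 1 + c * fderiv ℝ g z I = 0) :
    ∫ z in Ω, g z * (fderiv ℝ φ z 1 + c * fderiv ℝ φ z I) = 0 := by
  obtain ⟨C, hC0, hC⟩ := exists_deriv_flatCut_le
  set a : ℂ → ℝ := fun z => (φ z).re with ha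
  set b : ℂ → ℝ := fun z => (φ z).im with hb'
  have hac : Continuous a := continuous_re.comp hφ
  have hbc : Continuous b := continuous_im.comp hφ
  have ha0 : ∀ z ∉ Ω, a z = 0 := fun z hz => by simp [ha, h0 z hz]
  have hb0 : ∀ z ∉ Ω, b z = 0 := fun z hz => by simp [hb', h0 z hz]
  have had : ContDiffOn ℝ 2 a Ω := reCLM.contDiff.comp_contDiffOn hd
  have hbd : ContDiffOn ℝ 2 b Ω := imCLM.contDiff.comp_contDiffOn hd
  set ε : ℕ → ℝ := fun n => 1 / ((n : ℝ) + 1) with hεdef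
  have hε : ∀ n, 0 < ε n := fun n => by positivity
  have hε0 : Tendsto ε atTop (𝓝 0) := tendsto_one_div_add_atTop_nhds_zero_nat
  have hdiff : ∀ z ∈ Ω, DifferentiableAt ℝ φ z := fun z hz =>
    (hd.contDiffAt (ho.mem_nhds hz)).differentiableAt (by norm_num)
  set ψ : ℕ → ℂ → ℂ := fun n z =>
    ((flatCutScale (ε n) ∘ a) z : ℂ) + ((flatCutScale (ε n) ∘ b) z : ℂ) * I with hψ
  have ca := fun n => contDiff_flatCutScale_comp ho hac ha0 had (hε n)
  have cb := fun n => contDiff_flatCutScale_comp ho hbc hb0 hbd (hε n)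
  have hψd : ∀ n, ContDiff ℝ 2 (ψ n) := fun n =>
    (ofRealCLM.contDiff.comp (ca n)).add ((ofRealCLM.contDiff.comp (cb n)).mul contDiff_const)
  have hψf : ∀ n z v, fderiv ℝ (ψ n) z v = (fderiv ℝ (flatCutScale (ε n) ∘ a) z v : ℂ) +
      (fderiv ℝ (flatCutScale (ε n) ∘ b) z v : ℂ) * I := by
    intro n z v
    rw [fderiv_apply_eq_re_im ((hψd n).differentiable (by norm_num)).differentiableAt]
    have h1 : (fun z => (ψ n z).re) = flatCutScale (ε n) ∘ a := by ext z; simp [hψ]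
    have h2 : (fun z => (ψ n z).im) = flatCutScale (ε n) ∘ b := by ext z; simp [hψ]
    rw [h1, h2]
  have hψbound : ∀ n, ∀ z ∈ Ω, ∀ v, ‖fderiv ℝ (ψ n) z v‖ ≤ 2 * C * ‖fderiv ℝ φ z v‖ := by
    intro n z hz v
    have e := fderiv_apply_eq_re_im (hdiff z hz) v
    rw [hψf, fderiv_flatCutScale_comp ho hac ha0 had (hε n),
        fderiv_flatCutScale_comp ho hbc hb0 hbd (hε n)]
    have h1 : |fderiv ℝ a z v| ≤ ‖fderiv ℝ φ z v‖ := by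
      have := abs_re_le_norm (fderiv ℝ φ z v)
      rw [e] at this ⊢
      simpa using this
    have h2 : |fderiv ℝ b z v| ≤ ‖fderiv ℝ φ z v‖ := by
      have := abs_im_le_norm (fderiv ℝ φ z v)
      rw [e] at this ⊢
      simpa using this
    refine (norm_add_le _ _).trans ?_
    simp only [_root_.smul_apply, smul_eq_mul, norm_mul, norm_I, mul_one, norm_real,
      Real.norm_eq_abs, abs_of_nonneg (deriv_flatCut_nonneg _)]
    have e1 := mul_le_mul (hC (a z / ε n)) h1 (abs_nonneg _) hC0.le
    have e2 := mul_le_mul (hC (b z / ε n)) h2 (abs_nonneg _) hC0.le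
    linarith
  have hψs : ∀ n, tsupport (ψ n) ⊆ Ω := by
    intro n
    have : tsupport (ψ n) ⊆ tsupport (flatCutScale (ε n) ∘ a) ∪ tsupport (flatCutScale (ε n) ∘ b) := by
      refine closure_minimal (fun z hz => ?_) ((isClosed_tsupport _).union (isClosed_tsupport _))
      by_contra h
      simp only [mem_union, not_or] at h
      refine hz ?_
      simp only [hψ, image_eq_zero_of_notMem_tsupport h.1, image_eq_zero_of_notMem_tsupport h.2]
      simp
    exact this.trans (union_subset (tsupport_flatCutScale_subset hac ha0 (hε n))
      (tsupport_flatCutScale_subset hbc hb0 (hε n)))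
  have hzero : ∀ n, ∫ z in Ω, g z * (fderiv ℝ (ψ n) z 1 + c * fderiv ℝ (ψ n) z I) = 0 := by
    intro n
    set F : ℂ → ℂ := fun z => g z * ψ n z with hF
    have hFs : tsupport F ⊆ tsupport (ψ n) := by
      refine closure_mono fun z hz => ?_
      simp only [hF, Function.mem_support] at hz ⊢
      exact right_ne_zero_of_mul hz
    have hFc : HasCompactSupport F := Metric.isCompact_of_isClosed_isBounded (isClosed_tsupport _)
      (hb.subset (hFs.trans (hψs n)))
    have hFd : ContDiff ℝ 1 F := by
      refine contDiff_iff_contDiffAt.2 fun z => ?_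
      by_cases hz : z ∈ tsupport F
      · exact (hg.contDiffAt (ho.mem_nhds (hψs n (hFs hz)))).mul
          ((hψd n).of_le (by norm_num)).contDiffAt
      · exact contDiffAt_const.congr_of_eventuallyEq (notMem_tsupport_iff_eventuallyEq.1 hz)
    have hFi : ∀ v, Integrable (fun z => fderiv ℝ F z v) := fun v =>
      ((hFd.continuous_fderiv (by norm_num)).clm_apply
        continuous_const).integrable_of_hasCompactSupport (hFc.fderiv_apply (𝕜 := ℝ) v)
    have h1 : ∫ z, (fderiv ℝ F z 1 + c * fderiv ℝ F z I) = 0 := by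
      rw [integral_add (hFi 1) ((hFi I).const_mul c), integral_const_mul,
        integral_fderiv_apply_eq_zero hFd hFc, integral_fderiv_apply_eq_zero hFd hFc]
      simp
    refine Eq.trans ?_ ((setIntegral_eq_integral_of_forall_compl_eq_zero (s := Ω) ?_).trans h1)
    · refine setIntegral_congr_fun ho.measurableSet fun z hz => ?_
      have d1 : DifferentiableAt ℝ g z :=
        (hg.contDiffAt (ho.mem_nhds hz)).differentiableAt (by norm_num)
      have d2 : DifferentiableAt ℝ (ψ n) z := ((hψd n).differentiable (by norm_num)).differentiableAt
      have e : fderiv ℝ F z = g z • fderiv ℝ (ψ n) z + ψ n z • fderiv ℝ g z :=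
        (d1.hasFDerivAt.mul d2.hasFDerivAt).fderiv
      simp only [e, _root_.add_apply, _root_.smul_apply, smul_eq_mul]
      linear_combination -ψ n z * hgc z hz
    · intro z hz
      have : z ∉ tsupport F := fun h => hz (hψs n (hFs h))
      rw [image_eq_zero_of_notMem_tsupport (f := fderiv ℝ F)
        fun h => this (tsupport_fderiv_subset ℝ h)]
      simp
  obtain ⟨i1, i2⟩ := integrableOn_norm_fderiv ho hb hφ h0 hd hM
  have hlim : Tendsto (fun n => ∫ z in Ω, g z * (fderiv ℝ (ψ n) z 1 + c * fderiv ℝ (ψ n) z I)) atTop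
      (𝓝 (∫ z in Ω, g z * (fderiv ℝ φ z 1 + c * fderiv ℝ φ z I))) := by
    refine tendsto_integral_of_dominated_convergence
      (fun z => B * (2 * C * ‖fderiv ℝ φ z 1‖ + ‖c‖ * (2 * C * ‖fderiv ℝ φ z I‖))) ?_ ?_ ?_ ?_
    · intro n
      refine ContinuousOn.aestronglyMeasurable ?_ ho.measurableSet
      exact hg.continuousOn.mul ((continuousOn_fderiv_apply ho (hψd n).contDiffOn 1).add
        (continuousOn_const.mul (continuousOn_fderiv_apply ho (hψd n).contDiffOn I)))
    · exact ((i1.const_mul _).add ((i2.const_mul _).const_mul _)).const_mul _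
    · intro n
      filter_upwards [ae_restrict_mem ho.measurableSet] with z hz
      rw [norm_mul]
      refine mul_le_mul (hB z hz) ((norm_add_le _ _).trans ?_) (norm_nonneg _)
        ((norm_nonneg _).trans (hB z hz))
      rw [norm_mul]
      gcongr
      · exact hψbound n z hz 1
      · exact hψbound n z hz I
    · filter_upwards [ae_restrict_mem ho.measurableSet,
        ae_eventually_fderiv_flatCutScale ho hac ha0 had hε hε0,
        ae_eventually_fderiv_flatCutScale ho hbc hb0 hbd hε hε0] with z hz h1 h2
      refine tendsto_const_nhds.congr' ?_
      filter_upwards [h1, h2] with n e1 e2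
      simp only [hψf, e1, e2, fderiv_apply_eq_re_im (hdiff z hz)]
      rfl
  simp_rw [hzero] at hlim
  exact tendsto_nhds_unique hlim tendsto_const_nhds

end Energy

theorem integrableOn_inv_norm_ball (r : ℝ) : IntegrableOn (fun z : ℂ => ‖z‖⁻¹) (ball 0 r) := by
  refine (integrableOn_fun_norm_addHaar volume (f := fun y => y⁻¹)).2 ?_
  have : IntegrableOn (fun _ : ℝ => (1 : ℝ)) (Ioo 0 r) := integrableOn_const (by simp)
  refine this.congr_fun (fun y hy => ?_) measurableSet_Ioo
  have : y ≠ 0 := hy.1.ne'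
  simp [Complex.finrank_real_complex, this]

theorem integrableOn_inv_ball (r : ℝ) : IntegrableOn (fun z : ℂ => z⁻¹) (ball 0 r) :=
  (integrableOn_inv_norm_ball r).mono' measurable_inv.aestronglyMeasurable
    (Eventually.of_forall fun z => by simp)

theorem circleAverage_inv_sub_of_lt {w : ℂ} {ρ : ℝ} (h0 : 0 < ρ) (h : ρ < ‖w‖) :
    Real.circleAverage (fun y => (w - y)⁻¹) 0 ρ = w⁻¹ := by
  have hd : ∀ y ∈ closedBall (0 : ℂ) ρ, w - y ≠ 0 := by
    intro y hy h1
    rw [sub_eq_zero] at h1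
    rw [mem_closedBall_zero_iff, ← h1] at hy
    linarith
  have : DiffContOnCl ℂ (fun y => (w - y)⁻¹) (ball 0 |ρ|) := by
    rw [abs_of_pos h0]
    refine DifferentiableOn.diffContOnCl fun y hy => ?_
    have hy := closure_ball_subset_closedBall hy
    exact ((differentiableAt_const w).sub differentiableAt_id).inv (hd y hy) |>.differentiableWithinAt
  simpa using this.circleAverage

theorem circleAverage_inv_sub_of_gt {w : ℂ} {ρ : ℝ} (h : ‖w‖ < ρ) :
    Real.circleAverage (fun y => (w - y)⁻¹) 0 ρ = 0 := by
  have h0 : 0 < ρ := (norm_nonneg w).trans_lt h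
  have hd : ∀ y ∈ closedBall (0 : ℂ) ρ, conj w * y - ρ ^ 2 ≠ 0 := by
    intro y hy h1
    rw [mem_closedBall_zero_iff] at hy
    have h2 : ‖conj w * y‖ = ρ ^ 2 := by
      rw [sub_eq_zero.1 h1]; simp
    rw [norm_mul, norm_conj] at h2
    nlinarith [norm_nonneg w, norm_nonneg y]
  have hdc : DiffContOnCl ℂ (fun y => y / (conj w * y - ρ ^ 2)) (ball 0 |ρ|) := by
    rw [abs_of_pos h0]
    refine DifferentiableOn.diffContOnCl fun y hy => ?_
    have hy := closure_ball_subset_closedBall hy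
    refine DifferentiableAt.differentiableWithinAt ?_
    exact differentiableAt_id.div (by fun_prop) (hd y hy)
  have h1 := hdc.circleAverage
  have hcc : ContinuousOn (fun y => y / (conj w * y - ρ ^ 2)) (sphere (0 : ℂ) |ρ|) := by
    intro y hy
    rw [abs_of_pos h0] at hy
    exact (continuousWithinAt_id.div (by fun_prop) (hd y (sphere_subset_closedBall hy)))
  have h2 := ContinuousLinearMap.circleAverage_comp_comm (conjCLE : ℂ →L[ℝ] ℂ) (c := 0) (R := ρ)
    (f := fun y => y / (conj w * y - ρ ^ 2))
    (ContinuousOn.circleIntegrable' hcc)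
  rw [h1] at h2
  rw [zero_div, map_zero] at h2
  refine Eq.trans ?_ h2
  refine Real.circleAverage_congr_sphere fun y hy => ?_
  rw [abs_of_pos h0, mem_sphere_zero_iff_norm] at hy
  have hy0 : y ≠ 0 := by rintro rfl; simp at hy; linarith
  have hc : conj y = ρ ^ 2 / y := by
    rw [eq_div_iff hy0, ← normSq_eq_conj_mul_self, normSq_eq_norm_sq, hy]; simp
  have hcy : conj y ≠ 0 := by simpa using hy0
  have hwy : w - y ≠ 0 := by
    intro h3; rw [sub_eq_zero] at h3; rw [h3, hy] at h; exact lt_irrefl _ h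
  have hr : (ρ : ℂ) ^ 2 = conj y * y := by rw [hc]; field_simp
  simp only [Function.comp, ContinuousLinearEquiv.coe_coe, conjCLE_apply, map_div₀, map_sub,
    map_mul, conj_conj, map_pow, conj_ofReal]
  rw [hr]
  have : w * conj y - conj y * y = conj y * (w - y) := by ring
  rw [this]
  field_simp

theorem integral_polar {f : ℂ → ℂ} (hm : Measurable f) (hf : Integrable f) :
    ∫ z, f z = ∫ ρ in Ioi (0 : ℝ), (2 * Real.pi * ρ) • Real.circleAverage f 0 ρ := by
  have hint : IntegrableOn (fun p : ℝ × ℝ => p.1 • f (Complex.polarCoord.symm p)) polarCoord.target := by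
    refine ⟨?_, ?_⟩
    · have : Measurable fun p : ℝ × ℝ => Complex.polarCoord.symm p := by
        simp_rw [Complex.polarCoord_symm_apply]; fun_prop
      exact (measurable_fst.smul (hm.comp this)).aestronglyMeasurable
    · have h1 := Complex.lintegral_comp_polarCoord_symm (fun z => ‖f z‖ₑ)
      have h2 := hf.2
      rw [HasFiniteIntegral, ← h1] at h2
      refine (lintegral_congr_ae ?_).trans_lt h2
      filter_upwards [ae_restrict_mem polarCoord.open_target.measurableSet] with p hp
      rw [polarCoord_target] at hp
      have : 0 < p.1 := hp.1
      rw [enorm_smul, Real.enorm_eq_ofReal this.le, smul_eq_mul]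
  rw [← Complex.integral_comp_polarCoord_symm]
  rw [polarCoord_target] at hint ⊢
  rw [Measure.volume_eq_prod] at hint ⊢
  rw [setIntegral_prod _ hint]
  refine setIntegral_congr_fun measurableSet_Ioi fun ρ hρ => ?_
  simp only
  rw [integral_smul, mul_comm, mul_smul]
  congr 1
  rw [Real.circleAverage_eq_integral_add (-Real.pi), smul_smul,
    mul_inv_cancel₀ (by positivity), one_smul, intervalIntegral.integral_comp_add_right
      (fun θ => f (circleMap 0 ρ θ)), intervalIntegral.integral_of_le (by linarith [Real.pi_pos]),
      integral_Ioc_eq_integral_Ioo]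
  have e1 : (0 : ℝ) + -Real.pi = -Real.pi := by ring
  have e2 : 2 * Real.pi + -Real.pi = Real.pi := by ring
  rw [e1, e2]
  refine setIntegral_congr_fun measurableSet_Ioo fun θ _ => ?_
  simp [Complex.polarCoord_symm_apply, circleMap, exp_mul_I]

theorem setIntegral_ball_inv_sub {w : ℂ} {r : ℝ} (h : ‖w‖ < r) :
    ∫ y in ball (0 : ℂ) r, (w - y)⁻¹ = Real.pi * conj w := by
  have hmeas : Measurable fun y : ℂ => (w - y)⁻¹ := (measurable_const.sub measurable_id).inv
  have hint : IntegrableOn (fun y : ℂ => (w - y)⁻¹) (ball 0 r) := by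
    have h1 := ((integrableOn_inv_ball (r + ‖w‖)).integrable_indicator measurableSet_ball).comp_sub_left w
    refine h1.integrableOn.congr_fun (fun y hy => ?_) measurableSet_ball
    rw [mem_ball_zero_iff] at hy
    refine indicator_of_mem (mem_ball_zero_iff.2 ?_) _
    linarith [norm_sub_le w y]
  rw [← integral_indicator measurableSet_ball, integral_polar (hmeas.indicator measurableSet_ball)
    (hint.integrable_indicator measurableSet_ball)]
  have hav : ∀ᵐ ρ ∂(volume.restrict (Ioi (0 : ℝ))), (2 * Real.pi * ρ) • Real.circleAverage
      ((ball (0 : ℂ) r).indicator fun y => (w - y)⁻¹) 0 ρ =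
      (Ioo 0 ‖w‖).indicator (fun ρ : ℝ => (2 * Real.pi * ρ : ℝ) • w⁻¹) ρ := by
    have hne : ∀ᵐ ρ ∂(volume.restrict (Ioi (0 : ℝ))), ρ ≠ ‖w‖ :=
      ae_restrict_of_ae (Measure.ae_ne volume _)
    filter_upwards [ae_restrict_mem measurableSet_Ioi, hne] with ρ hρ hne
    have hρ : 0 < ρ := hρ
    by_cases hr : ρ < r
    · have : Real.circleAverage ((ball (0 : ℂ) r).indicator fun y => (w - y)⁻¹) 0 ρ =
          Real.circleAverage (fun y => (w - y)⁻¹) 0 ρ := by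
        refine Real.circleAverage_congr_sphere fun y hy => ?_
        rw [abs_of_pos hρ, mem_sphere_zero_iff_norm] at hy
        rw [indicator_of_mem]
        rw [mem_ball_zero_iff, hy]; exact hr
      rw [this]
      rcases lt_or_gt_of_ne hne with h1 | h1
      · rw [circleAverage_inv_sub_of_lt hρ h1, indicator_of_mem (mem_Ioo.2 ⟨hρ, h1⟩)]
      · rw [circleAverage_inv_sub_of_gt h1, indicator_of_notMem (fun h => not_lt.2 h1.le h.2), smul_zero]
    · have : Real.circleAverage ((ball (0 : ℂ) r).indicator fun y => (w - y)⁻¹) 0 ρ =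
          Real.circleAverage (fun y => (0 : ℂ)) 0 ρ := by
        refine Real.circleAverage_congr_sphere fun y hy => ?_
        rw [abs_of_pos hρ, mem_sphere_zero_iff_norm] at hy
        rw [indicator_of_notMem]
        rw [mem_ball_zero_iff, hy]; exact hr
      rw [this, Real.circleAverage_const, smul_zero, indicator_of_notMem]
      intro h1; linarith [h1.2]
  rw [integral_congr_ae hav, setIntegral_indicator measurableSet_Ioo]
  have : Ioi 0 ∩ Ioo 0 ‖w‖ = Ioo 0 ‖w‖ := inter_eq_right.2 fun x hx => hx.1
  rw [this, integral_smul_const, ← integral_Ioc_eq_integral_Ioo,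
    ← intervalIntegral.integral_of_le (norm_nonneg w), intervalIntegral.integral_const_mul, integral_id]
  by_cases hw : w = 0
  · simp [hw]
  · have : conj w = ‖w‖ ^ 2 * w⁻¹ := by
      rw [← ofReal_pow, ← normSq_eq_norm_sq, normSq_eq_conj_mul_self]; field_simp
    rw [this, real_smul]
    push_cast
    ring

/-- The (unnormalised) Cauchy transform of the indicator function of `s`. -/
def cauchyInt (s : Set ℂ) (ζ : ℂ) : ℂ := ∫ z in s, (ζ - z)⁻¹

section CauchyInt

variable {s : Set ℂ}

theorem norm_inv_sub_le (ζ z : ℂ) :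
    ‖(ζ - z)⁻¹‖ ≤ (ball (0 : ℂ) 1).indicator (fun z : ℂ => ‖z‖⁻¹) (ζ - z) + 1 := by
  by_cases h : ζ - z ∈ ball (0 : ℂ) 1
  · rw [indicator_of_mem h, norm_inv]; linarith
  · rw [indicator_of_notMem h, zero_add, norm_inv]
    rw [mem_ball_zero_iff, not_lt] at h
    exact inv_le_one_of_one_le₀ h

theorem measurable_inv_sub (ζ : ℂ) : Measurable fun z : ℂ => (ζ - z)⁻¹ :=
  (measurable_const.sub measurable_id).inv

theorem integrable_indicator_inv_sub (ζ : ℂ) (r : ℝ) :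
    Integrable fun z => (ball (0 : ℂ) r).indicator (fun z : ℂ => ‖z‖⁻¹) (ζ - z) :=
  ((integrableOn_inv_norm_ball r).integrable_indicator measurableSet_ball).comp_sub_left ζ

theorem integrableOn_inv_sub (hs : volume s < ⊤) (ζ : ℂ) :
    IntegrableOn (fun z => (ζ - z)⁻¹) s :=
  ((integrable_indicator_inv_sub ζ 1).integrableOn.add (integrableOn_const hs.ne)).mono'
    (measurable_inv_sub ζ).aestronglyMeasurable
    (Eventually.of_forall fun z => norm_inv_sub_le ζ z)

theorem exists_norm_cauchyInt_le (hs : volume s < ⊤) : ∃ M, ∀ ζ, ‖cauchyInt s ζ‖ ≤ M := by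
  refine ⟨(∫ z, (ball (0 : ℂ) 1).indicator (fun z : ℂ => ‖z‖⁻¹) z) + volume.real s, fun ζ => ?_⟩
  have h1 := (integrable_indicator_inv_sub ζ 1).integrableOn (s := s)
  have h2 : IntegrableOn (fun _ : ℂ => (1 : ℝ)) s := integrableOn_const hs.ne
  calc ‖cauchyInt s ζ‖ ≤ ∫ z in s, ‖(ζ - z)⁻¹‖ := norm_integral_le_integral_norm _
    _ ≤ ∫ z in s, ((ball (0 : ℂ) 1).indicator (fun z : ℂ => ‖z‖⁻¹) (ζ - z) + 1) :=
        integral_mono (integrableOn_inv_sub hs ζ).norm (h1.add h2) fun z => norm_inv_sub_le ζ z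
    _ = (∫ z in s, (ball (0 : ℂ) 1).indicator (fun z : ℂ => ‖z‖⁻¹) (ζ - z)) + volume.real s := by
        rw [integral_add h1 h2]; simp
    _ ≤ _ := by
        gcongr
        rw [← integral_sub_left_eq_self (fun z => (ball (0 : ℂ) 1).indicator (fun z : ℂ => ‖z‖⁻¹) z)
          volume ζ]
        exact setIntegral_le_integral (integrable_indicator_inv_sub ζ 1)
          (Eventually.of_forall fun z => indicator_nonneg (fun _ _ => by positivity) _)

/-- A continuous truncation of `z ↦ z⁻¹`. -/
def truncInv (ε : ℝ) (z : ℂ) : ℂ := conj z / (max (‖z‖ ^ 2) (ε ^ 2) : ℝ)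

theorem continuous_truncInv {ε : ℝ} (hε : 0 < ε) : Continuous (truncInv ε) := by
  unfold truncInv
  refine continuous_conj.div (continuous_ofReal.comp (by fun_prop)) fun z => ?_
  rw [ofReal_ne_zero]
  have : 0 < ε ^ 2 := by positivity
  exact (this.trans_le (le_max_right _ _)).ne'

theorem norm_truncInv_le {ε : ℝ} (hε : 0 < ε) (z : ℂ) : ‖truncInv ε z‖ ≤ ε⁻¹ := by
  have h0 : 0 < max (‖z‖ ^ 2) (ε ^ 2) := lt_max_of_lt_right (by positivity)
  rw [truncInv, norm_div, norm_conj, norm_real, Real.norm_of_nonneg h0.le, div_le_iff₀ h0,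
    inv_mul_eq_div, le_div_iff₀ hε]
  rcases le_total ‖z‖ ε with h | h
  · exact le_max_of_le_right (by nlinarith [norm_nonneg z])
  · exact le_max_of_le_left (by nlinarith [norm_nonneg z])

theorem norm_inv_sub_truncInv_le {ε : ℝ} (hε : 0 < ε) (z : ℂ) :
    ‖z⁻¹ - truncInv ε z‖ ≤ (ball (0 : ℂ) ε).indicator (fun z : ℂ => ‖z‖⁻¹) z := by
  by_cases hz : z = 0
  · subst hz
    simp [truncInv, hε]
  have hz' : 0 < ‖z‖ := norm_pos_iff.2 hz
  have e : z⁻¹ = conj z / (‖z‖ ^ 2 : ℝ) := by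
    rw [← normSq_eq_norm_sq, normSq_eq_conj_mul_self]
    have : conj z ≠ 0 := by simpa using hz
    field_simp
  by_cases h : z ∈ ball (0 : ℂ) ε
  · rw [indicator_of_mem h]
    rw [mem_ball_zero_iff] at h
    have hm : max (‖z‖ ^ 2) (ε ^ 2) = ε ^ 2 := max_eq_right (by nlinarith)
    rw [e, truncInv, hm, div_eq_mul_inv, div_eq_mul_inv, ← mul_sub, norm_mul, norm_conj,
      ← ofReal_inv, ← ofReal_inv, ← ofReal_sub, norm_real, Real.norm_eq_abs, abs_of_nonneg]
    · have : 0 ≤ (ε ^ 2)⁻¹ := by positivity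
      calc ‖z‖ * ((‖z‖ ^ 2)⁻¹ - (ε ^ 2)⁻¹) ≤ ‖z‖ * (‖z‖ ^ 2)⁻¹ := by gcongr; linarith
        _ = ‖z‖⁻¹ := by field_simp
    · rw [sub_nonneg]; gcongr
  · rw [indicator_of_notMem h]
    rw [mem_ball_zero_iff, not_lt] at h
    have hm : max (‖z‖ ^ 2) (ε ^ 2) = ‖z‖ ^ 2 := max_eq_left (by nlinarith)
    rw [e, truncInv, hm, sub_self, norm_zero]

theorem tendsto_setIntegral_ball_inv_norm :
    Tendsto (fun n : ℕ => ∫ z in ball (0 : ℂ) (1 / ((n : ℝ) + 1)), ‖z‖⁻¹) atTop (𝓝 0) := by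
  have h := tendsto_setIntegral_of_antitone (μ := volume) (f := fun z : ℂ => ‖z‖⁻¹)
    (s := fun n : ℕ => ball (0 : ℂ) (1 / ((n : ℝ) + 1))) (fun n => measurableSet_ball)
    (fun m n hmn => ball_subset_ball (Nat.one_div_le_one_div hmn))
    ⟨0, integrableOn_inv_norm_ball _⟩
  have h0 : (⋂ n : ℕ, ball (0 : ℂ) (1 / ((n : ℝ) + 1))) = {0} := by
    ext z
    simp only [mem_iInter, mem_ball_zero_iff, mem_singleton_iff]
    refine ⟨fun h => ?_, fun h n => by rw [h, norm_zero]; positivity⟩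
    by_contra hz
    obtain ⟨n, hn⟩ := exists_nat_one_div_lt (norm_pos_iff.2 hz)
    exact lt_asymm hn (h n)
  rwa [h0, Measure.restrict_singleton, measure_singleton, zero_smul, integral_zero_measure] at h

theorem continuous_cauchyInt (hs : volume s < ⊤) : Continuous (cauchyInt s) := by
  set ε : ℕ → ℝ := fun n => 1 / ((n : ℝ) + 1) with hεdef
  have hε : ∀ n, 0 < ε n := fun n => by positivity
  set F : ℕ → ℂ → ℂ := fun n ζ => ∫ z in s, truncInv (ε n) (ζ - z) with hF
  have hti : ∀ n ζ, IntegrableOn (fun z => truncInv (ε n) (ζ - z)) s := fun n ζ =>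
    IntegrableOn.of_bound hs ((continuous_truncInv (hε n)).comp
      (continuous_const.sub continuous_id)).aestronglyMeasurable (ε n)⁻¹
      (Eventually.of_forall fun z => norm_truncInv_le (hε n) _)
  have hFc : ∀ n, Continuous (F n) := fun n =>
    continuous_of_dominated (bound := fun _ => (ε n)⁻¹) (fun ζ => (hti n ζ).1)
      (fun ζ => Eventually.of_forall fun z => norm_truncInv_le (hε n) _)
      (integrableOn_const hs.ne) (Eventually.of_forall fun z =>
        (continuous_truncInv (hε n)).comp (continuous_id.sub continuous_const))
  have hu : TendstoUniformly F (cauchyInt s) atTop := by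
    rw [Metric.tendstoUniformly_iff]
    intro δ hδ
    filter_upwards [tendsto_setIntegral_ball_inv_norm.eventually (gt_mem_nhds hδ)] with n hn ζ
    refine lt_of_le_of_lt ?_ hn
    rw [dist_eq_norm, hF, cauchyInt]
    simp only
    rw [← integral_sub (integrableOn_inv_sub hs ζ) (hti n ζ)]
    have hii := integrable_indicator_inv_sub ζ (ε n)
    calc _ ≤ ∫ z in s, ‖(ζ - z)⁻¹ - truncInv (ε n) (ζ - z)‖ := norm_integral_le_integral_norm _
      _ ≤ ∫ z in s, (ball (0 : ℂ) (ε n)).indicator (fun z : ℂ => ‖z‖⁻¹) (ζ - z) :=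
          integral_mono ((integrableOn_inv_sub hs ζ).sub (hti n ζ)).norm hii.integrableOn
            fun z => norm_inv_sub_truncInv_le (hε n) _
      _ ≤ ∫ z, (ball (0 : ℂ) (ε n)).indicator (fun z : ℂ => ‖z‖⁻¹) (ζ - z) :=
          setIntegral_le_integral hii
            (Eventually.of_forall fun z => indicator_nonneg (fun _ _ => by positivity) _)
      _ = ∫ z in ball (0 : ℂ) (ε n), ‖z‖⁻¹ := by
          rw [integral_sub_left_eq_self (fun z => (ball (0 : ℂ) (ε n)).indicator
            (fun z : ℂ => ‖z‖⁻¹) z) volume ζ, integral_indicator measurableSet_ball]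
  exact hu.continuous (Eventually.of_forall hFc).frequently

theorem differentiableOn_cauchyInt (hm : MeasurableSet s) (hs : volume s < ⊤) {c : ℂ} {r : ℝ}
    (hd : Disjoint (ball c r) s) : DifferentiableOn ℂ (cauchyInt s) (ball c r) := by
  intro ζ hζ
  set δ := (r - dist ζ c) / 2 with hδ
  have hδ0 : 0 < δ := by rw [mem_ball] at hζ; rw [hδ]; linarith
  have hfar : ∀ z ∈ s, ∀ x ∈ ball ζ δ, δ ≤ ‖x - z‖ := by
    intro z hz x hx
    have h1 : r ≤ dist z c := by
      by_contra h
      exact hd.le_bot ⟨mem_ball.2 (not_le.1 h), hz⟩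
    rw [← dist_eq_norm]
    rw [mem_ball] at hx
    have h2 := dist_triangle z x ζ
    have h3 := dist_triangle z ζ c
    rw [dist_comm z x] at h2
    linarith
  have key := hasDerivAt_integral_of_dominated_loc_of_deriv_le (μ := volume.restrict s)
    (F := fun x z => (x - z)⁻¹) (F' := fun x z => -((x - z) ^ 2)⁻¹) (x₀ := ζ)
    (s := ball ζ δ) (bound := fun _ => (δ ^ 2)⁻¹) (ball_mem_nhds ζ hδ0)
    (Eventually.of_forall fun x => (measurable_inv_sub x).aestronglyMeasurable)
    (integrableOn_inv_sub hs ζ)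
    (((measurable_const.sub measurable_id).pow_const 2).inv.neg.aestronglyMeasurable) ?_
    (integrableOn_const hs.ne) ?_
  · exact key.2.differentiableAt.differentiableWithinAt
  · filter_upwards [ae_restrict_mem hm] with z hz x hx
    rw [norm_neg, norm_inv, norm_pow]
    have := hfar z hz x hx
    gcongr
  · filter_upwards [ae_restrict_mem hm] with z hz x hx
    have : x - z ≠ 0 := norm_pos_iff.1 (hδ0.trans_le (hfar z hz x hx))
    have h := ((hasDerivAt_id x).sub_const z).inv this
    rw [neg_div, one_div] at h
    exact h

theorem differentiableOn_conj_sub_cauchyInt {Ω : Set ℂ} (ho : IsOpen Ω) (hv : volume Ω < ⊤) :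
    DifferentiableOn ℂ (fun ζ => Real.pi * conj ζ - cauchyInt Ω ζ) Ω := by
  intro c hc
  obtain ⟨r, hr, hb⟩ := Metric.isOpen_iff.1 ho c hc
  have hv' : volume (Ω \ ball c r) < ⊤ := (measure_mono sdiff_subset).trans_lt hv
  have h1 := differentiableOn_cauchyInt (ho.measurableSet.diff measurableSet_ball) hv'
    (c := c) (r := r) disjoint_sdiff_right
  have h2 : ∀ ζ ∈ ball c r, Real.pi * conj ζ - cauchyInt Ω ζ =
      Real.pi * conj c - cauchyInt (Ω \ ball c r) ζ := by
    intro ζ hζ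
    have e1 : cauchyInt Ω ζ = cauchyInt (ball c r) ζ + cauchyInt (Ω \ ball c r) ζ := by
      unfold cauchyInt
      rw [← setIntegral_union disjoint_sdiff_right (ho.measurableSet.diff measurableSet_ball)
        (integrableOn_inv_sub measure_ball_lt_top ζ) (integrableOn_inv_sub hv' ζ),
        union_sdiff_cancel hb]
    have e2 : cauchyInt (ball c r) ζ = Real.pi * conj (ζ - c) := by
      rw [← setIntegral_ball_inv_sub (w := ζ - c) (r := r) (by rwa [mem_ball_iff_norm] at hζ),
        cauchyInt, ← integral_indicator measurableSet_ball, ← integral_indicator measurableSet_ball,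
        ← integral_add_right_eq_self _ c]
      refine integral_congr_ae (Eventually.of_forall fun z => ?_)
      have : z + c ∈ ball c r ↔ z ∈ ball (0 : ℂ) r := by simp
      beta_reduce
      by_cases hz : z ∈ ball (0 : ℂ) r
      · rw [indicator_of_mem hz, indicator_of_mem (this.2 hz), sub_sub, add_comm c]
      · rw [indicator_of_notMem hz, indicator_of_notMem (fun h => hz (this.1 h))]
    rw [e1, e2, map_sub]
    ring
  have h3 : DifferentiableOn ℂ (fun ζ => Real.pi * conj ζ - cauchyInt Ω ζ) (ball c r) :=
    ((differentiableOn_const _).sub h1).congr h2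
  exact (h3.differentiableAt (ball_mem_nhds c hr)).differentiableWithinAt

end CauchyInt

section SquareRoot

variable {Ω E : Set ℂ} {x y a : ℂ}

theorem exists_sqrt_of_dist_le {W : Set ℂ} {δ : ℝ} (hδ : 0 < δ) (hE : IsPreconnected E)
    (hd : ∀ z ∈ W, ∀ y ∈ E, δ ≤ dist z y) (hx : x ∈ E) (hy : y ∈ E) :
    ∃ g : ℂ → ℂ, DifferentiableOn ℂ g W ∧ ∀ z ∈ W, g z ^ 2 * (z - y) = z - x := by
  have hne : ∀ z ∈ W, ∀ y ∈ E, z - y ≠ 0 := fun z hz y hy h => by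
    have := hd z hz y hy
    rw [dist_eq_norm, h, norm_zero] at this
    linarith
  refine hE.induction₂ (fun x y => ∃ g : ℂ → ℂ, DifferentiableOn ℂ g W ∧
    ∀ z ∈ W, g z ^ 2 * (z - y) = z - x) ?_ ?_ ?_ hx hy
  · intro x hx
    filter_upwards [self_mem_nhdsWithin, mem_nhdsWithin_of_mem_nhds (ball_mem_nhds x hδ)]
      with y hy hxy
    have hs : ∀ z ∈ W, 1 + (y - x) / (z - y) ∈ slitPlane := by
      intro z hz
      refine mem_slitPlane_of_norm_lt_one ?_
      rw [norm_div, div_lt_one (norm_pos_iff.2 (hne z hz y hy)), ← dist_eq_norm, ← dist_eq_norm]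
      exact (mem_ball.1 hxy).trans_le (hd z hz y hy)
    refine ⟨fun z => exp (log (1 + (y - x) / (z - y)) / 2), ?_, ?_⟩
    · intro z hz
      have h1 : DifferentiableAt ℂ (fun z => 1 + (y - x) / (z - y)) z :=
        (differentiableAt_const _).add
          ((differentiableAt_const _).div (differentiableAt_id.sub_const y) (hne z hz y hy))
      exact ((h1.clog (hs z hz)).div_const 2).cexp.differentiableWithinAt
    · intro z hz
      have h2 := hne z hz y hy
      rw [← exp_nat_mul]
      rw [show ((2 : ℕ) : ℂ) * (log (1 + (y - x) / (z - y)) / 2) = log (1 + (y - x) / (z - y)) by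
        push_cast; ring, exp_log (slitPlane_ne_zero (hs z hz))]
      field_simp
      ring
  · rintro x y z - hy hz ⟨g, hg, hg'⟩ ⟨f, hf, hf'⟩
    refine ⟨g * f, hg.mul hf, fun u hu => ?_⟩
    rw [← hg' u hu, ← hf' u hu, Pi.mul_apply]
    ring
  · rintro x y hx hy ⟨g, hg, hg'⟩
    have h0 : ∀ u ∈ W, g u ≠ 0 := fun u hu h => hne u hu x hx (by rw [← hg' u hu, h]; ring)
    refine ⟨fun u => (g u)⁻¹, hg.inv h0, fun u hu => ?_⟩
    rw [← hg' u hu]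
    field_simp [h0 u hu]

theorem exists_sqrt_of_isPreconnected (ho : IsOpen Ω) (hc : IsConnected Ω) (hE : IsPreconnected E)
    (hEΩ : E ⊆ Ωᶜ) (hx : x ∈ E) (hy : y ∈ E) (ha : a ∈ Ω) {s : ℂ}
    (hs : s ^ 2 * (a - y) = a - x) :
    ∃ g : ℂ → ℂ, DifferentiableOn ℂ g Ω ∧ (∀ z ∈ Ω, g z ^ 2 * (z - y) = z - x) ∧ g a = s := by
  have hne : ∀ z ∈ Ω, ∀ y ∈ E, z - y ≠ 0 := fun z hz y hy h => hEΩ hy (by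
    rwa [sub_eq_zero.1 h] at hz)
  have hpos : ∀ z ∈ Ω, 0 < infDist z Ωᶜ := fun z hz =>
    ((isClosed_compl_iff.2 ho).notMem_iff_infDist_pos ⟨x, hEΩ hx⟩).1 (not_not.2 hz)
  set W : ℕ → Set ℂ := fun n => {z | infDist a Ωᶜ / (n + 2) < infDist z Ωᶜ}
  have hWo : ∀ n, IsOpen (W n) := fun n => isOpen_lt continuous_const (continuous_infDist_pt _)
  have hWΩ : ∀ n, W n ⊆ Ω := by
    intro n z hz
    by_contra h
    have h1 : infDist z Ωᶜ = 0 := infDist_zero_of_mem h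
    have h2 : infDist a Ωᶜ / (n + 2) < infDist z Ωᶜ := hz
    have := hpos a ha
    rw [h1] at h2
    exact absurd h2 (not_lt.2 (by positivity))
  have haW : ∀ n, a ∈ W n := fun n => div_lt_self (hpos a ha) (by
    have : (0 : ℝ) ≤ n := by positivity
    linarith)
  have hWm : Monotone W := by
    intro n m hnm z hz
    refine lt_of_le_of_lt ?_ (show infDist a Ωᶜ / (n + 2) < infDist z Ωᶜ from hz)
    have := hpos a ha
    gcongr
  set U : ℕ → Set ℂ := fun n => connectedComponentIn (W n) a
  have hUm : Monotone U := fun n m h => connectedComponentIn_mono a (hWm h)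
  have hUW : ∀ n, U n ⊆ W n := fun n => connectedComponentIn_subset _ _
  have haU : ∀ n, a ∈ U n := fun n => mem_connectedComponentIn (haW n)
  have hcov : ∀ z ∈ Ω, ∃ n, z ∈ U n := by
    intro z hz
    obtain ⟨γ, hγ⟩ := (ho.isConnected_iff_isPathConnected.1 hc).joinedIn a ha z hz
    obtain ⟨p, hp, hmin⟩ := (isCompact_range γ.continuous).exists_isMinOn (range_nonempty γ)
      (continuous_infDist_pt Ωᶜ).continuousOn
    have hp' : 0 < infDist p Ωᶜ := by
      obtain ⟨t, rfl⟩ := hp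
      exact hpos _ (hγ t)
    obtain ⟨n, hn⟩ := exists_nat_gt (infDist a Ωᶜ / infDist p Ωᶜ)
    have hsub : range γ ⊆ W n := by
      intro q hq
      refine lt_of_lt_of_le ?_ (isMinOn_iff.1 hmin q hq)
      rw [div_lt_iff₀ hp'] at hn
      rw [div_lt_iff₀ (by positivity)]
      nlinarith
    refine ⟨n, (isPreconnected_range γ.continuous).subset_connectedComponentIn
      ⟨0, γ.source⟩ hsub ⟨1, γ.target⟩⟩
  have hex : ∀ n, ∃ g : ℂ → ℂ, DifferentiableOn ℂ g (W n) ∧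
      (∀ z ∈ W n, g z ^ 2 * (z - y) = z - x) ∧ g a = s := by
    intro n
    have hδ : 0 < infDist a Ωᶜ / (n + 2) := by have := hpos a ha; positivity
    obtain ⟨g, hg, hg'⟩ := exists_sqrt_of_dist_le hδ hE (W := W n) (fun z hz y hy =>
      (le_of_lt hz).trans (infDist_le_dist_of_mem (hEΩ hy))) hx hy
    have h1 : g a ^ 2 = s ^ 2 :=
      mul_right_cancel₀ (hne a ha y hy) ((hg' a (haW n)).trans hs.symm)
    rcases sq_eq_sq_iff_eq_or_eq_neg.1 h1 with h | h
    · exact ⟨g, hg, hg', h⟩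
    · exact ⟨-g, hg.neg, fun z hz => by rw [Pi.neg_apply, neg_sq, hg' z hz], by
        rw [Pi.neg_apply, h, neg_neg]⟩
  choose g hgd hgs hga using hex
  have hagree : ∀ n m, n ≤ m → EqOn (g n) (g m) (U n) := by
    intro n m h
    have h1 : U n ⊆ W m := (hUm h).trans (hUW m)
    refine isPreconnected_connectedComponentIn.eq_of_sq_eq ((hgd n).continuousOn.mono (hUW n))
      ((hgd m).continuousOn.mono h1) (fun z hz => ?_) (fun {z} hz h0 => ?_) (haU n)
      ((hga n).trans (hga m).symm)
    · exact mul_right_cancel₀ (hne z (hWΩ n (hUW n hz)) y hy)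
        ((hgs n z (hUW n hz)).trans (hgs m z (h1 hz)).symm)
    · refine hne z (hWΩ n (hUW n hz)) x hx ?_
      rw [← hgs m z (h1 hz), h0]; ring
  have hagree' : ∀ n m, ∀ z ∈ U n, z ∈ U m → g n z = g m z := by
    intro n m z hn hm
    rcases le_total n m with h | h
    · exact hagree n m h hn
    · exact (hagree m n h hm).symm
  choose! ν hν using hcov
  refine ⟨fun z => g (ν z) z, fun z hz => ?_, fun z hz => hgs _ z (hUW _ (hν z hz)), hga _⟩
  have hUo : IsOpen (U (ν z)) := (hWo _).connectedComponentIn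
  have h1 : DifferentiableAt ℂ (g (ν z)) z :=
    ((hgd _).mono (hUW _)).differentiableAt (hUo.mem_nhds (hν z hz))
  refine (h1.congr_of_eventuallyEq ?_).differentiableWithinAt
  filter_upwards [hUo.mem_nhds (hν z hz)] with u hu
  exact hagree' _ _ u (hν u (hWΩ _ (hUW _ hu))) hu

end SquareRoot

theorem tendsto_iteratedDerivWithin {ι : Type*} {l : Filter ι} {Ω : Set ℂ} {F : ι → ℂ → ℂ}
    {f : ℂ → ℂ} (ho : IsOpen Ω) (hF : ∀ᶠ i in l, DifferentiableOn ℂ (F i) Ω)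
    (h : TendstoLocallyUniformlyOn F f l Ω) (k : ℕ) {w : ℂ} (hw : w ∈ Ω) :
    Tendsto (fun i => iteratedDerivWithin k (F i) Ω w) l (𝓝 (iteratedDerivWithin k f Ω w)) := by
  have key : ∀ k, (∀ᶠ i in l, DifferentiableOn ℂ (iteratedDeriv k (F i)) Ω) ∧
      TendstoLocallyUniformlyOn (fun i => iteratedDeriv k (F i)) (iteratedDeriv k f) l Ω := by
    intro k
    induction k with
    | zero => simpa only [iteratedDeriv_zero] using ⟨hF, h⟩
    | succ k ih =>
      simp only [iteratedDeriv_succ]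
      exact ⟨ih.1.mono fun i hi => hi.deriv ho, ih.2.deriv ih.1 ho⟩
  have h1 := (key k).2.tendsto_at hw
  rw [iteratedDerivWithin_of_isOpen ho hw]
  refine h1.congr fun i => ?_
  rw [iteratedDerivWithin_of_isOpen ho hw]

theorem iteratedDerivWithin_inv_sub {Ω : Set ℂ} (ho : IsOpen Ω) {ζ : ℂ} (hζ : ζ ∉ Ω) (k : ℕ) :
    EqOn (iteratedDerivWithin k (fun z => (ζ - z)⁻¹) Ω)
      (fun z => (k.factorial : ℂ) / (ζ - z) ^ (k + 1)) Ω := by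
  induction k with
  | zero => intro z _; simp
  | succ k ih =>
    intro z hz
    have hne : ζ - z ≠ 0 := fun h => hζ (by rwa [sub_eq_zero.1 h])
    rw [iteratedDerivWithin_succ, derivWithin_congr ih (ih hz), derivWithin_of_isOpen ho hz]
    have h1 : HasDerivAt (fun z => ζ - z) (-1) z := by
      simpa using (hasDerivAt_id z).const_sub ζ
    have h2 := ((hasDerivAt_const z (k.factorial : ℂ)).div (h1.pow (k + 1)) (pow_ne_zero _ hne))
    rw [HasDerivAt.deriv (f := fun z => (k.factorial : ℂ) / (ζ - z) ^ (k + 1)) h2]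
    rw [Nat.factorial_succ]
    push_cast
    simp only [Pi.pow_apply]
    field_simp
    ring

section SquareRootApprox

variable {Ω : Set ℂ} {ζ t z g : ℂ}

theorem norm_sq_sqrt_mul_inv (hz : z ≠ ζ) (ht : z ≠ t) (hg : g ^ 2 * (z - t) = z - ζ) :
    ‖g * (ζ - z)⁻¹‖ ^ 2 = ‖(ζ - z)⁻¹‖ * ‖(t - z)⁻¹‖ := by
  have h1 : ζ - z ≠ 0 := sub_ne_zero.2 hz.symm
  have h2 : t - z ≠ 0 := sub_ne_zero.2 ht.symm
  rw [← norm_pow, ← norm_mul]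
  congr 1
  have : g ^ 2 * (t - z) = ζ - z := by linear_combination -hg
  field_simp
  exact this

theorem norm_sqrt_mul_inv_le (hz : z ≠ ζ) (ht : z ≠ t) (hg : g ^ 2 * (z - t) = z - ζ) :
    ‖g * (ζ - z)⁻¹‖ ≤ (‖(ζ - z)⁻¹‖ + ‖(t - z)⁻¹‖) / 2 := by
  refine abs_le_of_sq_le_sq' ?_ (by positivity) |>.2
  rw [norm_sq_sqrt_mul_inv hz ht hg]
  nlinarith [sq_nonneg (‖(ζ - z)⁻¹‖ - ‖(t - z)⁻¹‖)]

theorem norm_inv_mul_norm_inv_le (hz : z ≠ ζ) (ht : z ≠ t) (hζt : t ≠ ζ) :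
    ‖(ζ - z)⁻¹‖ * ‖(t - z)⁻¹‖ ≤ ‖t - ζ‖⁻¹ * (‖(ζ - z)⁻¹‖ + ‖(t - z)⁻¹‖) := by
  have h1 : 0 < ‖ζ - z‖ := norm_pos_iff.2 (sub_ne_zero.2 hz.symm)
  have h2 : 0 < ‖t - z‖ := norm_pos_iff.2 (sub_ne_zero.2 ht.symm)
  have h3 : 0 < ‖t - ζ‖ := norm_pos_iff.2 (sub_ne_zero.2 hζt)
  have h4 : ‖t - ζ‖ ≤ ‖t - z‖ + ‖ζ - z‖ := by
    rw [show t - ζ = (t - z) - (ζ - z) by ring]; exact norm_sub_le _ _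
  rw [norm_inv, norm_inv]
  have e : ‖ζ - z‖⁻¹ + ‖t - z‖⁻¹ = (‖t - z‖ + ‖ζ - z‖) * (‖ζ - z‖⁻¹ * ‖t - z‖⁻¹) := by
    field_simp
  rw [e, ← mul_assoc]
  refine le_mul_of_one_le_left (by positivity) ?_
  rw [inv_mul_eq_div, one_le_div h3]
  exact h4

theorem bergmanFun_sqrt_mul_inv (ho : IsOpen Ω) (hv : volume Ω < ⊤) (hζ : ζ ∉ Ω) (ht : t ∉ Ω)
    (hζt : t ≠ ζ) {g : ℂ → ℂ} (hgd : DifferentiableOn ℂ g Ω)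
    (hg : ∀ z ∈ Ω, g z ^ 2 * (z - t) = z - ζ) :
    BergmanFun Ω fun z => g z * (ζ - z)⁻¹ := by
  have hz : ∀ z ∈ Ω, z ≠ ζ := fun z hz h => hζ (h ▸ hz)
  have hz' : ∀ z ∈ Ω, z ≠ t := fun z hz h => ht (h ▸ hz)
  have hd : DifferentiableOn ℂ (fun z => g z * (ζ - z)⁻¹) Ω :=
    hgd.mul (((differentiableOn_const ζ).sub differentiableOn_id).inv fun z h =>
      sub_ne_zero.2 (hz z h).symm)
  refine ⟨hd, ?_⟩
  refine (((integrableOn_inv_sub hv ζ).norm.add (integrableOn_inv_sub hv t).norm).const_mul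
    ‖t - ζ‖⁻¹).mono' ((hd.continuousOn.norm.pow 2).aestronglyMeasurable ho.measurableSet) ?_
  refine (ae_restrict_iff' ho.measurableSet).2 (Eventually.of_forall fun z h => ?_)
  rw [norm_sq_sqrt_mul_inv (hz z h) (hz' z h) (hg z h), Real.norm_of_nonneg (by positivity)]
  exact norm_inv_mul_norm_inv_le (hz z h) (hz' z h) hζt

theorem tendstoLocallyUniformlyOn_sqrt_mul_inv (ho : IsOpen Ω) (hc : IsConnected Ω)
    (hζ : ζ ∉ Ω) {l : Filter ℂ} (hl : l ≤ 𝓝 ζ) {a : ℂ} (ha : a ∈ Ω) {g : ℂ → ℂ → ℂ}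
    (hgd : ∀ᶠ t in l, DifferentiableOn ℂ (g t) Ω)
    (hg : ∀ᶠ t in l, ∀ z ∈ Ω, g t z ^ 2 * (z - t) = z - ζ)
    (hga : ∀ᶠ t in l, 0 < (g t a).re) :
    TendstoLocallyUniformlyOn (fun t z => g t z * (ζ - z)⁻¹) (fun z => (ζ - z)⁻¹) l Ω := by
  rw [Metric.tendstoLocallyUniformlyOn_iff]
  intro ε hε x hx
  obtain ⟨γ, hγ⟩ := (ho.isConnected_iff_isPathConnected.1 hc).joinedIn a ha x hx
  obtain ⟨r, hr, hb⟩ := nhds_basis_closedBall.mem_iff.1 (ho.mem_nhds hx)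
  set k := range γ ∪ closedBall x r with hk
  have hkΩ : k ⊆ Ω := union_subset (by rintro _ ⟨t, rfl⟩; exact hγ t) hb
  have hkc : IsCompact k := (isCompact_range γ.continuous).union (isCompact_closedBall x r)
  have hkp : IsPreconnected k :=
    (isPreconnected_range γ.continuous).union x ⟨1, γ.target⟩ (mem_closedBall_self hr.le)
      (convex_closedBall x r).isPreconnected
  have hak : a ∈ k := Or.inl ⟨0, γ.source⟩
  obtain ⟨p, hp, hmin⟩ := hkc.exists_isMinOn ⟨a, hak⟩
    (f := fun z => ‖z - ζ‖) (by fun_prop)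
  set d := ‖p - ζ‖
  have hd : 0 < d := norm_pos_iff.2 (sub_ne_zero.2 fun h => hζ (h ▸ hkΩ hp))
  have hmin' : ∀ z ∈ k, d ≤ ‖z - ζ‖ := fun z hz => isMinOn_iff.1 hmin z hz
  refine ⟨closedBall x r, mem_nhdsWithin_of_mem_nhds (closedBall_mem_nhds x hr), ?_⟩
  have e1 : ∀ᶠ t in l, ‖t - ζ‖ < d / 4 := by
    filter_upwards [hl (ball_mem_nhds ζ (show 0 < d / 4 by positivity))] with t ht
    rwa [mem_ball_iff_norm] at ht
  have e2 : ∀ᶠ t in l, ‖t - ζ‖ < ε * d ^ 2 / 2 := by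
    filter_upwards [hl (ball_mem_nhds ζ (show 0 < ε * d ^ 2 / 2 by positivity))] with t ht
    rwa [mem_ball_iff_norm] at ht
  filter_upwards [hgd, hg, hga, e1, e2] with t hgd hg hga e1 e2
  have hsq : ∀ z ∈ k, ‖g t z ^ 2 - 1‖ ≤ 2 * ‖t - ζ‖ / d := by
    intro z hz
    have h0 : d * (3 / 4) ≤ ‖z - t‖ := by
      have := hmin' z hz
      have h := norm_sub_le (z - t) (ζ - t)
      rw [show z - t - (ζ - t) = z - ζ by ring, norm_sub_rev ζ t] at h
      linarith
    have h1 : (g t z ^ 2 - 1) * (z - t) = t - ζ := by linear_combination hg z (hkΩ hz)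
    have h2 : ‖g t z ^ 2 - 1‖ * ‖z - t‖ = ‖t - ζ‖ := by rw [← norm_mul, h1]
    rw [le_div_iff₀ hd]
    nlinarith [norm_nonneg (g t z ^ 2 - 1)]
  have hlt : ∀ z ∈ k, ‖g t z ^ 2 - 1‖ < 1 := by
    intro z hz
    refine (hsq z hz).trans_lt ?_
    rw [div_lt_one hd]; linarith
  have hre : ∀ z ∈ k, (g t z).re ≠ 0 := by
    intro z hz h
    have h1 := hlt z hz
    have h2 := abs_re_le_norm (g t z ^ 2 - 1)
    have h3 : (g t z ^ 2 - 1).re = -(g t z).im ^ 2 - 1 := by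
      simp [pow_two, mul_re, h]
    rw [h3] at h2
    have h4 := neg_abs_le (-(g t z).im ^ 2 - 1)
    nlinarith [sq_nonneg (g t z).im]
  have hpos : ∀ z ∈ k, 0 < (g t z).re := by
    intro z hz
    by_contra hcon
    have hcont : ContinuousOn (fun z => (g t z).re) k :=
      continuous_re.comp_continuousOn (hgd.continuousOn.mono hkΩ)
    obtain ⟨y, hy, hy'⟩ := hkp.intermediate_value hz hak hcont
      (show (0 : ℝ) ∈ Icc (g t z).re (g t a).re from ⟨not_lt.1 hcon, hga.le⟩)
    exact hre y hy hy'
  intro z hz'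
  have hz : z ∈ k := Or.inr hz'
  have h1 : 1 ≤ ‖g t z + 1‖ := by
    refine le_trans ?_ ((le_abs_self _).trans (abs_re_le_norm _))
    rw [add_re, one_re]
    linarith [hpos z hz]
  have h2 : ‖g t z - 1‖ ≤ 2 * ‖t - ζ‖ / d := by
    refine le_trans ?_ (hsq z hz)
    rw [show g t z ^ 2 - 1 = (g t z - 1) * (g t z + 1) by ring, norm_mul]
    exact le_mul_of_one_le_right (norm_nonneg _) h1
  have h3 := hmin' z hz
  rw [dist_eq_norm, show (ζ - z)⁻¹ - g t z * (ζ - z)⁻¹ = -((g t z - 1) * (ζ - z)⁻¹) by ring,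
    norm_neg, norm_mul, norm_inv, norm_sub_rev ζ z, ← div_eq_mul_inv, div_lt_iff₀ (hd.trans_le h3)]
  calc ‖g t z - 1‖ ≤ 2 * ‖t - ζ‖ / d := h2
    _ < ε * d := by
        rw [div_lt_iff₀ hd]; nlinarith
    _ ≤ ε * ‖z - ζ‖ := by gcongr

end SquareRootApprox

theorem setIntegral_norm_inv_sub_le {s : Set ℂ} {t : ℂ} {r : ℝ} (hm : MeasurableSet s)
    (hs : s ⊆ ball t r) :
    ∫ z in s, ‖(t - z)⁻¹‖ ≤ ∫ z in ball (0 : ℂ) r, ‖z‖⁻¹ := by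
  rw [← integral_indicator hm, ← integral_indicator measurableSet_ball,
    ← integral_sub_left_eq_self (fun z => (ball (0 : ℂ) r).indicator (fun z : ℂ => ‖z‖⁻¹) z)
          volume t]
  refine integral_mono_of_nonneg (Eventually.of_forall fun z => indicator_nonneg (fun _ _ => by
    positivity) _) (integrable_indicator_inv_sub t r) (Eventually.of_forall fun z => ?_)
  beta_reduce
  by_cases hz : z ∈ s
  · have h1 : t - z ∈ ball (0 : ℂ) r := by
      have := hs hz
      rwa [mem_ball_iff_norm', ← mem_ball_zero_iff] at this
    rw [indicator_of_mem hz, indicator_of_mem h1, norm_inv]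
  · rw [indicator_of_notMem hz]
    exact indicator_nonneg (fun _ _ => by positivity) _

theorem tendsto_setIntegral_of_norm_le_inv_sub {Ω : Set ℂ} (hm : MeasurableSet Ω)
    (hv : volume Ω < ⊤) {ζ : ℂ} {l : Filter ℂ} [l.IsCountablyGenerated] (hl : l ≤ 𝓝 ζ)
    {F : ℂ → ℂ → ℂ}
    (hFm : ∀ᶠ t in l, AEStronglyMeasurable (F t) (volume.restrict Ω))
    (hF : ∀ᶠ t in l, ∀ z ∈ Ω, ‖F t z‖ ≤ (‖(ζ - z)⁻¹‖ + ‖(t - z)⁻¹‖) / 2)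
    (hlim : ∀ z ∈ Ω, Tendsto (fun t => F t z) l (𝓝 (ζ - z)⁻¹)) :
    Tendsto (fun t => ∫ z in Ω, F t z) l (𝓝 (∫ z in Ω, (ζ - z)⁻¹)) := by
  rw [Metric.tendsto_nhds]
  intro ε hε
  obtain ⟨n, hn⟩ := ((tendsto_order.1 tendsto_setIntegral_ball_inv_norm).2 (ε / 4)
    (by positivity)).exists
  set r : ℝ := 1 / ((n : ℝ) + 1) with hr
  have hr0 : 0 < r := by positivity
  set J := ∫ z in ball (0 : ℂ) r, ‖z‖⁻¹
  set s := Ω ∩ ball ζ (r / 2) with hs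
  set s' := Ω \ ball ζ (r / 2) with hs'
  have hsm : MeasurableSet s := hm.inter measurableSet_ball
  have hsm' : MeasurableSet s' := hm.diff measurableSet_ball
  have hsv : volume s < ⊤ := (measure_mono inter_subset_left).trans_lt hv
  have hsv' : volume s' < ⊤ := (measure_mono sdiff_subset).trans_lt hv
  have e1 : ∀ᶠ t in l, ‖t - ζ‖ < r / 4 := by
    filter_upwards [hl (ball_mem_nhds ζ (show 0 < r / 4 by positivity))] with t ht
    rwa [mem_ball_iff_norm] at ht
  have hfar : ∀ z ∈ s', r / 2 ≤ ‖ζ - z‖ := by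
    intro z hz
    have := hz.2
    rwa [mem_ball_iff_norm', not_lt] at this
  have houter : Tendsto (fun t => ∫ z in s', F t z) l (𝓝 (∫ z in s', (ζ - z)⁻¹)) := by
    refine tendsto_integral_filter_of_dominated_convergence (fun _ => 3 / r)
      (hFm.mono fun t ht => ht.mono_measure (Measure.restrict_mono sdiff_subset le_rfl)) ?_
      (integrableOn_const hsv'.ne) ?_
    · filter_upwards [hF, e1] with t h1 h2
      refine (ae_restrict_iff' hsm').2 (Eventually.of_forall fun z hz => (h1 z hz.1).trans ?_)
      have h3 := hfar z hz
      have h4 : r / 4 ≤ ‖t - z‖ := by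
        have := norm_sub_le (t - z) (t - ζ)
        rw [show t - z - (t - ζ) = ζ - z by ring] at this
        linarith
      have h5 : ‖(ζ - z)⁻¹‖ ≤ 2 / r := by
        rw [norm_inv, ← inv_div]
        exact inv_anti₀ (by positivity) h3
      have h6 : ‖(t - z)⁻¹‖ ≤ 4 / r := by
        rw [norm_inv, ← inv_div]
        exact inv_anti₀ (by positivity) h4
      calc _ ≤ (2 / r + 4 / r) / 2 := by gcongr
        _ = 3 / r := by ring
    · exact (ae_restrict_iff' hsm').2 (Eventually.of_forall fun z hz => hlim z hz.1)
  have hint : ∀ u, IntegrableOn (fun z => ‖(u - z)⁻¹‖) Ω := fun u => (integrableOn_inv_sub hv u).norm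
  filter_upwards [hFm, hF, e1, Metric.tendsto_nhds.1 houter (ε / 2) (by positivity)]
    with t hFm hF e1 hout
  have hFi : IntegrableOn (F t) Ω := (((hint ζ).add (hint t)).div_const 2).mono' hFm
    ((ae_restrict_iff' hm).2 (Eventually.of_forall hF))
  have hsplit : ∀ g : ℂ → ℂ, IntegrableOn g Ω → ∫ z in Ω, g z = (∫ z in s, g z) + ∫ z in s', g z :=
    fun g hg => (integral_inter_add_sdiff measurableSet_ball hg).symm
  rw [hsplit _ hFi, hsplit _ (integrableOn_inv_sub hv ζ), dist_eq_norm]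
  rw [dist_eq_norm] at hout
  have hJζ : ∫ z in s, ‖(ζ - z)⁻¹‖ ≤ J :=
    setIntegral_norm_inv_sub_le hsm (inter_subset_right.trans (ball_subset_ball (by linarith)))
  have hJt : ∫ z in s, ‖(t - z)⁻¹‖ ≤ J := by
    refine setIntegral_norm_inv_sub_le hsm (inter_subset_right.trans (ball_subset_ball' ?_))
    rw [dist_comm, dist_eq_norm]; linarith
  have hin1 : ‖∫ z in s, F t z‖ ≤ J := by
    calc ‖∫ z in s, F t z‖ ≤ ∫ z in s, (‖(ζ - z)⁻¹‖ + ‖(t - z)⁻¹‖) / 2 := by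
          refine norm_integral_le_of_norm_le
            (IntegrableOn.mono_set (((hint ζ).add (hint t)).div_const 2) inter_subset_left) ?_
          exact (ae_restrict_iff' hsm).2 (Eventually.of_forall fun z hz => hF z hz.1)
      _ = ((∫ z in s, ‖(ζ - z)⁻¹‖) + ∫ z in s, ‖(t - z)⁻¹‖) / 2 := by
          rw [integral_div, integral_add ((hint ζ).mono_set inter_subset_left)
            ((hint t).mono_set inter_subset_left)]
      _ ≤ J := by linarith
  have hin2 : ‖∫ z in s, (ζ - z)⁻¹‖ ≤ J := (norm_integral_le_integral_norm _).trans hJζ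
  calc _ = ‖(∫ z in s, F t z) - (∫ z in s, (ζ - z)⁻¹) +
        ((∫ z in s', F t z) - ∫ z in s', (ζ - z)⁻¹)‖ := by congr 1; ring
    _ ≤ _ := (norm_add_le _ _).trans (add_le_add (norm_sub_le _ _) le_rfl)
    _ < ε := by linarith

/-- The Cauchy transform of a quadrature domain is rational off the domain. -/
theorem cauchyInt_eq_of_quadrature {Ω : Set ℂ} (ho : IsOpen Ω) (hc : IsConnected Ω)
    (hv : volume Ω < ⊤) {N : ℕ} {w : Fin N → ℂ} {n : Fin N → ℕ} {c : Fin N → ℕ → ℂ}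
    (hw : ∀ j, w j ∈ Ω)
    (hq : ∀ f : ℂ → ℂ, BergmanFun Ω f → (∫ z in Ω, f z) =
        ∑ j, ∑ k ∈ Finset.range (n j + 1), c j k * iteratedDerivWithin k f Ω (w j))
    {ζ : ℂ} (hζ : ζ ∈ Ωᶜ) (hζc : ¬ (connectedComponentIn Ωᶜ ζ).Subsingleton) :
    cauchyInt Ω ζ = ∑ j, ∑ k ∈ Finset.range (n j + 1),
      c j k * ((k.factorial : ℂ) / (ζ - w j) ^ (k + 1)) := by
  set E := connectedComponentIn Ωᶜ ζ with hE
  have hEΩ : E ⊆ Ωᶜ := connectedComponentIn_subset _ _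
  have hEp : IsPreconnected E := isPreconnected_connectedComponentIn
  have hζE : ζ ∈ E := mem_connectedComponentIn hζ
  have hacc : AccPt ζ (𝓟 E) :=
    hEp.preperfect_of_nontrivial (not_subsingleton_iff.1 hζc) ζ hζE
  set l := 𝓝[≠] ζ ⊓ 𝓟 E with hldef
  have : l.NeBot := hacc
  have hl : l ≤ 𝓝 ζ := inf_le_left.trans nhdsWithin_le_nhds
  have hlE : ∀ᶠ t in l, t ∈ E := inf_le_right (a := 𝓝[≠] ζ) (mem_principal_self E)
  have hlne : ∀ᶠ t in l, t ≠ ζ := inf_le_left (b := 𝓟 E) self_mem_nhdsWithin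
  obtain ⟨a, ha⟩ := hc.nonempty
  have hane : ∀ t ∈ E, a - t ≠ 0 := fun t ht h => hEΩ ht (by rwa [← sub_eq_zero.1 h])
  set s : ℂ → ℂ := fun t => exp (log ((a - ζ) / (a - t)) / 2) with hs
  have hsq : ∀ t ∈ E, s t ^ 2 * (a - t) = a - ζ := by
    intro t ht
    rw [hs, ← exp_nat_mul, show ((2 : ℕ) : ℂ) * (log ((a - ζ) / (a - t)) / 2) =
      log ((a - ζ) / (a - t)) by push_cast; ring,
      exp_log (div_ne_zero (hane ζ hζE) (hane t ht)), div_mul_cancel₀ _ (hane t ht)]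
  have hs1 : Tendsto s l (𝓝 1) := by
    have h1 : Tendsto (fun t => (a - ζ) / (a - t)) (𝓝 ζ) (𝓝 1) := by
      have : ContinuousAt (fun t => (a - ζ) / (a - t)) ζ :=
        continuousAt_const.div (by fun_prop) (hane ζ hζE)
      rw [ContinuousAt, div_self (hane ζ hζE)] at this
      exact this
    have h2 : Tendsto (fun t => exp (log ((a - ζ) / (a - t)) / 2)) (𝓝 ζ) (𝓝 (exp (log 1 / 2))) :=
      (continuous_exp.tendsto _).comp ((h1.clog one_mem_slitPlane).div_const 2)
    rw [log_one, zero_div, Complex.exp_zero] at h2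
    exact h2.mono_left hl
  have hex : ∀ t, ∃ g : ℂ → ℂ, t ∈ E → DifferentiableOn ℂ g Ω ∧
      (∀ z ∈ Ω, g z ^ 2 * (z - t) = z - ζ) ∧ g a = s t := by
    intro t
    by_cases ht : t ∈ E
    · obtain ⟨g, hg⟩ := exists_sqrt_of_isPreconnected ho hc hEp hEΩ hζE ht ha (hsq t ht)
      exact ⟨g, fun _ => hg⟩
    · exact ⟨0, fun h => absurd h ht⟩
  choose g hg using hex
  have hzζ : ∀ z ∈ Ω, ∀ t ∈ E, z ≠ t := fun z hz t ht h => hEΩ ht (h ▸ hz)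
  have hB : ∀ᶠ t in l, BergmanFun Ω fun z => g t z * (ζ - z)⁻¹ := by
    filter_upwards [hlE, hlne] with t ht ht'
    exact bergmanFun_sqrt_mul_inv ho hv hζ (hEΩ ht) ht' (hg t ht).1 (hg t ht).2.1
  have hre : ∀ᶠ t in l, 0 < (g t a).re := by
    have h1 : ∀ᶠ t in l, 0 < (s t).re :=
      ((continuous_re.tendsto _).comp hs1).eventually (lt_mem_nhds (by simp))
    filter_upwards [hlE, h1] with t ht h1
    rwa [(hg t ht).2.2]
  have hloc := tendstoLocallyUniformlyOn_sqrt_mul_inv ho hc hζ hl ha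
    (hlE.mono fun t ht => (hg t ht).1) (hlE.mono fun t ht => (hg t ht).2.1) hre
  have hint : Tendsto (fun t => ∫ z in Ω, g t z * (ζ - z)⁻¹) l (𝓝 (∫ z in Ω, (ζ - z)⁻¹)) := by
    refine tendsto_setIntegral_of_norm_le_inv_sub ho.measurableSet hv hl
      (hB.mono fun t ht => ht.1.continuousOn.aestronglyMeasurable ho.measurableSet) ?_
      fun z hz => hloc.tendsto_at hz
    filter_upwards [hlE] with t ht z hz
    exact norm_sqrt_mul_inv_le (hzζ z hz ζ hζE) (hzζ z hz t ht) ((hg t ht).2.1 z hz)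
  have hsum : Tendsto (fun t => ∑ j, ∑ k ∈ Finset.range (n j + 1),
      c j k * iteratedDerivWithin k (fun z => g t z * (ζ - z)⁻¹) Ω (w j)) l
      (𝓝 (∑ j, ∑ k ∈ Finset.range (n j + 1),
        c j k * iteratedDerivWithin k (fun z => (ζ - z)⁻¹) Ω (w j))) :=
    tendsto_finsetSum _ fun j _ => tendsto_finsetSum _ fun k _ =>
      (tendsto_iteratedDerivWithin ho (hB.mono fun t ht => ht.1) hloc k (hw j)).const_mul _
  have := tendsto_nhds_unique (hint.congr' (hB.mono fun t ht => hq _ ht)) hsum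
  rw [cauchyInt, this]
  exact Finset.sum_congr rfl fun j _ => Finset.sum_congr rfl fun k _ => by
    rw [iteratedDerivWithin_inv_sub ho hζ k (hw j)]

theorem subset_ball_of_schwarz {Ω : Set ℂ} (ho : IsOpen Ω) {u : ℂ → ℂ} {r₀ M : ℝ} (hM0 : 0 ≤ M)
    (hc : ContinuousOn u {z | r₀ ≤ ‖z‖}) (hM : ∀ z, r₀ ≤ ‖z‖ → ‖u z‖ ≤ M)
    (h0 : ∀ z ∉ Ω, r₀ ≤ ‖z‖ → u z = 0)
    (hd : DifferentiableOn ℂ (fun z => conj z - u z) (Ω ∩ {z | r₀ < ‖z‖})) :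
    Ω ⊆ ball 0 (r₀ + (M + 1)) := by
  intro z₀ hz₀
  by_contra hcon
  rw [mem_ball_zero_iff, not_lt] at hcon
  set r := M + 1
  have hr : 0 < r := by positivity
  set G : ℂ → ℂ := fun z => (conj z - u z - conj z₀) * (z - z₀)
  set V := Ω ∩ ball z₀ r
  have hVo : IsOpen V := ho.inter isOpen_ball
  have hV0 : ∀ z, dist z z₀ ≤ r → r₀ ≤ ‖z‖ := by
    intro z hz
    rw [dist_eq_norm] at hz
    have := norm_sub_le z (z - z₀)
    rw [sub_sub_cancel] at this
    linarith
  have hV1 : ∀ z, dist z z₀ < r → r₀ < ‖z‖ := by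
    intro z hz
    rw [dist_eq_norm] at hz
    have := norm_sub_le z (z - z₀)
    rw [sub_sub_cancel] at this
    linarith
  have hVcl : closure V ⊆ closedBall z₀ r :=
    (closure_mono inter_subset_right).trans closure_ball_subset_closedBall
  have hGc : ContinuousOn G (closure V) := by
    have h1 : ContinuousOn u (closure V) := hc.mono fun z hz => hV0 z (hVcl hz)
    exact ((continuous_conj.continuousOn.sub h1).sub continuousOn_const).mul (by fun_prop)
  have hGd : DifferentiableOn ℂ G V :=
    ((hd.mono fun z hz => ⟨hz.1, hV1 z hz.2⟩).sub_const _).mul (by fun_prop)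
  have hfd : DiffContOnCl ℂ (fun z => exp (-G z)) V :=
    ⟨hGd.neg.cexp, continuous_exp.comp_continuousOn hGc.neg⟩
  have hVb : Bornology.IsBounded V := isBounded_ball.subset inter_subset_right
  have hpos : ∀ z ∈ frontier V, ‖exp (-G z)‖ < 1 := by
    intro z hz
    rw [norm_exp, Real.exp_lt_one_iff, neg_re, neg_lt_zero]
    have hz1 : dist z z₀ ≤ r := hVcl (frontier_subset_closure hz)
    have hz2 : z ∉ V := by
      rw [hVo.frontier_eq] at hz
      exact hz.2
    have e : (G z).re = ‖z - z₀‖ ^ 2 - (u z * (z - z₀)).re := by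
      have : G z = conj (z - z₀) * (z - z₀) - u z * (z - z₀) := by
        simp only [G, map_sub]; ring
      rw [this, sub_re, conj_mul', ← ofReal_pow, ofReal_re]
    by_cases hzΩ : z ∈ Ω
    · have h1 : ‖z - z₀‖ = r := by
        rw [← dist_eq_norm]
        exact le_antisymm hz1 (not_lt.1 fun h => hz2 ⟨hzΩ, h⟩)
      have h2 : (u z * (z - z₀)).re ≤ M * r := by
        refine (re_le_norm _).trans ?_
        rw [norm_mul, h1]
        gcongr
        exact hM z (hV0 z hz1)
      rw [e, h1]
      nlinarith
    · rw [e, h0 z hzΩ (hV0 z hz1), zero_mul, zero_re, sub_zero]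
      have : 0 < ‖z - z₀‖ := norm_pos_iff.2 (sub_ne_zero.2 fun h => hzΩ (h ▸ hz₀))
      positivity
  obtain ⟨C, hC1, hC⟩ : ∃ C < 1, ∀ z ∈ frontier V, ‖exp (-G z)‖ ≤ C := by
    rcases (frontier V).eq_empty_or_nonempty with h | h
    · exact ⟨0, one_pos, by simp [h]⟩
    · obtain ⟨p, hp, hmax⟩ := (hVb.isCompact_closure.of_isClosed_subset isClosed_frontier
        frontier_subset_closure).exists_isMaxOn h
        (hfd.continuousOn.norm.mono frontier_subset_closure)
      exact ⟨_, hpos p hp, fun z hz => isMaxOn_iff.1 hmax z hz⟩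
  have := norm_le_of_forall_mem_frontier_norm_le hVb hfd hC (subset_closure ⟨hz₀, mem_ball_self hr⟩)
  simp only [G, sub_self, mul_zero, neg_zero, Complex.exp_zero, norm_one] at this
  linarith

theorem isBounded_of_cauchyInt_eq {Ω : Set ℂ} (ho : IsOpen Ω) (hv : volume Ω < ⊤) {N : ℕ}
    {w : Fin N → ℂ} {n : Fin N → ℕ} {c : Fin N → ℕ → ℂ}
    (hC : ∀ ζ ∉ Ω, cauchyInt Ω ζ = ∑ j, ∑ k ∈ Finset.range (n j + 1),
      c j k * ((k.factorial : ℂ) / (ζ - w j) ^ (k + 1))) :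
    Bornology.IsBounded Ω := by
  obtain ⟨M₁, hM₁⟩ := exists_norm_cauchyInt_le hv
  set R : ℂ → ℂ := fun ζ => ∑ j, ∑ k ∈ Finset.range (n j + 1),
      c j k * ((k.factorial : ℂ) / (ζ - w j) ^ (k + 1)) with hR
  set r₀ := 1 + ∑ j, ‖w j‖ with hr₀
  set M₂ := ∑ j, ∑ k ∈ Finset.range (n j + 1), ‖c j k‖ * (k.factorial : ℝ)
  have hfar : ∀ z, r₀ ≤ ‖z‖ → ∀ j, 1 ≤ ‖z - w j‖ := by
    intro z hz j
    have h1 : ‖w j‖ ≤ ∑ j, ‖w j‖ :=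
      Finset.single_le_sum (f := fun j => ‖w j‖) (fun i _ => norm_nonneg _) (Finset.mem_univ j)
    have h2 := norm_sub_norm_le z (w j)
    linarith
  have hRM : ∀ z, r₀ ≤ ‖z‖ → ‖R z‖ ≤ M₂ := by
    intro z hz
    refine norm_sum_le_of_le _ fun j _ => norm_sum_le_of_le _ fun k _ => ?_
    rw [norm_mul, norm_div, norm_pow, norm_natCast]
    gcongr
    exact div_le_self (by positivity) (one_le_pow₀ (hfar z hz j))
  have hne : ∀ z, r₀ ≤ ‖z‖ → ∀ j, z - w j ≠ 0 := fun z hz j h => by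
    have := hfar z hz j
    rw [h, norm_zero] at this
    linarith
  have hRd : DifferentiableOn ℂ R {z | r₀ ≤ ‖z‖} :=
    DifferentiableOn.fun_sum fun j _ => DifferentiableOn.fun_sum fun k _ => fun z hz =>
      (((differentiableAt_const ((k.factorial : ℂ))).div
        ((differentiableAt_id.sub_const (w j)).pow (k + 1))
        (pow_ne_zero _ (hne z hz j))).const_mul (c j k)).differentiableWithinAt
  have hM0 : 0 ≤ M₁ + M₂ := add_nonneg ((norm_nonneg _).trans (hM₁ 0)) (by positivity)
  have hπ : (Real.pi : ℂ) ≠ 0 := ofReal_ne_zero.2 Real.pi_ne_zero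
  refine isBounded_ball.subset (subset_ball_of_schwarz ho (u := fun z => (cauchyInt Ω z - R z) / Real.pi)
    (r₀ := r₀) (M := (M₁ + M₂) / Real.pi) (by positivity) ?_ ?_ ?_ ?_)
  · exact ((continuous_cauchyInt hv).continuousOn.sub hRd.continuousOn).div_const _
  · intro z hz
    rw [norm_div, norm_real, Real.norm_of_nonneg Real.pi_pos.le]
    gcongr
    exact (norm_sub_le _ _).trans (add_le_add (hM₁ z) (hRM z hz))
  · intro z hz _
    rw [hC z hz, sub_self, zero_div]
  · have h1 := ((differentiableOn_conj_sub_cauchyInt ho hv).mono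
      (inter_subset_left (t := {z | r₀ < ‖z‖}))).add
      (hRd.mono ((inter_subset_right (s := Ω)).trans fun z (hz : r₀ < ‖z‖) => hz.le))
    refine (h1.div_const (Real.pi : ℂ)).congr fun z _ => ?_
    simp only [Pi.add_apply]
    field_simp
    ring

open Polynomial

/-- Bounded holomorphic functions on `Ω`. -/
def BddHol (Ω : Set ℂ) (f : ℂ → ℂ) : Prop :=
  DifferentiableOn ℂ f Ω ∧ ∃ M, ∀ z ∈ Ω, ‖f z‖ ≤ M

namespace BddHol

variable {Ω : Set ℂ} {f g : ℂ → ℂ}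

theorem add (hf : BddHol Ω f) (hg : BddHol Ω g) : BddHol Ω fun z => f z + g z := by
  obtain ⟨hf, M, hM⟩ := hf
  obtain ⟨hg, M', hM'⟩ := hg
  exact ⟨hf.add hg, M + M', fun z hz =>
    (norm_add_le _ _).trans (add_le_add (hM z hz) (hM' z hz))⟩

theorem mul (hf : BddHol Ω f) (hg : BddHol Ω g) : BddHol Ω fun z => f z * g z := by
  obtain ⟨hf, M, hM⟩ := hf
  obtain ⟨hg, M', hM'⟩ := hg
  refine ⟨hf.mul hg, M * M', fun z hz => ?_⟩
  rw [norm_mul]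
  exact mul_le_mul (hM z hz) (hM' z hz) (norm_nonneg _) ((norm_nonneg _).trans (hM z hz))

theorem const (c : ℂ) : BddHol Ω fun _ => c :=
  ⟨differentiableOn_const c, ‖c‖, fun _ _ => le_rfl⟩

theorem sub (hf : BddHol Ω f) (hg : BddHol Ω g) : BddHol Ω fun z => f z - g z := by
  simpa [sub_eq_add_neg] using hf.add ((const (-1)).mul hg)

theorem pow (hf : BddHol Ω f) : ∀ n : ℕ, BddHol Ω fun z => f z ^ n
  | 0 => by simpa using const (Ω := Ω) 1
  | n + 1 => by simpa [pow_succ] using (hf.pow n).mul hf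

theorem sum {ι : Type*} {s : Finset ι} {F : ι → ℂ → ℂ} (h : ∀ i ∈ s, BddHol Ω (F i)) :
    BddHol Ω fun z => ∑ i ∈ s, F i z := by
  classical
  induction s using Finset.induction_on with
  | empty => simpa using const (Ω := Ω) 0
  | insert a s ha ih =>
    simp only [Finset.sum_insert ha]
    exact (h a (Finset.mem_insert_self a s)).add
      (ih fun i hi => h i (Finset.mem_insert_of_mem hi))

theorem congr (hf : BddHol Ω f) (h : EqOn g f Ω) : BddHol Ω g :=
  ⟨hf.1.congr h, hf.2.imp fun M hM z hz => by rw [h hz]; exact hM z hz⟩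

theorem of_continuous (hb : Bornology.IsBounded Ω) (hc : Continuous f)
    (hd : DifferentiableOn ℂ f Ω) : BddHol Ω f := by
  obtain ⟨M, hM⟩ := hb.isCompact_closure.exists_bound_of_continuousOn hc.continuousOn
  exact ⟨hd, M, fun z hz => hM z (subset_closure hz)⟩

theorem eval (hb : Bornology.IsBounded Ω) (p : ℂ[X]) : BddHol Ω fun z => p.eval z :=
  of_continuous hb p.continuous p.differentiable.differentiableOn

theorem integrableOn (ho : IsOpen Ω) (hv : volume Ω < ⊤) (hf : BddHol Ω f) : IntegrableOn f Ω := by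
  obtain ⟨hf, M, hM⟩ := hf
  exact IntegrableOn.of_bound hv (hf.continuousOn.aestronglyMeasurable ho.measurableSet) M
    ((ae_restrict_iff' ho.measurableSet).2 (Eventually.of_forall hM))

theorem integrableOn_mul (ho : IsOpen Ω) (hb : Bornology.IsBounded Ω) (hf : BddHol Ω f)
    {φ : ℂ → ℂ} (hφ : Continuous φ) : IntegrableOn (fun z => f z * φ z) Ω := by
  obtain ⟨hf, M, hM⟩ := hf
  obtain ⟨M', hM'⟩ := hb.isCompact_closure.exists_bound_of_continuousOn hφ.continuousOn
  refine IntegrableOn.of_bound hb.measure_lt_top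
    ((hf.continuousOn.mul hφ.continuousOn).aestronglyMeasurable ho.measurableSet) (M * M')
    ((ae_restrict_iff' ho.measurableSet).2 (Eventually.of_forall fun z hz => ?_))
  rw [norm_mul]
  exact mul_le_mul (hM z hz) (hM' z (subset_closure hz)) (norm_nonneg _)
    ((norm_nonneg _).trans (hM z hz))

end BddHol

/-- `N / A` is the reduced form of the rational function which agrees with the normalised Cauchy
transform of the bounded domain `Ω` off `Ω`. -/
structure SchwarzData (Ω : Set ℂ) (A N : ℂ[X]) : Prop where
  isOpen : IsOpen Ω
  isConnected : IsConnected Ω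
  isBounded : Bornology.IsBounded Ω
  ne_zero : A ≠ 0
  mem_of_root : ∀ z, A.eval z = 0 → z ∈ Ω
  isCoprime : IsCoprime A N
  cauchy : ∀ z ∉ Ω, A.eval z * (cauchyInt Ω z / Real.pi) = N.eval z

theorem exists_isCoprime_of_ne_zero {R : Type*} [EuclideanDomain R] {p : R} (q : R)
    (hp : p ≠ 0) : ∃ d a b, p = d * a ∧ q = d * b ∧ IsCoprime a b := by
  classical
  obtain ⟨a, ha⟩ := EuclideanDomain.gcd_dvd_left p q
  obtain ⟨b, hb⟩ := EuclideanDomain.gcd_dvd_right p q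
  refine ⟨_, a, b, ha, hb, EuclideanDomain.gcdA p q, EuclideanDomain.gcdB p q, ?_⟩
  have h := EuclideanDomain.gcd_eq_gcd_ab p q
  refine mul_left_cancel₀ (fun h0 => hp (EuclideanDomain.gcd_eq_zero_iff.1 h0).1)
    (a := EuclideanDomain.gcd p q) ?_
  generalize EuclideanDomain.gcd p q = d at *
  generalize EuclideanDomain.gcdA p q = x at *
  generalize EuclideanDomain.gcdB p q = y at *
  subst ha
  subst hb
  linear_combination -h

theorem exists_schwarzData {Ω : Set ℂ} (hΩ : IsFinConnDomain Ω) (hv : volume Ω < ⊤)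
    (hq : IsQuadratureDomain Ω) : ∃ A N : ℂ[X], SchwarzData Ω A N := by
  obtain ⟨ho, hc, -, hcomp⟩ := hΩ
  obtain ⟨N, -, w, n, c, hw, hq⟩ := hq
  have hC : ∀ ζ ∉ Ω, cauchyInt Ω ζ = ∑ j, ∑ k ∈ Finset.range (n j + 1),
      c j k * ((k.factorial : ℂ) / (ζ - w j) ^ (k + 1)) := fun ζ hζ =>
    cauchyInt_eq_of_quadrature ho hc hv hw hq hζ (hcomp ζ hζ)
  set A₀ : ℂ[X] := ∏ j, (X - C (w j)) ^ (n j + 1)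
  have hA₀ : A₀ ≠ 0 := Finset.prod_ne_zero_iff.2 fun j _ => pow_ne_zero _ (X_sub_C_ne_zero _)
  have hroot : ∀ z, A₀.eval z = 0 → z ∈ Ω := by
    intro z hz
    rw [eval_prod, Finset.prod_eq_zero_iff] at hz
    obtain ⟨j, -, hj⟩ := hz
    rw [eval_pow, eval_sub, eval_X, eval_C] at hj
    rw [sub_eq_zero.1 (pow_eq_zero_iff (Nat.succ_ne_zero _) |>.1 hj)]
    exact hw j
  have hdvd : ∀ j, ∀ k ∈ Finset.range (n j + 1), (X - C (w j)) ^ (k + 1) ∣ A₀ := fun j k hk =>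
    (pow_dvd_pow _ (by have := Finset.mem_range.1 hk; omega)).trans
      (Finset.dvd_prod_of_mem (fun j => (X - C (w j)) ^ (n j + 1)) (Finset.mem_univ j))
  choose! q hq' using hdvd
  set N₀ : ℂ[X] := ∑ j, ∑ k ∈ Finset.range (n j + 1), C (c j k * k.factorial / Real.pi) * q j k
  have hN₀ : ∀ z ∉ Ω, A₀.eval z * (cauchyInt Ω z / Real.pi) = N₀.eval z := by
    intro z hz
    rw [hC z hz, eval_finsetSum, Finset.sum_div, Finset.mul_sum]
    refine Finset.sum_congr rfl fun j _ => ?_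
    rw [eval_finsetSum, Finset.sum_div, Finset.mul_sum]
    refine Finset.sum_congr rfl fun k hk => ?_
    have hne : z - w j ≠ 0 := fun h => hz (by rw [sub_eq_zero.1 h]; exact hw j)
    rw [hq' j k hk, eval_mul, eval_mul, eval_pow, eval_sub, eval_X, eval_C, eval_C]
    field_simp
  obtain ⟨d, A, N, e1, e2, hAN⟩ := exists_isCoprime_of_ne_zero N₀ hA₀
  refine ⟨A, N, ho, hc, isBounded_of_cauchyInt_eq ho hv hC, ?_, ?_, ?_, ?_⟩
  · intro h
    rw [h, mul_zero] at e1
    exact hA₀ e1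
  · intro z hz
    refine hroot z ?_
    rw [e1, eval_mul, hz, mul_zero]
  · exact hAN
  · intro z hz
    have h1 := hN₀ z hz
    have h2 : d.eval z ≠ 0 := fun h => hz (hroot z (by rw [e1, eval_mul, h, zero_mul]))
    rw [e1, e2, eval_mul, eval_mul, mul_assoc] at h1
    exact mul_left_cancel₀ h2 h1

/-- The function `A z * S z`, where `S` is the Schwarz function of the boundary of `Ω`. -/
def schwarzNum (Ω : Set ℂ) (A N : ℂ[X]) (z : ℂ) : ℂ :=
  A.eval z * conj z - (A.eval z * (cauchyInt Ω z / Real.pi) - N.eval z)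

namespace SchwarzData

variable {Ω : Set ℂ} {A N : ℂ[X]}

theorem volume_lt_top (h : SchwarzData Ω A N) : volume Ω < ⊤ := h.isBounded.measure_lt_top

theorem continuous_schwarzNum (h : SchwarzData Ω A N) : Continuous (schwarzNum Ω A N) := by
  have h1 := continuous_cauchyInt h.volume_lt_top
  have h2 := A.continuous
  have h3 := N.continuous
  exact (h2.mul continuous_conj).sub ((h2.mul (h1.div_const _)).sub h3)

theorem bddHol_conj_sub (h : SchwarzData Ω A N) :
    BddHol Ω fun z => conj z - cauchyInt Ω z / Real.pi := by
  refine .of_continuous h.isBounded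
    (continuous_conj.sub ((continuous_cauchyInt h.volume_lt_top).div_const _)) ?_
  refine ((differentiableOn_conj_sub_cauchyInt h.isOpen h.volume_lt_top).div_const
    (Real.pi : ℂ)).congr fun z _ => ?_
  have hπ : (Real.pi : ℂ) ≠ 0 := ofReal_ne_zero.2 Real.pi_ne_zero
  field_simp

theorem schwarzNum_eq (z : ℂ) : schwarzNum Ω A N z =
    A.eval z * (conj z - cauchyInt Ω z / Real.pi) + N.eval z := by
  rw [schwarzNum]; ring

theorem bddHol_schwarzNum (h : SchwarzData Ω A N) : BddHol Ω (schwarzNum Ω A N) :=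
  (((BddHol.eval h.isBounded A).mul h.bddHol_conj_sub).add (.eval h.isBounded N)).congr
    fun z _ => schwarzNum_eq z

theorem schwarzNum_of_notMem (h : SchwarzData Ω A N) {z : ℂ} (hz : z ∉ Ω) :
    schwarzNum Ω A N z = A.eval z * conj z := by
  rw [schwarzNum, h.cauchy z hz, sub_self, sub_zero]

end SchwarzData

theorem hasFDerivAt_conj_pow_mul {n : ℕ} {p : ℂ → ℂ} {z : ℂ} (hp : DifferentiableAt ℂ p z) :
    HasFDerivAt (fun z => conj z ^ n * p z)
      ((n * conj z ^ (n - 1) * p z) • (conjCLE : ℂ →L[ℝ] ℂ) +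
        (conj z ^ n * deriv p z) • (1 : ℂ →L[ℝ] ℂ)) z := by
  have h1 : HasFDerivAt (fun z : ℂ => conj z) (conjCLE : ℂ →L[ℝ] ℂ) z := conjCLE.hasFDerivAt
  have h2 := (h1.pow n).mul hp.hasDerivAt.complexToReal_fderiv
  refine h2.congr_fderiv ?_
  ext
  simp [nsmul_eq_mul]
  ring

theorem fderiv_conj_pow_mul_sub {n k : ℕ} {a b : ℂ → ℂ} {z : ℂ} (ha : DifferentiableAt ℂ a z)
    (hb : DifferentiableAt ℂ b z) (v : ℂ) :
    fderiv ℝ (fun z => conj z ^ n * a z - conj z ^ k * b z) z v =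
      (n * conj z ^ (n - 1) * a z - k * conj z ^ (k - 1) * b z) * conj v +
        (conj z ^ n * deriv a z - conj z ^ k * deriv b z) * v := by
  rw [((hasFDerivAt_conj_pow_mul (n := n) ha).fun_sub (hasFDerivAt_conj_pow_mul (n := k) hb)).fderiv]
  simp
  ring

section Stokes

variable {Ω : Set ℂ} {n k : ℕ} {a b h : ℂ → ℂ}

theorem contDiffOn_conj_pow_mul_sub (ho : IsOpen Ω) (ha : DifferentiableOn ℂ a Ω)
    (hb : DifferentiableOn ℂ b Ω) :
    ContDiffOn ℝ 2 (fun z => conj z ^ n * a z - conj z ^ k * b z) Ω := by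
  have h1 : ContDiff ℝ 2 fun z : ℂ => conj z := conjCLE.contDiff
  exact ((h1.pow n).contDiffOn.mul ((ha.contDiffOn ho).restrict_scalars ℝ)).sub
    ((h1.pow k).contDiffOn.mul ((hb.contDiffOn ho).restrict_scalars ℝ))

theorem exists_norm_dbar_le (ho : IsOpen Ω) (hbd : Bornology.IsBounded Ω)
    (ha : BddHol Ω a) (hb : BddHol Ω b) :
    ∃ M, ∀ z ∈ Ω, ‖fderiv ℝ (fun z => conj z ^ n * a z - conj z ^ k * b z) z 1 +
      I * fderiv ℝ (fun z => conj z ^ n * a z - conj z ^ k * b z) z I‖ ≤ M := by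
  obtain ⟨ha, Ma, hMa⟩ := ha
  obtain ⟨hb, Mb, hMb⟩ := hb
  obtain ⟨r, hr⟩ := hbd.exists_norm_le
  have key : ∀ (n : ℕ) (a : ℂ → ℂ) (M : ℝ), (∀ z ∈ Ω, ‖a z‖ ≤ M) → ∀ z ∈ Ω,
      ‖n * conj z ^ (n - 1) * a z‖ ≤ n * r ^ (n - 1) * M := by
    intro n a M hM z hz
    have h0 : 0 ≤ r := (norm_nonneg _).trans (hr z hz)
    rw [norm_mul, norm_mul, norm_natCast, norm_pow, norm_conj]
    gcongr
    exacts [hr z hz, hM z hz]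
  refine ⟨2 * (n * r ^ (n - 1) * Ma + k * r ^ (k - 1) * Mb), fun z hz => ?_⟩
  rw [fderiv_conj_pow_mul_sub (ha.differentiableAt (ho.mem_nhds hz))
    (hb.differentiableAt (ho.mem_nhds hz)), fderiv_conj_pow_mul_sub
    (ha.differentiableAt (ho.mem_nhds hz)) (hb.differentiableAt (ho.mem_nhds hz))]
  generalize conj z ^ n * deriv a z - conj z ^ k * deriv b z = Q
  have e : ∀ P : ℂ, P * conj 1 + Q * 1 + I * (P * conj I + Q * I) = 2 * P := by
    intro P
    rw [map_one, conj_I]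
    linear_combination (Q - P) * I_mul_I
  rw [e, norm_mul, RCLike.norm_two]
  gcongr
  exact (norm_sub_le _ _).trans (add_le_add (key n a Ma hMa z hz) (key k b Mb hMb z hz))

theorem setIntegral_mul_dbar_eq_zero (ho : IsOpen Ω) (hbd : Bornology.IsBounded Ω)
    (ha : BddHol Ω a) (hb : BddHol Ω b) (hh : BddHol Ω h)
    (hc : Continuous fun z => conj z ^ n * a z - conj z ^ k * b z)
    (h0 : ∀ z ∉ Ω, conj z ^ n * a z - conj z ^ k * b z = 0) :
    ∫ z in Ω, h z * (n * conj z ^ (n - 1) * a z - k * conj z ^ (k - 1) * b z) = 0 := by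
  obtain ⟨M, hM⟩ := exists_norm_dbar_le (n := n) (k := k) ho hbd ha hb
  obtain ⟨hhd, B, hB⟩ := hh
  have h1 := setIntegral_mul_fderiv_eq_zero ho hbd hc h0 (contDiffOn_conj_pow_mul_sub ho ha.1 hb.1)
    hM (c := I) ((hhd.contDiffOn ho).restrict_scalars ℝ) hB fun z hz => by
      have := (hhd.differentiableAt (ho.mem_nhds hz)).hasDerivAt.complexToReal_fderiv.fderiv
      rw [this]
      simp
      linear_combination deriv h z * I_mul_I
  have h2 : ∫ z in Ω, 2 * (h z * (n * conj z ^ (n - 1) * a z - k * conj z ^ (k - 1) * b z)) = 0 := by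
    refine Eq.trans (setIntegral_congr_fun ho.measurableSet fun z hz => ?_) h1
    rw [fderiv_conj_pow_mul_sub (ha.1.differentiableAt (ho.mem_nhds hz))
      (hb.1.differentiableAt (ho.mem_nhds hz)), fderiv_conj_pow_mul_sub
      (ha.1.differentiableAt (ho.mem_nhds hz)) (hb.1.differentiableAt (ho.mem_nhds hz)), map_one,
      conj_I]
    linear_combination h z * ((n * conj z ^ (n - 1) * a z - k * conj z ^ (k - 1) * b z) -
      (conj z ^ n * deriv a z - conj z ^ k * deriv b z)) * I_mul_I
  rw [integral_const_mul] at h2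
  exact (mul_eq_zero.1 h2).resolve_left two_ne_zero

theorem setIntegral_conj_mul_del_eq_zero (ho : IsOpen Ω) (hbd : Bornology.IsBounded Ω)
    (ha : BddHol Ω a) (hb : BddHol Ω b) (hh : BddHol Ω h)
    (hc : Continuous fun z => conj z ^ n * a z - conj z ^ k * b z)
    (h0 : ∀ z ∉ Ω, conj z ^ n * a z - conj z ^ k * b z = 0) :
    ∫ z in Ω, conj (h z) * (conj z ^ n * deriv a z - conj z ^ k * deriv b z) = 0 := by
  obtain ⟨M, hM⟩ := exists_norm_dbar_le (n := n) (k := k) ho hbd ha hb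
  obtain ⟨hhd, B, hB⟩ := hh
  have h1 := setIntegral_mul_fderiv_eq_zero ho hbd hc h0 (contDiffOn_conj_pow_mul_sub ho ha.1 hb.1)
    hM (c := -I) (g := fun z => conj (h z))
    (conjCLE.contDiff.comp_contDiffOn ((hhd.contDiffOn ho).restrict_scalars ℝ))
    (fun z hz => by rw [norm_conj]; exact hB z hz) fun z hz => by
      have := (hhd.differentiableAt (ho.mem_nhds hz)).hasDerivAt.complexToReal_fderiv
      have := ((conjCLE : ℂ →L[ℝ] ℂ).hasFDerivAt.comp z this).fderiv
      rw [show (fun z => conj (h z)) = (conjCLE : ℂ →L[ℝ] ℂ) ∘ h from rfl, this]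
      simp
      linear_combination conj (deriv h z) * I_mul_I
  have h2 : ∫ z in Ω, 2 * (conj (h z) * (conj z ^ n * deriv a z - conj z ^ k * deriv b z)) = 0 := by
    refine Eq.trans (setIntegral_congr_fun ho.measurableSet fun z hz => ?_) h1
    rw [fderiv_conj_pow_mul_sub (ha.1.differentiableAt (ho.mem_nhds hz))
      (hb.1.differentiableAt (ho.mem_nhds hz)), fderiv_conj_pow_mul_sub
      (ha.1.differentiableAt (ho.mem_nhds hz)) (hb.1.differentiableAt (ho.mem_nhds hz)), map_one,
      conj_I]
    linear_combination conj (h z) * (-(n * conj z ^ (n - 1) * a z - k * conj z ^ (k - 1) * b z) +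
      (conj z ^ n * deriv a z - conj z ^ k * deriv b z)) * I_mul_I
  rw [integral_const_mul] at h2
  exact (mul_eq_zero.1 h2).resolve_left two_ne_zero

theorem integrableOn_sq_norm_del (ho : IsOpen Ω) (hbd : Bornology.IsBounded Ω)
    (ha : BddHol Ω a) (hb : BddHol Ω b)
    (hc : Continuous fun z => conj z ^ n * a z - conj z ^ k * b z)
    (h0 : ∀ z ∉ Ω, conj z ^ n * a z - conj z ^ k * b z = 0) :
    IntegrableOn (fun z => ‖conj z ^ n * deriv a z - conj z ^ k * deriv b z‖ ^ 2) Ω := by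
  obtain ⟨M, hM⟩ := exists_norm_dbar_le (n := n) (k := k) ho hbd ha hb
  have h1 := integrableOn_sq_norm_fderiv ho hbd hc h0 (contDiffOn_conj_pow_mul_sub ho ha.1 hb.1) hM
  refine h1.mono' ?_ ((ae_restrict_iff' ho.measurableSet).2 (Eventually.of_forall fun z hz => ?_))
  · refine ContinuousOn.aestronglyMeasurable ?_ ho.measurableSet
    exact (((continuous_conj.pow n).continuousOn.mul (ha.1.deriv ho).continuousOn).sub
      ((continuous_conj.pow k).continuousOn.mul (hb.1.deriv ho).continuousOn)).norm.pow 2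
  · rw [fderiv_conj_pow_mul_sub (ha.1.differentiableAt (ho.mem_nhds hz))
      (hb.1.differentiableAt (ho.mem_nhds hz)), fderiv_conj_pow_mul_sub
      (ha.1.differentiableAt (ho.mem_nhds hz)) (hb.1.differentiableAt (ho.mem_nhds hz)), map_one,
      conj_I, Real.norm_of_nonneg (by positivity)]
    generalize conj z ^ n * deriv a z - conj z ^ k * deriv b z = Q
    generalize (n * conj z ^ (n - 1) * a z - k * conj z ^ (k - 1) * b z) = P
    have e1 : ‖P * -I + Q * I‖ = ‖Q - P‖ := by
      rw [show P * -I + Q * I = (Q - P) * I by ring, norm_mul, norm_I, mul_one]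
    have e2 : ‖Q‖ ≤ (‖P + Q‖ + ‖Q - P‖) / 2 := by
      have h := norm_add_le (P + Q) (Q - P)
      rw [show P + Q + (Q - P) = 2 * Q by ring, norm_mul, RCLike.norm_two] at h
      linarith
    rw [e1, mul_one, mul_one]
    nlinarith [sq_nonneg (‖P + Q‖ - ‖Q - P‖), norm_nonneg Q, norm_nonneg (P + Q),
      norm_nonneg (Q - P), pow_le_pow_left₀ (norm_nonneg Q) e2 2]

end Stokes

/-- The moments `k * ∫ h * conj z ^ (k - 1)`, extended by zero to negative indices. -/
def conjMoment (Ω : Set ℂ) (h : ℂ → ℂ) : ℤ → ℂ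
  | Int.ofNat n => n * ∫ z in Ω, h z * conj z ^ (n - 1)
  | Int.negSucc _ => 0

theorem continuous_conj_pow (n : ℕ) : Continuous fun z : ℂ => conj z ^ n :=
  continuous_conj.pow n

section ConjMoment

variable {Ω : Set ℂ} {f g : ℂ → ℂ}

theorem conjMoment_of_nonpos {k : ℤ} (hk : k ≤ 0) : conjMoment Ω f k = 0 := by
  match k, hk with
  | Int.ofNat 0, _ => simp [conjMoment]
  | Int.ofNat (n + 1), h => exact absurd h (by simp)
  | Int.negSucc _, _ => rfl

theorem conjMoment_one : conjMoment Ω f 1 = ∫ z in Ω, f z := by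
  change conjMoment Ω f (Int.ofNat 1) = _
  simp [conjMoment]

theorem conjMoment_congr (ho : IsOpen Ω) (h : EqOn f g Ω) (k : ℤ) :
    conjMoment Ω f k = conjMoment Ω g k := by
  match k with
  | Int.ofNat n =>
    simp only [conjMoment]
    congr 1
    exact setIntegral_congr_fun ho.measurableSet fun z hz => by simp only [h hz]
  | Int.negSucc _ => rfl

theorem conjMoment_const_mul (c : ℂ) (k : ℤ) :
    conjMoment Ω (fun z => c * f z) k = c * conjMoment Ω f k := by
  match k with
  | Int.ofNat n =>
    simp only [conjMoment, mul_assoc, integral_const_mul]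
    ring
  | Int.negSucc _ => simp [conjMoment]

theorem conjMoment_add (ho : IsOpen Ω) (hb : Bornology.IsBounded Ω) (hf : BddHol Ω f)
    (hg : BddHol Ω g) (k : ℤ) :
    conjMoment Ω (fun z => f z + g z) k = conjMoment Ω f k + conjMoment Ω g k := by
  match k with
  | Int.ofNat n =>
    simp only [conjMoment, add_mul]
    rw [integral_add (hf.integrableOn_mul ho hb (continuous_conj_pow _))
      (hg.integrableOn_mul ho hb (continuous_conj_pow _)), mul_add]
  | Int.negSucc _ => simp [conjMoment]

theorem conjMoment_sum (ho : IsOpen Ω) (hb : Bornology.IsBounded Ω) {ι : Type*} {s : Finset ι}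
    {F : ι → ℂ → ℂ} (hF : ∀ i ∈ s, BddHol Ω (F i)) (k : ℤ) :
    conjMoment Ω (fun z => ∑ i ∈ s, F i z) k = ∑ i ∈ s, conjMoment Ω (F i) k := by
  match k with
  | Int.ofNat n =>
    simp only [conjMoment, Finset.sum_mul]
    rw [integral_finsetSum _ fun i hi => (hF i hi).integrableOn_mul ho hb (continuous_conj_pow _),
      Finset.mul_sum]
  | Int.negSucc _ => simp [conjMoment]

end ConjMoment

theorem BddHol.dslope {Ω : Set ℂ} (ho : IsOpen Ω) {f : ℂ → ℂ} (hf : BddHol Ω f) {w : ℂ}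
    (hw : w ∈ Ω) : BddHol Ω (dslope f w) := by
  obtain ⟨hf, M, hM⟩ := hf
  have hd := (Complex.differentiableOn_dslope (ho.mem_nhds hw)).2 hf
  obtain ⟨r, hr, hb⟩ := nhds_basis_closedBall.mem_iff.1 (ho.mem_nhds hw)
  obtain ⟨M', hM'⟩ := (isCompact_closedBall w r).exists_bound_of_continuousOn
    (hd.continuousOn.mono hb)
  refine ⟨hd, max M' ((M + M) / r), fun z hz => ?_⟩
  by_cases h : z ∈ closedBall w r
  · exact (hM' z h).trans (le_max_left _ _)
  · refine le_trans ?_ (le_max_right _ _)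
    rw [mem_closedBall_iff_norm, not_le] at h
    have h1 : (z - w) * _root_.dslope f w z = f z - f w := by
      rw [← smul_eq_mul, sub_smul_dslope]
    have h2 : ‖z - w‖ * ‖_root_.dslope f w z‖ ≤ M + M := by
      rw [← norm_mul, h1]
      exact (norm_sub_le _ _).trans (add_le_add (hM z hz) (hM w hw))
    rw [le_div_iff₀ hr, mul_comm]
    exact (mul_le_mul_of_nonneg_right h.le (norm_nonneg _)).trans h2

theorem BddHol.exists_eq_add_mul {Ω : Set ℂ} (ho : IsOpen Ω) {f : ℂ → ℂ} (hf : BddHol Ω f) :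
    ∀ (n : ℕ) {A : ℂ[X]}, A.natDegree = n → A ≠ 0 → (∀ z, A.eval z = 0 → z ∈ Ω) →
      ∃ p : ℂ[X], p.degree < A.degree ∧ ∃ g, BddHol Ω g ∧
        ∀ z ∈ Ω, f z = p.eval z + A.eval z * g z := by
  intro n
  induction n with
  | zero =>
    intro A hA h0 _
    obtain ⟨c, rfl⟩ := natDegree_eq_zero.1 hA
    have hc : c ≠ 0 := fun h => h0 (by rw [h, C_0])
    refine ⟨0, ?_, fun z => c⁻¹ * f z, (BddHol.const _).mul hf, fun z _ => ?_⟩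
    · rw [degree_zero, degree_C hc]; exact WithBot.bot_lt_coe 0
    · rw [eval_zero, eval_C]; field_simp; ring
  | succ n ih =>
    intro A hA h0 hroot
    obtain ⟨w, hw⟩ := IsAlgClosed.exists_root A (by
      rw [degree_eq_natDegree h0, hA]; exact_mod_cast n.succ_ne_zero)
    obtain ⟨A', rfl⟩ := dvd_iff_isRoot.2 hw
    have hA'0 : A' ≠ 0 := right_ne_zero_of_mul h0
    have hdeg : A'.natDegree = n := by
      rw [natDegree_mul (X_sub_C_ne_zero w) hA'0, natDegree_X_sub_C] at hA
      omega
    obtain ⟨p, hp, g, hg, hfg⟩ := ih hdeg hA'0 fun z hz => hroot z (by rw [eval_mul, hz, mul_zero])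
    have hwΩ : w ∈ Ω := hroot w hw
    have hlt : A'.degree < ((X - C w) * A').degree := by
      rw [degree_mul, degree_X_sub_C, degree_eq_natDegree hA'0]
      exact_mod_cast (by omega : A'.natDegree < 1 + A'.natDegree)
    refine ⟨p + C (g w) * A', ?_, _, hg.dslope ho hwΩ, fun z hz => ?_⟩
    · refine (degree_add_le _ _).trans_lt (max_lt (hp.trans hlt) ?_)
      refine lt_of_le_of_lt ?_ hlt
      rw [degree_mul]
      exact (add_le_add_left degree_C_le _).trans (by rw [zero_add])
    · have h1 : (z - w) * _root_.dslope g w z = g z - g w := by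
        rw [← smul_eq_mul, sub_smul_dslope]
      rw [hfg z hz, eval_add, eval_mul, eval_mul, eval_C, eval_sub, eval_X, eval_C]
      linear_combination -A'.eval z * h1

namespace SchwarzData

variable {Ω : Set ℂ} {A N : ℂ[X]} {f : ℂ → ℂ}

theorem exists_eq_add_mul (h : SchwarzData Ω A N) (hf : BddHol Ω f) :
    ∃ p : ℂ[X], p.degree < A.degree ∧ ∃ g, BddHol Ω g ∧
        ∀ z ∈ Ω, f z = p.eval z + A.eval z * g z :=
  hf.exists_eq_add_mul h.isOpen _ rfl h.ne_zero h.mem_of_root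

theorem bddHol_eval (h : SchwarzData Ω A N) (p : ℂ[X]) : BddHol Ω fun z => p.eval z :=
  .eval h.isBounded p

theorem conjMoment_succ (h : SchwarzData Ω A N) (hf : BddHol Ω f) (k : ℤ) :
    conjMoment Ω (fun z => A.eval z * f z) (k + 1) =
      conjMoment Ω (fun z => schwarzNum Ω A N z * f z) k := by
  match k with
  | Int.ofNat n =>
    have hφ : Continuous fun z => conj z ^ (n + 1) * A.eval z - conj z ^ n * schwarzNum Ω A N z := by
      have h1 := h.continuous_schwarzNum
      have h2 := A.continuous
      exact ((continuous_conj.pow _).mul h2).sub ((continuous_conj.pow _).mul h1)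
    have h0 := setIntegral_mul_dbar_eq_zero (n := n + 1) (k := n) h.isOpen h.isBounded
      (h.bddHol_eval A) h.bddHol_schwarzNum hf hφ fun z hz => by
        rw [h.schwarzNum_of_notMem hz]; ring
    have i1 := (((h.bddHol_eval A).mul hf).integrableOn_mul h.isOpen h.isBounded
      (continuous_conj_pow n)).const_mul ((n + 1 : ℕ) : ℂ)
    have i2 := ((h.bddHol_schwarzNum.mul hf).integrableOn_mul h.isOpen h.isBounded
      (continuous_conj_pow (n - 1))).const_mul (n : ℂ)
    change ((n + 1 : ℕ) : ℂ) * ∫ z in Ω, A.eval z * f z * conj z ^ n =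
      (n : ℂ) * ∫ z in Ω, schwarzNum Ω A N z * f z * conj z ^ (n - 1)
    rw [← sub_eq_zero, ← integral_const_mul, ← integral_const_mul, ← integral_sub i1 i2]
    refine Eq.trans (setIntegral_congr_fun h.isOpen.measurableSet fun z hz => ?_) h0
    simp only [Nat.add_sub_cancel]
    ring
  | Int.negSucc m =>
    rw [conjMoment_of_nonpos (by omega), conjMoment_of_nonpos (by omega)]

theorem setIntegral_mul_eq_zero (h : SchwarzData Ω A N) (hf : BddHol Ω f) :
    ∫ z in Ω, A.eval z * f z = 0 := by
  rw [← conjMoment_one, show (1 : ℤ) = 0 + 1 from rfl, h.conjMoment_succ hf,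
    conjMoment_of_nonpos le_rfl]

/-- Functions annihilating the polynomials modulo `A`. -/
theorem dvd_of_setIntegral_eq_zero (h : SchwarzData Ω A N) {r : ℂ[X]}
    (hr : ∀ f, BddHol Ω f → ∫ z in Ω, r.eval z * f z = 0) : A ∣ r := by
  obtain ⟨R, hR⟩ := h.isBounded.exists_norm_le
  have hne : ∀ ζ : ℂ, R + 1 ≤ ‖ζ‖ → ∀ z ∈ Ω, 1 ≤ ‖ζ - z‖ := by
    intro ζ hζ z hz
    have h1 := hR z hz
    have h2 := norm_sub_norm_le ζ z
    linarith
  have hB : ∀ ζ : ℂ, R + 1 ≤ ‖ζ‖ → BddHol Ω fun z => (ζ - z)⁻¹ := by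
    intro ζ hζ
    refine ⟨DifferentiableOn.inv (by fun_prop) fun z hz h0 => ?_, 1, fun z hz => ?_⟩
    · have := hne ζ hζ z hz
      rw [h0, norm_zero] at this
      linarith
    · rw [norm_inv]
      exact inv_le_one_of_one_le₀ (hne ζ hζ z hz)
  have key : ∀ p : ℂ[X], ∃ q : ℂ[X], ∀ ζ : ℂ, R + 1 ≤ ‖ζ‖ →
      p.eval ζ * cauchyInt Ω ζ - ∫ z in Ω, p.eval z * (ζ - z)⁻¹ = q.eval ζ := by
    intro p
    induction p using Polynomial.induction_on with
    | C c =>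
      refine ⟨0, fun ζ _ => ?_⟩
      simp only [eval_C, integral_const_mul, eval_zero]
      rw [cauchyInt, sub_self]
    | add p p' hp hp' =>
      obtain ⟨q, hq⟩ := hp
      obtain ⟨q', hq'⟩ := hp'
      refine ⟨q + q', fun ζ hζ => ?_⟩
      rw [eval_add, eval_add, ← hq ζ hζ, ← hq' ζ hζ]
      simp only [eval_add, add_mul]
      rw [integral_add (((h.bddHol_eval p).mul (hB ζ hζ)).integrableOn h.isOpen h.volume_lt_top)
        (((h.bddHol_eval p').mul (hB ζ hζ)).integrableOn h.isOpen h.volume_lt_top)]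
      ring
    | monomial n c hp =>
      obtain ⟨q, hq⟩ := hp
      refine ⟨X * q + C (∫ z in Ω, (C c * X ^ n : ℂ[X]).eval z), fun ζ hζ => ?_⟩
      rw [eval_add, eval_mul (p := X), eval_X, eval_C, ← hq ζ hζ]
      have i1 := (((h.bddHol_eval (C c * X ^ n)).mul (hB ζ hζ)).integrableOn h.isOpen
        h.volume_lt_top).const_mul ζ
      have i2 := (h.bddHol_eval (C c * X ^ n)).integrableOn h.isOpen h.volume_lt_top
      have : ∫ z in Ω, (C c * X ^ (n + 1) : ℂ[X]).eval z * (ζ - z)⁻¹ =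
          ζ * (∫ z in Ω, (C c * X ^ n : ℂ[X]).eval z * (ζ - z)⁻¹) -
            ∫ z in Ω, (C c * X ^ n : ℂ[X]).eval z := by
        rw [← integral_const_mul, ← integral_sub i1 i2]
        refine setIntegral_congr_fun h.isOpen.measurableSet fun z hz => ?_
        have h0 : ζ - z ≠ 0 := fun h0 => by
          have := hne ζ hζ z hz
          rw [h0, norm_zero] at this
          linarith
        simp only [eval_mul, eval_C, eval_pow, eval_X]
        field_simp
        ring
      rw [this]
      simp only [eval_mul, eval_C, eval_pow, eval_X]
      ring
  obtain ⟨q, hq⟩ := key r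
  have hπ : (Real.pi : ℂ) ≠ 0 := ofReal_ne_zero.2 Real.pi_ne_zero
  have heq : r * N = A * (C (Real.pi : ℂ)⁻¹ * q) := by
    refine eq_of_infinite_eval_eq _ _ (Infinite.mono (s := {ζ : ℂ | R + 1 ≤ ‖ζ‖}) ?_ ?_)
    · intro ζ hζ
      have h1 := hq ζ hζ
      rw [hr _ (hB ζ hζ), sub_zero] at h1
      have hζΩ : ζ ∉ Ω := fun hz => by
        have := hR ζ hz
        have h2 : R + 1 ≤ ‖ζ‖ := hζ
        linarith
      rw [mem_ofPred_eq, eval_mul, eval_mul, eval_mul, eval_C, ← h.cauchy ζ hζΩ, ← h1]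
      field_simp
    · have hi : (range fun n : ℕ => ((R + 1 : ℝ) : ℂ) + (n : ℂ)).Infinite :=
        infinite_range_of_injective fun a b hab => by simpa using hab
      obtain hR0 := h.isConnected.nonempty
      obtain ⟨z, hz⟩ := hR0
      have hR1 : 0 ≤ R := (norm_nonneg z).trans (hR z hz)
      refine hi.mono ?_
      rintro _ ⟨n, rfl⟩
      change R + 1 ≤ ‖((R + 1 : ℝ) : ℂ) + (n : ℂ)‖
      rw [← ofReal_natCast, ← ofReal_add, norm_real, Real.norm_of_nonneg (by positivity)]
      have : (0 : ℝ) ≤ n := by positivity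
      linarith
  exact h.isCoprime.dvd_of_dvd_mul_right ⟨_, heq⟩

theorem eq_zero_of_setIntegral_eq_zero (h : SchwarzData Ω A N) {r : ℂ[X]} (hd : r.degree < A.degree)
    (hr : ∀ f, BddHol Ω f → ∫ z in Ω, r.eval z * f z = 0) : r = 0 :=
  eq_zero_of_dvd_of_degree_lt (h.dvd_of_setIntegral_eq_zero hr) hd

theorem degree_pos (h : SchwarzData Ω A N) : 0 < A.degree := by
  by_contra hcon
  obtain ⟨c, hc⟩ := natDegree_eq_zero.1 (natDegree_eq_zero_iff_degree_le_zero.2 (not_lt.1 hcon))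
  have hc0 : c ≠ 0 := fun h0 => h.ne_zero (by rw [← hc, h0, C_0])
  have h1 := h.setIntegral_mul_eq_zero (BddHol.const 1)
  rw [← hc] at h1
  simp only [eval_C, mul_one, setIntegral_const] at h1
  have h2 : 0 < volume.real Ω :=
    ENNReal.toReal_pos (h.isOpen.measure_pos volume h.isConnected.nonempty).ne' h.volume_lt_top.ne
  rw [real_smul, mul_eq_zero] at h1
  exact h1.elim (fun h => h2.ne' (by exact_mod_cast h)) hc0

theorem exists_eq_mul_of_mul_schwarzNum_eq (h : SchwarzData Ω A N) {g : ℂ → ℂ} (hf : BddHol Ω f)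
    (hg : BddHol Ω g) (hfg : ∀ z ∈ Ω, f z * schwarzNum Ω A N z = A.eval z * g z) :
    ∃ g', BddHol Ω g' ∧ ∀ z ∈ Ω, f z = A.eval z * g' z := by
  obtain ⟨u, v, huv⟩ := h.isCoprime
  refine ⟨fun z => v.eval z * g z - (v.eval z * (conj z - cauchyInt Ω z / Real.pi) - u.eval z) * f z,
    ((h.bddHol_eval v).mul hg).sub ((((h.bddHol_eval v).mul h.bddHol_conj_sub).sub
      (h.bddHol_eval u)).mul hf), fun z hz => ?_⟩
  have h1 := hfg z hz
  rw [schwarzNum_eq] at h1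
  have h2 := congrArg (Polynomial.eval z) huv
  rw [eval_add, eval_mul, eval_mul, eval_one] at h2
  linear_combination (v.eval z) * h1 - f z * h2

end SchwarzData

theorem setIntegral_mul_conj_derivative {Ω : Set ℂ} {f : ℂ → ℂ} (ho : IsOpen Ω)
    (hb : Bornology.IsBounded Ω) (hf : BddHol Ω f) (p : ℂ[X]) :
    ∫ z in Ω, f z * conj (p.derivative.eval z) =
      ∑ j ∈ Finset.range (p.natDegree + 1), conj (p.coeff j) * conjMoment Ω f j := by
  have h1 : ∀ z : ℂ, f z * conj (p.derivative.eval z) =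
      ∑ j ∈ Finset.range (p.natDegree + 1),
        conj (p.coeff j) * (j * (f z * conj z ^ (j - 1))) := by
    intro z
    rw [derivative_eval, sum_over_range _ (by simp), map_sum, Finset.mul_sum]
    refine Finset.sum_congr rfl fun j _ => ?_
    simp only [map_mul, map_pow, map_natCast]
    ring
  simp only [h1]
  rw [integral_finsetSum _ fun j _ =>
    ((hf.integrableOn_mul ho hb (continuous_conj_pow _)).const_mul _).const_mul _]
  refine Finset.sum_congr rfl fun j _ => ?_
  rw [integral_const_mul, integral_const_mul]
  rfl

namespace SchwarzData

variable {Ω : Set ℂ} {A N : ℂ[X]}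

/-- Moments of the polynomials. -/
theorem setIntegral_pow_mul_conj_derivative (h : SchwarzData Ω A N) {l M : ℕ} (hM : l + 2 ≤ M)
    (p : ℂ[X]) : ∫ z in Ω, z ^ l * conj ((p * A ^ M).derivative.eval z) = 0 := by
  obtain ⟨F, hF⟩ : ∃ F : ℂ[X], (p * A ^ M).derivative = A ^ (l + 1) * F := by
    obtain ⟨d, rfl⟩ := Nat.exists_eq_add_of_le hM
    refine ⟨derivative p * A ^ (d + 1) + p * (C ((l + 2 + d : ℕ) : ℂ) * A ^ d * derivative A), ?_⟩
    rw [derivative_mul, derivative_pow, show l + 2 + d - 1 = l + 1 + d by omega]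
    ring
  have key : ∀ n : ℕ, ∀ g, BddHol Ω g → conjMoment Ω (fun z => A.eval z ^ n * g z) n = 0 := by
    intro n
    induction n with
    | zero => exact fun g _ => conjMoment_of_nonpos le_rfl
    | succ n ih =>
      intro g hg
      have h1 := h.conjMoment_succ (((h.bddHol_eval A).pow n).mul hg) n
      have h2 := ih _ (h.bddHol_schwarzNum.mul hg)
      simp only [pow_succ', mul_assoc]
      push_cast
      rw [h1, ← h2]
      congr 1
      funext z
      ring
  have h1 := key (l + 1) _ (h.bddHol_eval F)
  change ((l + 1 : ℕ) : ℂ) * ∫ z in Ω, A.eval z ^ (l + 1) * F.eval z * conj z ^ l = 0 at h1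
  have h2 := congrArg conj ((mul_eq_zero.1 h1).resolve_left (Nat.cast_ne_zero.2 l.succ_ne_zero))
  rw [map_zero, ← integral_conj] at h2
  rw [← h2]
  congr 1
  funext z
  rw [hF, eval_mul, eval_pow]
  simp only [map_mul, map_pow, conj_conj]
  ring

/-- Moments of the Bergman kernel. -/
theorem setIntegral_kernel_mul_conj_derivative (h : SchwarzData Ω A N) {k : ℂ → ℂ} {w : ℂ}
    (hw : w ∈ Ω) (hk : BddHol Ω k)
    (hrep : ∀ f, BergmanFun Ω f → f w = ∫ z in Ω, f z * conj (k z))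
    {l M : ℕ} (hM : l ≤ M) (p : ℂ[X]) :
    ∫ z in Ω, k z * z ^ l * conj ((p * (A ^ M * (X - C w) ^ 2)).derivative.eval z) = 0 := by
  set q : ℂ[X] := p * (A ^ M * (X - C w) ^ 2) with hq
  obtain ⟨d, rfl⟩ := Nat.exists_eq_add_of_le hM
  set b : ℂ → ℂ := fun z => (p * (X - C w) ^ 2).eval z *
    (schwarzNum Ω A N z ^ l * A.eval z ^ d) with hb
  have hbB : BddHol Ω b :=
    (h.bddHol_eval _).mul ((h.bddHol_schwarzNum.pow l).mul ((h.bddHol_eval A).pow d))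
  have hc : Continuous fun z => conj z ^ l * q.eval z - conj z ^ 0 * b z := by
    have h1 := h.continuous_schwarzNum
    have h2 := A.continuous
    have h3 := q.continuous
    have h4 := continuous_conj_pow l
    have h5 := continuous_conj_pow 0
    exact (h4.mul h3).sub (h5.mul ((p * (X - C w) ^ 2).continuous.mul ((h1.pow l).mul (h2.pow d))))
  have h0 : ∀ z ∉ Ω, conj z ^ l * q.eval z - conj z ^ 0 * b z = 0 := by
    intro z hz
    simp only [hb, hq, h.schwarzNum_of_notMem hz, eval_mul, eval_pow]
    ring
  have e1 := setIntegral_conj_mul_del_eq_zero h.isOpen h.isBounded (h.bddHol_eval q) hbB hk hc h0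
  have e2 := integrableOn_sq_norm_del h.isOpen h.isBounded (h.bddHol_eval q) hbB hc h0
  simp only [pow_zero, one_mul, Polynomial.deriv] at e1 e2
  have hqB : BddHol Ω fun z => q.derivative.eval z := h.bddHol_eval _
  have hdb : DifferentiableOn ℂ (_root_.deriv b) Ω := hbB.1.deriv h.isOpen
  have iA : IntegrableOn (fun z => ‖conj z ^ l * q.derivative.eval z‖ ^ 2) Ω := by
    have hc' : Continuous fun z => ‖conj z ^ l * q.derivative.eval z‖ ^ 2 := by
      have h4 := continuous_conj_pow l
      have h5 := q.derivative.continuous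
      exact (h4.mul h5).norm.pow 2
    exact IntegrableOn.mono_set (hc'.continuousOn.integrableOn_compact
      h.isBounded.isCompact_closure) subset_closure
  have hbA : BergmanFun Ω (_root_.deriv b) := by
    refine ⟨hdb, Integrable.mono' ((iA.add e2).const_mul 2) ?_ ?_⟩
    · exact ((hdb.continuousOn.norm.pow 2)).aestronglyMeasurable h.isOpen.measurableSet
    · refine Eventually.of_forall fun z => ?_
      rw [Real.norm_of_nonneg (by positivity)]
      simp only [Pi.add_apply]
      have h1 := norm_sub_le (conj z ^ l * q.derivative.eval z)
        (conj z ^ l * q.derivative.eval z - _root_.deriv b z)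
      rw [sub_sub_cancel] at h1
      nlinarith [sq_nonneg (‖conj z ^ l * q.derivative.eval z‖ -
        ‖conj z ^ l * q.derivative.eval z - _root_.deriv b z‖), norm_nonneg (_root_.deriv b z)]
  have hbw : _root_.deriv b w = 0 := by
    have h1 : HasDerivAt (fun z => (p * (X - C w) ^ 2).eval z)
        ((p * (X - C w) ^ 2).derivative.eval w) w := Polynomial.hasDerivAt _ _
    have h2 : DifferentiableAt ℂ (fun z => schwarzNum Ω A N z ^ l * A.eval z ^ d) w :=
      (((h.bddHol_schwarzNum.pow l).mul ((h.bddHol_eval A).pow d)).1).differentiableAt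
        (h.isOpen.mem_nhds hw)
    rw [show _root_.deriv b w = _ from (h1.mul h2.hasDerivAt).deriv]
    simp [derivative_pow]
  have hkm : AEStronglyMeasurable (fun z => conj (k z)) (volume.restrict Ω) :=
    (continuous_conj.comp_continuousOn hk.1.continuousOn).aestronglyMeasurable
      h.isOpen.measurableSet
  obtain ⟨Mk, hMk⟩ := hk.2
  have hbI : IntegrableOn (_root_.deriv b) Ω := by
    have i1 : IntegrableOn (fun _ : ℂ => (1 : ℝ)) Ω :=
      integrableOn_const (hs := h.volume_lt_top.ne)
    refine Integrable.mono' (i1.add hbA.2)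
      (hdb.continuousOn.aestronglyMeasurable h.isOpen.measurableSet) ?_
    refine Eventually.of_forall fun z => ?_
    simp only [Pi.add_apply]
    nlinarith [sq_nonneg (‖_root_.deriv b z‖ - 1), norm_nonneg (_root_.deriv b z)]
  have i2 : IntegrableOn (fun z => conj (k z) * _root_.deriv b z) Ω := by
    refine Integrable.bdd_mul (c := Mk) hbI hkm ((ae_restrict_iff' h.isOpen.measurableSet).2
      (Eventually.of_forall fun z hz => ?_))
    rw [norm_conj]
    exact hMk z hz
  have i1 : IntegrableOn (fun z => conj (k z) * (conj z ^ l * q.derivative.eval z)) Ω := by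
    have i0 : IntegrableOn (fun z => conj z ^ l * q.derivative.eval z) Ω := by
      simpa only [mul_comm] using
        hqB.integrableOn_mul h.isOpen h.isBounded (continuous_conj_pow l)
    refine Integrable.bdd_mul (c := Mk) i0 hkm ((ae_restrict_iff' h.isOpen.measurableSet).2
      (Eventually.of_forall fun z hz => ?_))
    rw [norm_conj]
    exact hMk z hz
  have e3 := hrep _ hbA
  simp only [mul_sub] at e1
  rw [integral_sub i1 i2] at e1
  simp only [mul_comm (_root_.deriv b _)] at e3
  rw [← e3, hbw, sub_zero] at e1
  have e4 := congrArg conj e1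
  rw [map_zero, ← integral_conj] at e4
  rw [← e4]
  congr 1
  funext z
  simp only [map_mul, map_pow, conj_conj]
  ring

theorem infinite (h : SchwarzData Ω A N) : Ω.Infinite := by
  obtain ⟨z, hz⟩ := h.isConnected.nonempty
  exact infinite_of_mem_nhds z (h.isOpen.mem_nhds hz)

theorem eq_zero_of_eval_mul_eq_zero (h : SchwarzData Ω A N) {u : ℂ → ℂ} (hu : BddHol Ω u)
    (h0 : ∀ z ∈ Ω, A.eval z * u z = 0) : ∀ z ∈ Ω, u z = 0 := by
  refine (AnalyticOnNhd.eq_zero_or_eq_zero_of_mul_eq_zero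
    ((h.bddHol_eval A).1.analyticOnNhd h.isOpen) (hu.1.analyticOnNhd h.isOpen) h0
    h.isConnected.isPreconnected).resolve_left fun h1 => h.ne_zero ?_
  exact eq_zero_of_infinite_isRoot _ (h.infinite.mono h1)

theorem exists_eq_mul_of_mul_schwarzNum_pow_eq (h : SchwarzData Ω A N) (n : ℕ) :
    ∀ {f g : ℂ → ℂ}, BddHol Ω f → BddHol Ω g →
      (∀ z ∈ Ω, f z * schwarzNum Ω A N z ^ (n + 1) = A.eval z * g z) →
      ∃ g', BddHol Ω g' ∧ ∀ z ∈ Ω, f z = A.eval z * g' z := by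
  induction n with
  | zero =>
    intro f g hf hg hfg
    exact h.exists_eq_mul_of_mul_schwarzNum_eq hf hg fun z hz => by rw [← hfg z hz]; ring
  | succ n ih =>
    intro f g hf hg hfg
    obtain ⟨g', hg', hfg'⟩ := ih (hf.mul h.bddHol_schwarzNum) hg fun z hz => by
      rw [← hfg z hz]; ring
    exact h.exists_eq_mul_of_mul_schwarzNum_eq hf hg' hfg'

theorem eq_zero_of_sum_eq_zero (h : SchwarzData Ω A N) (D : ℕ) :
    ∀ {p : ℕ → ℂ[X]}, (∀ d, (p d).degree < A.degree) →
      (∀ z ∈ Ω, ∑ d ∈ Finset.range (D + 1),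
        (p d).eval z * (schwarzNum Ω A N z ^ d * A.eval z ^ (D - d)) = 0) →
      ∀ d ≤ D, p d = 0 := by
  induction D with
  | zero =>
    intro p _ h0 d hd
    obtain rfl := Nat.le_zero.1 hd
    refine eq_zero_of_infinite_isRoot _ (h.infinite.mono fun z hz => ?_)
    simpa using h0 z hz
  | succ D ih =>
    intro p hp h0
    set u : ℂ → ℂ := fun z => ∑ d ∈ Finset.range (D + 1),
        (p d).eval z * (schwarzNum Ω A N z ^ d * A.eval z ^ (D - d)) with hu
    have huB : BddHol Ω u := .sum fun d _ =>
      (h.bddHol_eval _).mul ((h.bddHol_schwarzNum.pow _).mul ((h.bddHol_eval A).pow _))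
    have h1 : ∀ z ∈ Ω, A.eval z * u z +
        (p (D + 1)).eval z * schwarzNum Ω A N z ^ (D + 1) = 0 := by
      intro z hz
      rw [← h0 z hz, Finset.sum_range_succ _ (D + 1), Nat.sub_self, pow_zero, mul_one,
        Finset.mul_sum]
      congr 1
      refine Finset.sum_congr rfl fun d hd => ?_
      rw [Nat.succ_sub (Nat.lt_succ_iff.1 (Finset.mem_range.1 hd)), pow_succ]
      ring
    obtain ⟨g, hg, hpg⟩ := h.exists_eq_mul_of_mul_schwarzNum_pow_eq D (h.bddHol_eval (p (D + 1)))
      ((BddHol.const (-1)).mul huB) fun z hz => by linear_combination h1 z hz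
    have htop : p (D + 1) = 0 := by
      refine h.eq_zero_of_setIntegral_eq_zero (hp _) fun f hf => ?_
      rw [← h.setIntegral_mul_eq_zero (hg.mul hf)]
      refine setIntegral_congr_fun h.isOpen.measurableSet fun z hz => ?_
      simp only [hpg z hz, mul_assoc]
    have h2 := h.eq_zero_of_eval_mul_eq_zero huB fun z hz => by
      have := h1 z hz
      rwa [htop, eval_zero, zero_mul, add_zero] at this
    intro d hd
    rcases Nat.le_succ_iff.1 hd with h3 | rfl
    · exact ih hp h2 d h3
    · exact htop

theorem schwarzNum_ne_zero (h : SchwarzData Ω A N) {w : ℂ} (hw : A.eval w = 0) :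
    schwarzNum Ω A N w ≠ 0 := by
  obtain ⟨u, v, huv⟩ := h.isCoprime
  rw [schwarzNum_eq, hw, zero_mul, zero_add]
  intro h0
  have := congrArg (Polynomial.eval w) huv
  simp [hw, h0] at this

theorem eq_zero_of_conjMoment_eq_zero (h : SchwarzData Ω A N) {G : ℂ → ℂ} (hG : BddHol Ω G)
    (h0 : ∀ F, BddHol Ω F → ∀ k, conjMoment Ω (fun z => G z * F z) k = 0) :
    ∀ z ∈ Ω, G z = 0 := by
  have key : ∀ n : ℕ, ∃ g, BddHol Ω g ∧
      (∀ F, BddHol Ω F → ∀ k, conjMoment Ω (fun z => g z * F z) k = 0) ∧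
      ∀ z ∈ Ω, G z * schwarzNum Ω A N z ^ n = A.eval z ^ n * g z := by
    intro n
    induction n with
    | zero => exact ⟨G, hG, h0, fun z _ => by ring⟩
    | succ n ih =>
      obtain ⟨g, hg, hg0, hGg⟩ := ih
      obtain ⟨r, hr, g', hg', hrg⟩ := h.exists_eq_add_mul hg
      have hr0 : r = 0 := by
        refine h.eq_zero_of_setIntegral_eq_zero hr fun F hF => ?_
        have h1 := hg0 F hF 1
        have h2 := h.setIntegral_mul_eq_zero (hg'.mul hF)
        rw [conjMoment_one] at h1
        have i1 := ((h.bddHol_eval r).mul hF).integrableOn h.isOpen h.volume_lt_top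
        have i2 := ((h.bddHol_eval A).mul (hg'.mul hF)).integrableOn h.isOpen h.volume_lt_top
        have h3 := integral_add i1 i2
        rw [h2, add_zero] at h3
        rw [← h3, ← h1]
        refine setIntegral_congr_fun h.isOpen.measurableSet fun z hz => ?_
        simp only [hrg z hz]
        ring
      have hgA : ∀ z ∈ Ω, g z = A.eval z * g' z := fun z hz => by
        rw [hrg z hz, hr0, eval_zero, zero_add]
      refine ⟨fun z => schwarzNum Ω A N z * g' z, h.bddHol_schwarzNum.mul hg', fun F hF k => ?_,
        fun z hz => ?_⟩
      · simp only [mul_assoc]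
        rw [← h.conjMoment_succ (hg'.mul hF) k, ← hg0 F hF (k + 1)]
        refine conjMoment_congr h.isOpen (fun z hz => ?_) _
        simp only [hgA z hz, mul_assoc]
      · rw [pow_succ, ← mul_assoc, hGg z hz, hgA z hz]
        ring
  obtain ⟨w, hw⟩ := IsAlgClosed.exists_root A h.degree_pos.ne'
  have hwΩ := h.mem_of_root w hw
  have hAan : AnalyticAt ℂ (fun z => A.eval z) w :=
    (h.bddHol_eval A).1.analyticAt (h.isOpen.mem_nhds hwΩ)
  have hGan : AnalyticAt ℂ G w := hG.1.analyticAt (h.isOpen.mem_nhds hwΩ)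
  have hBan : AnalyticAt ℂ (schwarzNum Ω A N) w :=
    h.bddHol_schwarzNum.1.analyticAt (h.isOpen.mem_nhds hwΩ)
  have htop : analyticOrderAt G w = ⊤ := by
    refine ENat.eq_top_iff_forall_ge.2 fun n => ?_
    obtain ⟨g, hg, -, hGg⟩ := key n
    have hgan : AnalyticAt ℂ g w := hg.1.analyticAt (h.isOpen.mem_nhds hwΩ)
    have h1 : analyticOrderAt (G * schwarzNum Ω A N ^ n) w =
        analyticOrderAt ((fun z => A.eval z) ^ n * g) w :=
      analyticOrderAt_congr (Filter.eventually_of_mem (h.isOpen.mem_nhds hwΩ) fun z hz => hGg z hz)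
    rw [analyticOrderAt_mul hGan (hBan.pow n), analyticOrderAt_mul (hAan.pow n) hgan,
      analyticOrderAt_pow hBan, analyticOrderAt_pow hAan,
      hBan.analyticOrderAt_eq_zero.2 (h.schwarzNum_ne_zero hw), smul_zero, add_zero] at h1
    rw [h1]
    have h2 : 1 ≤ analyticOrderAt (fun z => A.eval z) w :=
      Order.one_le_iff_ne_zero.2 (hAan.analyticOrderAt_ne_zero.2 hw)
    calc (n : ℕ∞) = n • 1 := by simp
      _ ≤ n • analyticOrderAt (fun z => A.eval z) w := nsmul_le_nsmul_right h2 n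
      _ ≤ _ := le_self_add
  exact (hG.1.analyticOnNhd h.isOpen).eqOn_zero_of_preconnected_of_eventuallyEq_zero
    h.isConnected.isPreconnected hwΩ (analyticOrderAt_eq_top.1 htop)

theorem conjMoment_pow_mul (h : SchwarzData Ω A N) (n : ℕ) : ∀ {f : ℂ → ℂ}, BddHol Ω f →
    ∀ k : ℤ, conjMoment Ω (fun z => A.eval z ^ n * f z) (k + n) =
      conjMoment Ω (fun z => schwarzNum Ω A N z ^ n * f z) k := by
  induction n with
  | zero => intro f _ k; simp
  | succ n ih =>
    intro f hf k
    have h1 := h.conjMoment_succ (((h.bddHol_eval A).pow n).mul hf) (k + n)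
    have h2 := ih (h.bddHol_schwarzNum.mul hf) k
    simp only [pow_succ', mul_assoc]
    push_cast
    rw [← add_assoc, h1]
    simp only [mul_left_comm _ (schwarzNum Ω A N _)] at h2 ⊢
    exact h2

theorem sum_eq_zero_of_conjMoment_eq_zero (h : SchwarzData Ω A N) {D : ℕ} {T : ℕ → ℂ → ℂ}
    (hT : ∀ d, BddHol Ω (T d))
    (h0 : ∀ l < A.natDegree, ∀ k : ℤ,
      ∑ d ∈ Finset.range (D + 1), conjMoment Ω (fun z => T d z * z ^ l) (k + d) = 0) :
    ∀ z ∈ Ω, ∑ d ∈ Finset.range (D + 1),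
      T d z * (schwarzNum Ω A N z ^ d * A.eval z ^ (D - d)) = 0 := by
  have hpow : ∀ l : ℕ, BddHol Ω fun z => z ^ l := fun l =>
    (h.bddHol_eval (X ^ l)).congr fun z _ => by simp
  have h1 : ∀ n : ℕ, ∀ F, BddHol Ω F →
      ∑ d ∈ Finset.range (D + 1), conjMoment Ω (fun z => T d z * F z) ((n : ℤ) - D + d) = 0 := by
    intro n
    induction n with
    | zero =>
      intro F _
      refine Finset.sum_eq_zero fun d hd => conjMoment_of_nonpos ?_
      have := Finset.mem_range.1 hd
      push_cast
      omega
    | succ n ih =>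
      intro F hF
      obtain ⟨p, hp, g, hg, hFg⟩ := h.exists_eq_add_mul hF
      have hp' : p.natDegree < A.natDegree := by
        rcases eq_or_ne p 0 with rfl | hp0
        · rw [natDegree_zero]
          exact natDegree_pos_iff_degree_pos.2 h.degree_pos
        · exact natDegree_lt_natDegree hp0 hp
      have h2 : ∀ d k, conjMoment Ω (fun z => T d z * F z) k =
          (∑ l ∈ Finset.range A.natDegree,
            p.coeff l * conjMoment Ω (fun z => T d z * z ^ l) k) +
          conjMoment Ω (fun z => schwarzNum Ω A N z * (T d z * g z)) (k - 1) := by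
        intro d k
        have h3 : EqOn (fun z => T d z * F z) (fun z =>
            (∑ l ∈ Finset.range A.natDegree, p.coeff l * (T d z * z ^ l)) +
              A.eval z * (T d z * g z)) Ω := by
          intro z hz
          simp only [hFg z hz]
          rw [eval_eq_sum_range' hp', mul_add, Finset.mul_sum]
          congr 1
          · exact Finset.sum_congr rfl fun l _ => by ring
          · ring
        rw [conjMoment_congr h.isOpen h3, conjMoment_add h.isOpen h.isBounded
          (.sum fun l _ => (BddHol.const _).mul ((hT d).mul (hpow l)))
          ((h.bddHol_eval A).mul ((hT d).mul hg)), conjMoment_sum h.isOpen h.isBounded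
          fun l _ => (BddHol.const _).mul ((hT d).mul (hpow l)),
          ← h.conjMoment_succ ((hT d).mul hg), sub_add_cancel]
        simp only [conjMoment_const_mul]
      simp only [h2]
      rw [Finset.sum_add_distrib, Finset.sum_comm]
      have h3 := ih _ (h.bddHol_schwarzNum.mul hg)
      simp only [← Finset.mul_sum]
      rw [Finset.sum_eq_zero fun l hl => ?_, zero_add]
      · rw [← h3]
        refine Finset.sum_congr rfl fun d _ => ?_
        rw [show ((n + 1 : ℕ) : ℤ) - D + d - 1 = (n : ℤ) - D + d by push_cast; ring]
        congr 1
        funext z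
        ring
      · rw [h0 l (Finset.mem_range.1 hl), mul_zero]
  have h2 : ∀ F, BddHol Ω F → ∀ k : ℤ,
      ∑ d ∈ Finset.range (D + 1), conjMoment Ω (fun z => T d z * F z) (k + d) = 0 := by
    intro F hF k
    by_cases hk : 0 ≤ k + D
    · obtain ⟨n, hn⟩ := Int.eq_ofNat_of_zero_le hk
      rw [← h1 n F hF, ← hn]
      simp only [add_sub_cancel_right]
    · refine Finset.sum_eq_zero fun d hd => conjMoment_of_nonpos ?_
      have := Finset.mem_range.1 hd
      omega
  refine h.eq_zero_of_conjMoment_eq_zero (.sum fun d _ =>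
    (hT d).mul ((h.bddHol_schwarzNum.pow _).mul ((h.bddHol_eval A).pow _))) fun F hF k => ?_
  rw [← h2 _ (((h.bddHol_eval A).pow D).mul hF) k]
  simp only [Finset.sum_mul]
  rw [conjMoment_sum h.isOpen h.isBounded fun d _ =>
    ((hT d).mul ((h.bddHol_schwarzNum.pow _).mul ((h.bddHol_eval A).pow _))).mul hF]
  refine Finset.sum_congr rfl fun d hd => ?_
  have hd' : d ≤ D := Nat.lt_succ_iff.1 (Finset.mem_range.1 hd)
  have h3 := h.conjMoment_pow_mul d (((h.bddHol_eval A).pow (D - d)).mul ((hT d).mul hF)) k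
  refine Eq.trans ?_ (h3.symm.trans ?_)
  · congr 1
    funext z
    ring
  · congr 1
    funext z
    rw [← mul_assoc, ← pow_add, Nat.add_sub_cancel' hd']
    ring

end SchwarzData

/-- The shift of two-sided sequences. -/
def seqShift : Module.End ℂ (ℤ → ℂ) := LinearMap.funLeft ℂ ℂ fun k => k + 1

theorem seqShift_pow_apply (n : ℕ) (α : ℤ → ℂ) (k : ℤ) : (seqShift ^ n) α k = α (k + n) := by
  induction n generalizing k with
  | zero => simp
  | succ n ih =>
    rw [pow_succ', Module.End.mul_apply]
    change (seqShift ^ n) α (k + 1) = _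
    rw [ih]
    congr 1
    push_cast
    ring

theorem aeval_seqShift_apply {p : ℂ[X]} {D : ℕ} (hp : p.natDegree ≤ D) (α : ℤ → ℂ) (k : ℤ) :
    aeval seqShift p α k = ∑ d ∈ Finset.range (D + 1), p.coeff d * α (k + d) := by
  rw [aeval_eq_sum_range' (Nat.lt_succ_of_le hp), LinearMap.sum_apply, Finset.sum_apply]
  refine Finset.sum_congr rfl fun d _ => ?_
  rw [LinearMap.smul_apply, Pi.smul_apply, seqShift_pow_apply, smul_eq_mul]

theorem exists_aeval_seqShift_single {β : ℤ → ℂ} (D : ℕ) (h0 : ∀ k : ℤ, 0 ≤ k → β k = 0)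
    (hD : ∀ k : ℤ, k + D ≤ 0 → β k = 0) :
    ∃ ρ : ℂ[X], ρ.natDegree ≤ D ∧ aeval seqShift ρ (Pi.single (0 : ℤ) (1 : ℂ)) = β := by
  set ρ : ℂ[X] := ∑ j ∈ Finset.range (D + 1), monomial j (β (-j)) with hρ
  have hdeg : ρ.natDegree ≤ D := natDegree_sum_le_of_forall_le _ _ fun j hj =>
    (natDegree_monomial_le _).trans (Nat.lt_succ_iff.1 (Finset.mem_range.1 hj))
  have hcoeff : ∀ d ∈ Finset.range (D + 1), ρ.coeff d = β (-d) := by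
    intro d hd
    rw [hρ, finsetSum_coeff]
    simp only [coeff_monomial]
    rw [Finset.sum_ite_eq', if_pos hd]
  refine ⟨ρ, hdeg, ?_⟩
  funext k
  rw [aeval_seqShift_apply hdeg]
  by_cases hk : 0 ≤ -k ∧ -k ≤ D
  · obtain ⟨n, hn⟩ := Int.eq_ofNat_of_zero_le hk.1
    obtain rfl : k = -(n : ℤ) := by omega
    rw [Finset.sum_eq_single n, hcoeff n, neg_add_cancel, Pi.single_eq_same, mul_one]
    · exact Finset.mem_range.2 (by omega)
    · intro d _ hd
      rw [Pi.single_eq_of_ne (by omega), mul_zero]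
    · intro hn'
      exact absurd (Finset.mem_range.2 (by omega)) hn'
  · rw [Finset.sum_eq_zero fun d hd => ?_]
    · by_cases h1 : 0 ≤ k
      · exact (h0 k h1).symm
      · exact (hD k (by omega)).symm
    · have := Finset.mem_range.1 hd
      rw [Pi.single_eq_of_ne (by omega), mul_zero]

theorem exists_aeval_seqShift_conjMoment {Ω : Set ℂ} {f : ℂ → ℂ} (ho : IsOpen Ω)
    (hb : Bornology.IsBounded Ω) (hf : BddHol Ω f) {q : ℂ[X]}
    (h0 : ∀ p : ℂ[X], ∫ z in Ω, f z * conj ((p * q).derivative.eval z) = 0) :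
    ∃ ρ : ℂ[X], ρ.natDegree ≤ q.natDegree ∧ aeval seqShift ρ (Pi.single (0 : ℤ) (1 : ℂ)) =
      aeval seqShift (q.map (starRingEnd ℂ)) (conjMoment Ω f) := by
  refine exists_aeval_seqShift_single _ (fun k hk => ?_) fun k hk => ?_
  · obtain ⟨n, rfl⟩ := Int.eq_ofNat_of_zero_le hk
    have h1 := h0 (X ^ n)
    rw [setIntegral_mul_conj_derivative ho hb hf] at h1
    have h2 : aeval seqShift ((X ^ n * q).map (starRingEnd ℂ)) (conjMoment Ω f) 0 = 0 := by
      rw [aeval_seqShift_apply (natDegree_map_le), ← h1]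
      simp only [coeff_map, zero_add]
    rw [Polynomial.map_mul, Polynomial.map_pow, map_X, map_mul, map_pow, aeval_X,
      Module.End.mul_apply, seqShift_pow_apply, zero_add] at h2
    exact h2
  · rw [aeval_seqShift_apply natDegree_map_le]
    refine Finset.sum_eq_zero fun d hd => ?_
    have := Finset.mem_range.1 hd
    rw [conjMoment_of_nonpos (by omega), mul_zero]

namespace SchwarzData

variable {Ω : Set ℂ} {A N : ℂ[X]}

theorem bddHol_pow (h : SchwarzData Ω A N) (l : ℕ) : BddHol Ω fun z => z ^ l :=
  (h.bddHol_eval (X ^ l)).congr fun z _ => by simp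

theorem sum_eq_zero_of_aeval_seqShift_eq (h : SchwarzData Ω A N) {D m : ℕ} {q : ℂ[X]}
    (hq : q.natDegree ≤ D) {b : Fin m → ℂ[X]} (hb : ∀ j, (b j).natDegree ≤ D) {f : ℂ → ℂ}
    (hf : BddHol Ω f)
    (heq : ∀ l < A.natDegree, aeval seqShift q (conjMoment Ω fun z => f z * z ^ l) =
      ∑ j : Fin m, aeval seqShift (b j) (conjMoment Ω fun z => z ^ (l + j))) :
    ∀ z ∈ Ω, ∑ d ∈ Finset.range (D + 1), (q.coeff d * f z - ∑ j, (b j).coeff d * z ^ (j : ℕ)) *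
      (schwarzNum Ω A N z ^ d * A.eval z ^ (D - d)) = 0 := by
  have hT1 : ∀ d, BddHol Ω fun z => ∑ j : Fin m, (b j).coeff d * z ^ (j : ℕ) := fun d =>
    .sum fun j _ => (BddHol.const _).mul (h.bddHol_pow _)
  refine h.sum_eq_zero_of_conjMoment_eq_zero
    (fun d => ((BddHol.const _).mul hf).sub (hT1 d)) fun l hl k => ?_
  have h1 := congrFun (heq l hl) k
  rw [aeval_seqShift_apply hq, Finset.sum_apply] at h1
  simp only [aeval_seqShift_apply (hb _)] at h1
  rw [Finset.sum_comm, ← sub_eq_zero, ← Finset.sum_sub_distrib] at h1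
  rw [← h1]
  refine Finset.sum_congr rfl fun d _ => ?_
  have h2 : (fun z => (q.coeff d * f z - ∑ j, (b j).coeff d * z ^ (j : ℕ)) * z ^ l) =
      fun z => q.coeff d * (f z * z ^ l) + (-1) * ∑ j, (b j).coeff d * z ^ (l + j) := by
    funext z
    rw [sub_mul, Finset.sum_mul, mul_assoc, sub_eq_add_neg, neg_one_mul]
    congr 2
    exact Finset.sum_congr rfl fun j _ => by ring
  rw [h2, conjMoment_add h.isOpen h.isBounded ((BddHol.const _).mul (hf.mul (h.bddHol_pow l)))
    ((BddHol.const _).mul (.sum fun j _ => (BddHol.const _).mul (h.bddHol_pow _))),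
    conjMoment_const_mul, conjMoment_const_mul, conjMoment_sum h.isOpen h.isBounded fun j _ =>
      (BddHol.const _).mul (h.bddHol_pow _)]
  simp only [conjMoment_const_mul]
  ring

/-- The Bergman kernel in the first variable is a rational function of the variable and of the
Schwarz function. -/
theorem exists_kernel_eq (h : SchwarzData Ω A N) :
    ∃ a : ℂ[X], a ≠ 0 ∧ ∃ D : ℕ, ∀ w ∈ Ω, ∀ k, BddHol Ω k →
      (∀ f, BergmanFun Ω f → f w = ∫ z in Ω, f z * conj (k z)) →
      ∃ c : Fin A.natDegree → ℂ[X], (∀ j, (c j).natDegree ≤ D) ∧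
        ∀ z ∈ Ω, A.eval z ≠ 0 →
          a.eval (schwarzNum Ω A N z / A.eval z) *
            (schwarzNum Ω A N z / A.eval z - conj w) ^ 2 * k z =
          ∑ j, (c j).eval (schwarzNum Ω A N z / A.eval z) * z ^ (j : ℕ) := by
  set m := A.natDegree with hm
  set M := 2 * m + 2 with hM
  set p₀ : ℂ[X] := (A ^ M).map (starRingEnd ℂ) with hp₀
  have hp₀0 : p₀ ≠ 0 := (Polynomial.map_ne_zero_iff (starRingEnd ℂ).injective).2
    (pow_ne_zero _ h.ne_zero)
  have hpol : ∀ l : ℕ, ∃ ρ : ℂ[X], l ≤ 2 * m →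
      aeval seqShift ρ (Pi.single (0 : ℤ) (1 : ℂ)) =
        aeval seqShift p₀ (conjMoment Ω fun z => z ^ l) := by
    intro l
    by_cases hl : l ≤ 2 * m
    · obtain ⟨ρ, -, hρ⟩ := exists_aeval_seqShift_conjMoment h.isOpen h.isBounded (h.bddHol_pow l)
        fun p => h.setIntegral_pow_mul_conj_derivative (show l + 2 ≤ M by omega) p
      exact ⟨ρ, fun _ => hρ⟩
    · exact ⟨0, fun hl' => absurd hl' hl⟩
  choose ρ hρ using hpol
  set H : Matrix (Fin m) (Fin m) ℂ[X] := Matrix.of fun l j => ρ (l + j) with hH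
  have hHmul : ∀ b : Fin m → ℂ[X], ∀ l : Fin m,
      ∑ j : Fin m, aeval seqShift (p₀ * b j) (conjMoment Ω fun z => z ^ ((l : ℕ) + j)) =
        aeval seqShift (H.mulVec b l) (Pi.single (0 : ℤ) (1 : ℂ)) := by
    intro b l
    rw [Matrix.mulVec, dotProduct, map_sum, LinearMap.sum_apply]
    refine Finset.sum_congr rfl fun j _ => ?_
    rw [hH, Matrix.of_apply, mul_comm p₀, mul_comm (ρ _), map_mul, map_mul, Module.End.mul_apply,
      Module.End.mul_apply, hρ _ (by omega)]
  have hdet : H.det ≠ 0 := by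
    intro hdet
    obtain ⟨b, hb0, hb⟩ := Matrix.exists_mulVec_eq_zero_iff.2 hdet
    refine hb0 ?_
    set D := ∑ j, (p₀ * b j).natDegree with hD
    have hbD : ∀ j, (p₀ * b j).natDegree ≤ D := fun j =>
      Finset.single_le_sum (f := fun j => (p₀ * b j).natDegree) (fun _ _ => Nat.zero_le _)
        (Finset.mem_univ j)
    have h1 := h.sum_eq_zero_of_aeval_seqShift_eq (q := 0) (D := D) (by simp) hbD (BddHol.const 0)
      fun l hl => by
        rw [hHmul b ⟨l, hl⟩, hb]
        simp
    have h2 := h.eq_zero_of_sum_eq_zero D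
      (p := fun d => ∑ j : Fin m, C ((p₀ * b j).coeff d) * X ^ (j : ℕ)) (fun d => ?_)
      fun z hz => ?_
    · funext j
      refine (mul_eq_zero.1 (?_ : p₀ * b j = 0)).resolve_left hp₀0
      ext d
      rw [coeff_zero]
      rcases le_or_gt d D with hd | hd
      · have h3 := congrArg (fun p => coeff p j) (h2 d hd)
        simp only [finsetSum_coeff, coeff_C_mul_X_pow, coeff_zero, Fin.val_inj] at h3
        simpa using h3
      · exact coeff_eq_zero_of_natDegree_lt ((hbD j).trans_lt hd)
    · rw [degree_eq_natDegree h.ne_zero]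
      exact degree_sum_fin_lt _
    · have h3 := h1 z hz
      rw [← neg_eq_zero, ← h3, ← Finset.sum_neg_distrib]
      refine Finset.sum_congr rfl fun d _ => ?_
      simp only [eval_finsetSum, eval_mul, eval_C, eval_pow, eval_X, coeff_zero]
      ring
  set D₁ := ∑ j : Fin m, ∑ l : Fin m, (H.adjugate j l).natDegree with hD₁
  set D := p₀.natDegree + H.det.natDegree + ((A ^ M).natDegree + 2) + D₁ with hD
  refine ⟨p₀ * H.det, mul_ne_zero hp₀0 hdet, D, fun w hw k hk hrep => ?_⟩
  set q := A ^ M * (X - C w) ^ 2 with hq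
  have hqdeg : q.natDegree ≤ (A ^ M).natDegree + 2 := by
    refine natDegree_mul_le.trans (add_le_add_right ?_ _)
    refine natDegree_pow_le.trans ?_
    rw [natDegree_X_sub_C]
  have hqmap : q.map (starRingEnd ℂ) = p₀ * (X - C (conj w)) ^ 2 := by
    rw [hq, Polynomial.map_mul, ← hp₀, Polynomial.map_pow, Polynomial.map_sub, map_X, map_C]
  have hker : ∀ l : Fin m, ∃ r : ℂ[X], r.natDegree ≤ (A ^ M).natDegree + 2 ∧
      aeval seqShift r (Pi.single (0 : ℤ) (1 : ℂ)) =
        aeval seqShift (q.map (starRingEnd ℂ)) (conjMoment Ω fun z => k z * z ^ (l : ℕ)) := by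
    intro l
    obtain ⟨r, hr, hr'⟩ := exists_aeval_seqShift_conjMoment h.isOpen h.isBounded
      (hk.mul (h.bddHol_pow l)) fun p =>
        h.setIntegral_kernel_mul_conj_derivative hw hk hrep (show (l : ℕ) ≤ M by omega) p
    exact ⟨r, hr.trans hqdeg, hr'⟩
  choose r hr hr' using hker
  set b := H.adjugate.mulVec r with hb
  have hHb : ∀ l, H.mulVec b l = H.det * r l := by
    intro l
    rw [hb, Matrix.mulVec_mulVec, Matrix.mul_adjugate, Matrix.smul_mulVec, Matrix.one_mulVec,
      Pi.smul_apply, smul_eq_mul]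
  have hbdeg : ∀ j, (p₀ * b j).natDegree ≤ D := by
    intro j
    have h1 : (b j).natDegree ≤ D₁ + ((A ^ M).natDegree + 2) := by
      rw [hb, Matrix.mulVec, dotProduct]
      refine natDegree_sum_le_of_forall_le _ _ fun l _ => natDegree_mul_le.trans
        (add_le_add ?_ (hr l))
      exact (Finset.single_le_sum (f := fun l => (H.adjugate j l).natDegree)
        (fun _ _ => Nat.zero_le _) (Finset.mem_univ l)).trans
        (Finset.single_le_sum (f := fun j => ∑ l, (H.adjugate j l).natDegree)
          (fun _ _ => Nat.zero_le _) (Finset.mem_univ j))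
    exact natDegree_mul_le.trans (by omega)
  have hqD : (H.det * q.map (starRingEnd ℂ)).natDegree ≤ D := by
    refine natDegree_mul_le.trans ?_
    have := natDegree_map_le (p := q) (f := starRingEnd ℂ)
    omega
  have h1 := h.sum_eq_zero_of_aeval_seqShift_eq hqD hbdeg hk fun l hl => by
    rw [hHmul b ⟨l, hl⟩, hHb, map_mul, map_mul, Module.End.mul_apply, Module.End.mul_apply,
      hr' ⟨l, hl⟩]
  refine ⟨fun j => p₀ * b j, hbdeg, fun z hz hAz => ?_⟩
  set s := schwarzNum Ω A N z / A.eval z with hs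
  have hB : schwarzNum Ω A N z = A.eval z * s := by rw [hs]; field_simp
  have h2 := h1 z hz
  have h3 : ∀ p : ℂ[X], p.natDegree ≤ D → p.eval s * A.eval z ^ D =
      ∑ d ∈ Finset.range (D + 1),
        p.coeff d * (schwarzNum Ω A N z ^ d * A.eval z ^ (D - d)) := by
    intro p hp
    rw [eval_eq_sum_range' (Nat.lt_succ_of_le hp), Finset.sum_mul]
    refine Finset.sum_congr rfl fun d hd => ?_
    rw [hB, mul_pow, mul_comm (A.eval z ^ d), mul_assoc, mul_assoc, ← pow_add,
      Nat.add_sub_cancel' (Nat.lt_succ_iff.1 (Finset.mem_range.1 hd))]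
  have h4 : (H.det * q.map (starRingEnd ℂ)).eval s * A.eval z ^ D * k z =
      ∑ j, (p₀ * b j).eval s * A.eval z ^ D * z ^ (j : ℕ) := by
    simp only [h3 _ hqD, h3 _ (hbdeg _), Finset.sum_mul]
    rw [Finset.sum_comm, ← sub_eq_zero, ← Finset.sum_sub_distrib, ← h2]
    refine Finset.sum_congr rfl fun d _ => ?_
    rw [sub_mul, Finset.sum_mul]
    congr 1
    · ring
    · exact Finset.sum_congr rfl fun j _ => by ring
  refine mul_left_cancel₀ (pow_ne_zero D hAz) ?_
  rw [Finset.mul_sum]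
  refine Eq.trans ?_ (h4.trans (Finset.sum_congr rfl fun j _ => by ring))
  rw [hqmap]
  simp only [eval_mul, eval_pow, eval_sub, eval_X, eval_C]
  ring

end SchwarzData

theorem eval_mvPolynomial_aeval_X {σ : Type*} (x : σ → ℂ) (i : σ) (p : ℂ[X]) :
    MvPolynomial.eval x (aeval (MvPolynomial.X i) p) = p.eval (x i) := by
  induction p using Polynomial.induction_on' with
  | add p q hp hq => rw [map_add, map_add, hp, hq, eval_add]
  | monomial n c =>
    rw [aeval_monomial, map_mul, map_pow, MvPolynomial.eval_X, eval_monomial]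
    congr 1
    exact MvPolynomial.eval_C c

namespace SchwarzData

variable {Ω : Set ℂ} {A N : ℂ[X]}

theorem coeff_eq_zero_of_sum_eq_zero (h : SchwarzData Ω A N) {D : ℕ}
    {c : Fin (D + 1) → Fin A.natDegree → ℂ}
    (hc : ∀ z ∈ Ω, A.eval z ≠ 0 →
      ∑ d, ∑ j, c d j * ((schwarzNum Ω A N z / A.eval z) ^ (d : ℕ) * z ^ (j : ℕ)) = 0) : c = 0 := by
  set p : ℕ → ℂ[X] := fun d => ∑ j : Fin A.natDegree,
    C (if hd : d < D + 1 then c ⟨d, hd⟩ j else 0) * X ^ (j : ℕ) with hp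
  have hu : BddHol Ω fun z => ∑ d ∈ Finset.range (D + 1),
      (p d).eval z * (schwarzNum Ω A N z ^ d * A.eval z ^ (D - d)) := .sum fun d _ =>
    (h.bddHol_eval _).mul ((h.bddHol_schwarzNum.pow _).mul ((h.bddHol_eval A).pow _))
  have h1 := h.eq_zero_of_eval_mul_eq_zero hu fun z hz => by
    by_cases hA : A.eval z = 0
    · rw [hA, zero_mul]
    refine mul_eq_zero_of_right _ (Eq.trans ?_ (mul_eq_zero_of_right (A.eval z ^ D) (hc z hz hA)))
    rw [Finset.sum_range, Finset.mul_sum]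
    refine Finset.sum_congr rfl fun d _ => ?_
    simp only [hp, eval_finsetSum, eval_mul, eval_C, eval_pow, eval_X, dif_pos d.2, Fin.eta]
    rw [Finset.sum_mul, Finset.mul_sum]
    refine Finset.sum_congr rfl fun j _ => ?_
    have h2 : A.eval z ^ D = A.eval z ^ (d : ℕ) * A.eval z ^ (D - d) := by
      rw [← pow_add, Nat.add_sub_cancel' (Nat.lt_succ_iff.1 d.2)]
    rw [h2, div_pow]
    field_simp
  have h2 := h.eq_zero_of_sum_eq_zero D (p := p) (fun d => by
    rw [degree_eq_natDegree h.ne_zero]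
    exact degree_sum_fin_lt _) h1
  funext d j
  have h3 := congrArg (fun p => coeff p j) (h2 d (Nat.lt_succ_iff.1 d.2))
  simp only [hp, dif_pos d.2, Fin.eta, finsetSum_coeff, coeff_C_mul_X_pow, coeff_zero,
    Fin.val_inj] at h3
  simpa using h3

theorem exists_interpolation (h : SchwarzData Ω A N) (D : ℕ) :
    ∃ Z : Finset ℂ, (∀ ζ ∈ Z, ζ ∈ Ω ∧ A.eval ζ ≠ 0) ∧
      ∃ e : Fin (D + 1) → Fin A.natDegree → ℂ → ℂ,
        ∀ (c : Fin (D + 1) → Fin A.natDegree → ℂ) (d : Fin (D + 1)) (j : Fin A.natDegree),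
          c d j = ∑ ζ ∈ Z, e d j ζ * ∑ d', ∑ j', c d' j' *
            ((schwarzNum Ω A N ζ / A.eval ζ) ^ (d' : ℕ) * ζ ^ (j' : ℕ)) := by
  set U : Set ℂ := {z | z ∈ Ω ∧ A.eval z ≠ 0} with hU
  set vec : ℂ → (Fin (D + 1) × Fin A.natDegree → ℂ) := fun z i =>
    (schwarzNum Ω A N z / A.eval z) ^ (i.1 : ℕ) * z ^ (i.2 : ℕ) with hvec
  have hspan : Submodule.span ℂ (vec '' U) = ⊤ := by
    by_contra hne
    obtain ⟨f, hf0, hf⟩ := Submodule.exists_le_ker_of_lt_top _ (lt_top_iff_ne_top.2 hne)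
    have h1 : ∀ v : Fin (D + 1) × Fin A.natDegree → ℂ, f v = ∑ i, f (Pi.single i 1) * v i := by
      intro v
      conv_lhs => rw [pi_eq_sum_univ' v, map_sum]
      refine Finset.sum_congr rfl fun i _ => ?_
      rw [map_smul, smul_eq_mul, mul_comm]
    have h2 := h.coeff_eq_zero_of_sum_eq_zero (D := D) (c := fun d j => f (Pi.single (d, j) 1))
      fun z hz hA => by
        have h3 : f (vec z) = 0 := hf (Submodule.subset_span ⟨z, ⟨hz, hA⟩, rfl⟩)
        rw [h1, Fintype.sum_prod_type] at h3
        exact h3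
    refine hf0 (LinearMap.ext fun v => ?_)
    rw [h1, LinearMap.zero_apply]
    refine Finset.sum_eq_zero fun i _ => ?_
    have := congrFun (congrFun h2 i.1) i.2
    simp only [Pi.zero_apply, Prod.mk.eta] at this
    rw [this, zero_mul]
  have hl : ∀ i : Fin (D + 1) × Fin A.natDegree, ∃ l ∈ Finsupp.supported ℂ ℂ U,
      Finsupp.linearCombination ℂ vec l = Pi.single i 1 := fun i =>
    (Finsupp.mem_span_image_iff_linearCombination ℂ).1 (by rw [hspan]; trivial)
  choose l hlU hl using hl
  refine ⟨Finset.univ.biUnion fun i => (l i).support, fun ζ hζ => ?_, fun d j ζ => l (d, j) ζ,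
    fun c d j => ?_⟩
  · obtain ⟨i, -, hi⟩ := Finset.mem_biUnion.1 hζ
    exact (Finsupp.mem_supported ℂ _).1 (hlU i) hi
  · set Z := Finset.univ.biUnion fun i => (l i).support
    have h1 : ∀ i', (Pi.single (d, j) 1 : Fin (D + 1) × Fin A.natDegree → ℂ) i' =
        ∑ ζ ∈ Z, l (d, j) ζ * vec ζ i' := by
      intro i'
      rw [← hl (d, j), Finsupp.linearCombination_apply, Finsupp.sum_of_support_subset (s := Z) _
        (Finset.subset_biUnion_of_mem (fun i => (l i).support) (Finset.mem_univ _)) _ (by simp),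
        Finset.sum_apply]
      rfl
    have h2 : c d j = ∑ i' : Fin (D + 1) × Fin A.natDegree, c i'.1 i'.2 *
        (Pi.single (d, j) 1 : Fin (D + 1) × Fin A.natDegree → ℂ) i' := by
      rw [Finset.sum_eq_single (d, j) (fun i' _ hi' => by rw [Pi.single_eq_of_ne hi', mul_zero])
        fun hn => absurd (Finset.mem_univ _) hn, Pi.single_eq_same, mul_one]
    rw [h2]
    simp only [h1, ← Fintype.sum_prod_type', Finset.mul_sum]
    rw [Finset.sum_comm]
    refine Finset.sum_congr rfl fun ζ _ => Finset.sum_congr rfl fun i' _ => ?_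
    simp only [hvec]
    ring

theorem exists_mvPolynomial (h : SchwarzData Ω A N) {K : ℂ → ℂ → ℂ}
    (hKb : ∀ w ∈ Ω, BddHol Ω fun z => K z w)
    (hKsymm : ∀ z ∈ Ω, ∀ w ∈ Ω, conj (K z w) = K w z)
    (hK : ∀ f : ℂ → ℂ, BergmanFun Ω f → ∀ w ∈ Ω, f w = ∫ z in Ω, f z * conj (K z w)) :
    ∃ P Q : MvPolynomial (Fin 4) ℂ, ∃ a a' : ℂ[X], ∃ Z : Finset ℂ,
      a ≠ 0 ∧ a' ≠ 0 ∧ (∀ ζ ∈ Z, ζ ∈ Ω) ∧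
      (∀ x, MvPolynomial.eval x Q =
        a.eval (x 1) * (x 1 - x 3) ^ 2 * (a'.eval (x 2) * ∏ ζ ∈ Z, (x 2 - ζ) ^ 2)) ∧
      ∀ z ∈ Ω, A.eval z ≠ 0 → ∀ w ∈ Ω, A.eval w ≠ 0 →
        K z w * MvPolynomial.eval ![z, schwarzNum Ω A N z / A.eval z,
          conj (schwarzNum Ω A N w / A.eval w), conj w] Q =
        MvPolynomial.eval ![z, schwarzNum Ω A N z / A.eval z,
          conj (schwarzNum Ω A N w / A.eval w), conj w] P := by
  classical
  obtain ⟨a, ha, D, hD⟩ := h.exists_kernel_eq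
  obtain ⟨Z, hZ, e, he⟩ := h.exists_interpolation D
  set S : ℂ → ℂ := fun z => schwarzNum Ω A N z / A.eval z with hS
  have hD' : ∀ w, ∃ c : Fin A.natDegree → ℂ[X], w ∈ Ω → (∀ j, (c j).natDegree ≤ D) ∧
      ∀ z ∈ Ω, A.eval z ≠ 0 → a.eval (S z) * (S z - conj w) ^ 2 * K z w =
        ∑ j, (c j).eval (S z) * z ^ (j : ℕ) := by
    intro w
    by_cases hw : w ∈ Ω
    · obtain ⟨c, hc⟩ := hD w hw _ (hKb w hw) fun f hf => hK f hf w hw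
      exact ⟨c, fun _ => hc⟩
    · exact ⟨0, fun hw' => absurd hw' hw⟩
  choose c hc using hD'
  set ac : ℂ[X] := a.map (starRingEnd ℂ) with hac
  have hconj : ∀ (p : ℂ[X]) (t : ℂ), (p.map (starRingEnd ℂ)).eval (conj t) = conj (p.eval t) :=
    fun p t => by rw [eval_map, eval₂_at_apply]
  set V := fun i : Fin 4 => (MvPolynomial.X i : MvPolynomial (Fin 4) ℂ) with hV
  refine ⟨∑ d : Fin (D + 1), ∑ j : Fin A.natDegree, ∑ ζ ∈ Z,
      MvPolynomial.C (e d j ζ * a.eval (S ζ)) * (MvPolynomial.C (S ζ) - V 3) ^ 2 *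
        (V 1 ^ (d : ℕ) * V 0 ^ (j : ℕ)) * ((∏ ζ' ∈ Z.erase ζ, (V 2 - MvPolynomial.C ζ') ^ 2) *
        ∑ j' : Fin A.natDegree, aeval (V 2) ((c ζ j').map (starRingEnd ℂ)) * V 3 ^ (j' : ℕ)),
    aeval (V 1) a * (V 1 - V 3) ^ 2 *
      (aeval (V 2) ac * ∏ ζ ∈ Z, (V 2 - MvPolynomial.C ζ) ^ 2),
    a, ac, Z, ha, (Polynomial.map_ne_zero_iff (starRingEnd ℂ).injective).2 ha,
    fun ζ hζ => (hZ ζ hζ).1, fun x => ?_, fun z hz hAz w hw hAw => ?_⟩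
  · simp only [hV, map_mul, map_pow, map_sub, map_prod, MvPolynomial.eval_X, MvPolynomial.eval_C,
      eval_mvPolynomial_aeval_X]
  · simp only [hV, map_mul, map_pow, map_sub, map_prod, map_sum, MvPolynomial.eval_X,
      MvPolynomial.eval_C, eval_mvPolynomial_aeval_X, Matrix.cons_val]
    have hS' : ∀ z, schwarzNum Ω A N z / A.eval z = S z := fun _ => rfl
    simp only [hS']
    have h1 : ∀ ζ ∈ Z, ac.eval (conj (S w)) * (conj (S w) - ζ) ^ 2 * K ζ w =
        ∑ j' : Fin A.natDegree, ((c ζ j').map (starRingEnd ℂ)).eval (conj (S w)) *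
          conj w ^ (j' : ℕ) := by
      intro ζ hζ
      have h2 := congrArg conj ((hc ζ (hZ ζ hζ).1).2 w hw hAw)
      rw [map_mul, map_mul, map_pow, map_sub, conj_conj, hKsymm w hw ζ (hZ ζ hζ).1, map_sum] at h2
      rw [hac, hconj, h2]
      simp only [map_mul, map_pow, hconj]
    have h3 : ∀ z ∈ Ω, A.eval z ≠ 0 → a.eval (S z) * (S z - conj w) ^ 2 * K z w =
        ∑ d : Fin (D + 1), ∑ j : Fin A.natDegree,
          (c w j).coeff d * (S z ^ (d : ℕ) * z ^ (j : ℕ)) := by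
      intro z hz hAz
      rw [(hc w hw).2 z hz hAz, Finset.sum_comm]
      refine Finset.sum_congr rfl fun j _ => ?_
      rw [eval_eq_sum_range' (Nat.lt_succ_of_le ((hc w hw).1 j)), Finset.sum_range, Finset.sum_mul]
      exact Finset.sum_congr rfl fun d _ => by ring
    have h4 : ∀ (d : Fin (D + 1)) (j : Fin A.natDegree), (c w j).coeff d =
        ∑ ζ ∈ Z, e d j ζ * (a.eval (S ζ) * (S ζ - conj w) ^ 2 * K ζ w) := by
      intro d j
      rw [he (fun d j => (c w j).coeff d) d j]
      refine Finset.sum_congr rfl fun ζ hζ => ?_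
      rw [h3 ζ (hZ ζ hζ).1 (hZ ζ hζ).2]
    calc _ = (a.eval (S z) * (S z - conj w) ^ 2 * K z w) *
          (ac.eval (conj (S w)) * ∏ ζ ∈ Z, (conj (S w) - ζ) ^ 2) := by ring
      _ = _ := by
        rw [h3 z hz hAz, Finset.sum_mul]
        refine Finset.sum_congr rfl fun d _ => ?_
        rw [Finset.sum_mul]
        refine Finset.sum_congr rfl fun j _ => ?_
        rw [h4, Finset.sum_mul, Finset.sum_mul]
        refine Finset.sum_congr rfl fun ζ hζ => ?_
        rw [← h1 ζ hζ, ← Finset.mul_prod_erase Z _ hζ]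
        ring

theorem frontier_infinite {Ω : Set ℂ} (ho : IsOpen Ω) (hb : Bornology.IsBounded Ω)
    (hne : Ω.Nonempty) : (frontier Ω).Infinite := by
  intro hfin
  have hconn : IsConnected (frontier Ω)ᶜ :=
    hfin.countable.isConnected_compl_of_one_lt_rank (by simp)
  have h1 : Ω ⊆ (frontier Ω)ᶜ := fun z hz hz' => (ho.frontier_eq ▸ hz').2 hz
  have h2 : ((closure Ω)ᶜ).Nonempty := by
    by_contra hcon
    rw [not_nonempty_iff_eq_empty, compl_empty_iff] at hcon
    exact noncompact_univ ℂ (hcon ▸ hb.isCompact_closure)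
  have h3 : (closure Ω)ᶜ ⊆ (frontier Ω)ᶜ := compl_subset_compl.2 frontier_subset_closure
  have h4 : (frontier Ω)ᶜ ⊆ Ω ∪ (closure Ω)ᶜ := by
    intro z hz
    by_contra hcon
    rw [mem_union, not_or, mem_compl_iff, not_not] at hcon
    exact hz (ho.frontier_eq ▸ ⟨hcon.2, hcon.1⟩)
  obtain ⟨z, -, hz, hz'⟩ := hconn.isPreconnected Ω (closure Ω)ᶜ ho isClosed_closure.isOpen_compl h4
    (by rwa [inter_eq_self_of_subset_right h1]) (by rwa [inter_eq_self_of_subset_right h3])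
  exact hz' (subset_closure hz)

end SchwarzData

/-- on the boundary, the (continuously extended) Bergman kernel of a quadrature
domain of finite area is a rational function of `z`, `conj z`, `w`, `conj w` off the boundary
diagonal. -/
theorem stmt_9 (Ω : Set ℂ) (hΩ : IsFinConnDomain Ω) (hA : volume Ω < ⊤)
    (hq : IsQuadratureDomain Ω)
    (K : ℂ → ℂ → ℂ)
    (hK1 : ∀ w ∈ Ω, BergmanFun Ω (fun z => K z w))
    (hK2 : ∀ f : ℂ → ℂ, BergmanFun Ω f → ∀ w ∈ Ω, f w = ∫ z in Ω, f z * conj (K z w))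
    (Khat : ℂ × ℂ → ℂ)
    (hKhatc : ContinuousOn Khat
      ((closure Ω ×ˢ closure Ω) \ {p : ℂ × ℂ | p.1 = p.2 ∧ p.1 ∈ frontier Ω}))
    (hKhat : ∀ z ∈ Ω, ∀ w ∈ Ω, Khat (z, w) = K z w) :
    ∃ P Q : MvPolynomial (Fin 4) ℂ,
      (∃ z ∈ frontier Ω, ∃ w ∈ frontier Ω, z ≠ w ∧
        MvPolynomial.eval ![z, conj z, w, conj w] Q ≠ 0) ∧
      ∀ z ∈ frontier Ω, ∀ w ∈ frontier Ω, z ≠ w →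
        Khat (z, w) * MvPolynomial.eval ![z, conj z, w, conj w] Q =
          MvPolynomial.eval ![z, conj z, w, conj w] P := by
  obtain ⟨A, N, h⟩ := exists_schwarzData hΩ hA hq
  have hfr : ∀ z ∈ frontier Ω, z ∉ Ω := fun z hz hz' => (h.isOpen.frontier_eq ▸ hz).2 hz'
  have hKb : ∀ w ∈ Ω, BddHol Ω fun z => K z w := by
    intro w hw
    have h1 : ContinuousOn (fun z => Khat (z, w)) (closure Ω) := by
      refine hKhatc.comp (f := fun z => (z, w)) (by fun_prop) fun z hz => ?_
      refine ⟨⟨hz, subset_closure hw⟩, fun h2 => hfr _ h2.2 ?_⟩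
      rw [h2.1]
      exact hw
    obtain ⟨M, hM⟩ := h.isBounded.isCompact_closure.exists_bound_of_continuousOn h1
    exact ⟨(hK1 w hw).1, M, fun z hz => by
      change ‖K z w‖ ≤ M
      rw [← hKhat z hz w hw]
      exact hM z (subset_closure hz)⟩
  have hKsymm : ∀ z ∈ Ω, ∀ w ∈ Ω, conj (K z w) = K w z := by
    intro z hz w hw
    rw [hK2 _ (hK1 w hw) z hz, ← integral_conj, hK2 _ (hK1 z hz) w hw]
    congr 1
    funext ζ
    rw [map_mul, conj_conj, mul_comm]
  obtain ⟨P, Q, a, a', Z, ha, ha', hZ, hQ, hPQ⟩ := h.exists_mvPolynomial hKb hKsymm hK2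
  refine ⟨P, Q, ?_, fun z hz w hw hzw => ?_⟩
  · have hinf := SchwarzData.frontier_infinite h.isOpen h.isBounded h.isConnected.nonempty
    have hfin : {z : ℂ | a.eval (conj z) = 0}.Finite := by
      have := (finite_setOfPred_isRoot ha).preimage (f := fun z : ℂ => conj z)
        (starRingEnd ℂ).injective.injOn
      exact this
    have hfin' : {z : ℂ | a'.eval z = 0}.Finite := finite_setOfPred_isRoot ha'
    obtain ⟨z, hz, hz'⟩ := (hinf.sdiff hfin).nonempty
    obtain ⟨w, hw, hw'⟩ := (hinf.sdiff (hfin'.union (finite_singleton z))).nonempty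
    rw [mem_union, not_or] at hw'
    have hzw : z ≠ w := fun h1 => hw'.2 h1.symm
    refine ⟨z, hz, w, hw, hzw, ?_⟩
    rw [hQ]
    refine mul_ne_zero (mul_ne_zero hz' (pow_ne_zero 2 (sub_ne_zero.2 fun h1 =>
      hzw ((starRingEnd ℂ).injective h1)))) (mul_ne_zero hw'.1 (Finset.prod_ne_zero_iff.2
        fun ζ hζ => pow_ne_zero 2 (sub_ne_zero.2 fun h1 => hfr w hw ?_)))
    change w = ζ at h1
    exact h1 ▸ hZ ζ hζ
  · set S : ℂ → ℂ := fun z => schwarzNum Ω A N z / A.eval z with hS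
    have hAz : ∀ z ∈ frontier Ω, A.eval z ≠ 0 := fun z hz h1 => hfr z hz (h.mem_of_root z h1)
    have hSz : ∀ z ∈ frontier Ω, S z = conj z := fun z hz => by
      simp only [hS, h.schwarzNum_of_notMem (hfr z hz)]
      rw [mul_div_cancel_left₀ _ (hAz z hz)]
    have hSc : ∀ z ∈ frontier Ω, ContinuousAt S z := fun z hz =>
      h.continuous_schwarzNum.continuousAt.div A.continuous.continuousAt (hAz z hz)
    set l : Filter (ℂ × ℂ) := 𝓝[Ω ×ˢ Ω] (z, w) with hl
    have hne : l.NeBot := mem_closure_iff_nhdsWithin_neBot.1 (by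
      rw [closure_prod_eq]
      exact ⟨frontier_subset_closure hz, frontier_subset_closure hw⟩)
    set F : ℂ × ℂ → Fin 4 → ℂ := fun p => ![p.1, S p.1, conj (S p.2), conj p.2] with hF
    have hFl : Tendsto F l (𝓝 ![z, conj z, w, conj w]) := by
      have h1 : Tendsto (fun p : ℂ × ℂ => S p.1) l (𝓝 (conj z)) := by
        have h3 : ContinuousAt (fun p : ℂ × ℂ => S p.1) (z, w) :=
          ContinuousAt.comp (f := Prod.fst) (x := (z, w)) (hSc z hz) continuous_fst.continuousAt
        have h4 := h3.tendsto.mono_left (nhdsWithin_le_nhds (s := Ω ×ˢ Ω))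
        simpa only [hSz z hz] using h4
      have h2 : Tendsto (fun p : ℂ × ℂ => conj (S p.2)) l (𝓝 w) := by
        have h3 : ContinuousAt (fun p : ℂ × ℂ => S p.2) (z, w) :=
          ContinuousAt.comp (f := Prod.snd) (x := (z, w)) (hSc w hw) continuous_snd.continuousAt
        have h4 := (continuous_conj.continuousAt.comp h3).tendsto.mono_left
          (nhdsWithin_le_nhds (s := Ω ×ˢ Ω))
        simpa only [Function.comp_def, hSz w hw, conj_conj] using h4
      have h5 : Tendsto (fun p : ℂ × ℂ => p.1) l (𝓝 z) :=
        continuous_fst.continuousAt.tendsto.mono_left nhdsWithin_le_nhds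
      have h6 : Tendsto (fun p : ℂ × ℂ => conj p.2) l (𝓝 (conj w)) :=
        (continuous_conj.comp continuous_snd).continuousAt.tendsto.mono_left nhdsWithin_le_nhds
      refine tendsto_pi_nhds.2 fun i => ?_
      fin_cases i
      · exact h5
      · exact h1
      · exact h2
      · exact h6
    have hKl : Tendsto Khat l (𝓝 (Khat (z, w))) := by
      refine (hKhatc (z, w) ⟨⟨frontier_subset_closure hz, frontier_subset_closure hw⟩,
        fun h1 => hzw h1.1⟩).tendsto.mono_left (nhdsWithin_mono _ ?_)
      exact fun p hp => ⟨⟨subset_closure hp.1, subset_closure hp.2⟩, fun h1 => hfr _ h1.2 hp.1⟩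
    have hev : ∀ᶠ p in l, Khat p * MvPolynomial.eval (F p) Q = MvPolynomial.eval (F p) P := by
      have h1 : ∀ᶠ p : ℂ × ℂ in l, A.eval p.1 ≠ 0 :=
        ((show ContinuousAt (fun p : ℂ × ℂ => A.eval p.1) (z, w) from
          (A.continuous.comp continuous_fst).continuousAt).eventually_ne (hAz z hz)).filter_mono
          nhdsWithin_le_nhds
      have h2 : ∀ᶠ p : ℂ × ℂ in l, A.eval p.2 ≠ 0 :=
        ((show ContinuousAt (fun p : ℂ × ℂ => A.eval p.2) (z, w) from
          (A.continuous.comp continuous_snd).continuousAt).eventually_ne (hAz w hw)).filter_mono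
          nhdsWithin_le_nhds
      filter_upwards [h1, h2, self_mem_nhdsWithin] with p hp1 hp2 hp
      rw [show Khat p = K p.1 p.2 from hKhat _ hp.1 _ hp.2]
      exact hPQ _ hp.1 hp1 _ hp.2 hp2
    have hcont : ∀ R : MvPolynomial (Fin 4) ℂ, Tendsto (fun p => MvPolynomial.eval (F p) R) l
        (𝓝 (MvPolynomial.eval ![z, conj z, w, conj w] R)) := fun R =>
      ((MvPolynomial.continuous_eval R).tendsto _).comp hFl
    exact tendsto_nhds_unique ((hKl.mul (hcont Q)).congr' hev) (hcont P)
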